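/- Let p be an odd prime number and set P = 2p or p so that P ≢ ±1 (mod 9). Let ε = α + βπ + γπ² > 1 (π = P^{1/3}) be the fundamental unit of ℚ(π) with α, β, γ ∈ ℤ, and set ι = 1 if β ≢ 0 (mod p) or β ≡ γ ≡ 0 (mod p), and ι = 2 if β ≡ 0 (mod p) and γ ≢ 0 (mod p). Let n ≥ 5 be an odd integer divisible by p^ι. Then there exist infinitely many (n−3)/2-tuples of pairs of integers (b_j, c_j) (1 ≤ j ≤ (n−3)/2) with the following property: there exist infinitely many L ∈ ℤ such that the equation (X³ + P^ι Y³)·∏_{j=1}^{(n−3)/2}(b_j²X² + b_j c_j XY + c_j²Y²) = L Z^n defines a non-singular plane projective curve of degree n which violates the local-global principle. Moreover, there exists a set of such (n−3)/2-tuples which gives infinitely many classes of such curves of degree n that are pairwise non-isomorphic over ℂ. -/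

import Mathlib

open MvPolynomial

/-- The real cube root of a natural number. -/
noncomputable def cbrt (P : ℕ) : ℝ := (P : ℝ) ^ ((1 : ℝ) / 3)

/-- `u` belongs to the order `ℤ[P^{1/3}]` of `ℚ(P^{1/3})`. -/
def InOrder (P : ℕ) (u : ℝ) : Prop :=
  ∃ x y z : ℤ, u = (x : ℝ) + (y : ℝ) * cbrt P + (z : ℝ) * (cbrt P) ^ 2

/-- `u` is a unit of the order `ℤ[P^{1/3}]`. -/
def IsUnitOfOrder (P : ℕ) (u : ℝ) : Prop :=
  InOrder P u ∧ ∃ v : ℝ, InOrder P v ∧ u * v = 1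

/-- `ε` is the fundamental unit of `ℚ(P^{1/3})` (whose ring of integers is `ℤ[P^{1/3}]`
since `P ≢ ±1 mod 9`): the smallest unit greater than `1`, equivalently the generator
greater than `1` of the unit group modulo `±1`. -/
def IsFundamentalUnit (P : ℕ) (ε : ℝ) : Prop :=
  IsUnitOfOrder P ε ∧ 1 < ε ∧ ∀ u : ℝ, IsUnitOfOrder P u → 1 < u → ε ≤ u

/-- The equation `(X³+aY³) ∏_j (b_j²X² + b_j c_j XY + c_j² Y²) = L Z^n`, evaluated
in a commutative ring `K`; here `bc j = (b_j, c_j)`. -/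
def EqnHolds {K : Type} [CommRing K] (a L : ℤ) (n : ℕ) {m : ℕ} (bc : Fin m → ℤ × ℤ)
    (X Y Z : K) : Prop :=
  (X ^ 3 + (a : K) * Y ^ 3) *
      ∏ j : Fin m, (((bc j).1 : K) ^ 2 * X ^ 2 + ((bc j).1 : K) * ((bc j).2 : K) * X * Y
        + ((bc j).2 : K) ^ 2 * Y ^ 2)
    = (L : K) * Z ^ n

/-- The homogeneous equation `(X³+aY³) ∏_j (b_j²X² + b_j c_j XY + c_j² Y²) = L Z^n`
violates the local-global principle: it has nontrivial solutions over `ℝ` and over `ℚ_l`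
for every prime `l`, but only the trivial solution over `ℚ`. -/
def ViolatesLGP (a L : ℤ) (n : ℕ) {m : ℕ} (bc : Fin m → ℤ × ℤ) : Prop :=
  (∃ X Y Z : ℝ, (X, Y, Z) ≠ (0, 0, 0) ∧ EqnHolds a L n bc X Y Z) ∧
  (∀ (l : ℕ) [Fact l.Prime], ∃ X Y Z : ℚ_[l], (X, Y, Z) ≠ (0, 0, 0) ∧ EqnHolds a L n bc X Y Z) ∧
  (∀ X Y Z : ℚ, EqnHolds a L n bc X Y Z → (X, Y, Z) = (0, 0, 0))

/-- The homogeneous polynomial `(X³+aY³) ∏_j (b_j²X² + b_j c_j XY + c_j² Y²) - L Z^n`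
over `ℂ`. -/
noncomputable def curvePoly (a L : ℤ) (n : ℕ) {m : ℕ} (bc : Fin m → ℤ × ℤ) :
    MvPolynomial (Fin 3) ℂ :=
  (X 0 ^ 3 + C (a : ℂ) * X 1 ^ 3) *
      ∏ j : Fin m, (C (((bc j).1 : ℂ)) ^ 2 * X 0 ^ 2
        + C (((bc j).1 : ℂ)) * C (((bc j).2 : ℂ)) * X 0 * X 1
        + C (((bc j).2 : ℂ)) ^ 2 * X 1 ^ 2)
    - C (L : ℂ) * X 2 ^ n

/-- A homogeneous polynomial `F` defines a non-singular plane projective curve: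
`F` and its partial derivatives have no common zero other than the origin over `ℂ`. -/
def IsNonsingular (F : MvPolynomial (Fin 3) ℂ) : Prop :=
  ∀ v : Fin 3 → ℂ, v ≠ 0 →
    ¬ (eval v F = 0 ∧ ∀ i : Fin 3, eval v (pderiv i F) = 0)

/-- Dehomogenization at `Z = 1` of the defining polynomial of the plane curve
`(X³+aY³) ∏_j (b_j²X² + b_j c_j XY + c_j² Y²) = L Z^n`, over `ℂ`. -/
noncomputable def affinePoly (a L : ℤ) {m : ℕ} (bc : Fin m → ℤ × ℤ) :
    MvPolynomial (Fin 2) ℂ :=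
  (X 0 ^ 3 + C (a : ℂ) * X 1 ^ 3) *
      ∏ j : Fin m, (C (((bc j).1 : ℂ)) ^ 2 * X 0 ^ 2
        + C (((bc j).1 : ℂ)) * C (((bc j).2 : ℂ)) * X 0 * X 1
        + C (((bc j).2 : ℂ)) ^ 2 * X 1 ^ 2)
    - C (L : ℂ)

/-- The function field over `ℂ` of the plane curve whose (irreducible) dehomogenized
defining polynomial is `f`. -/
noncomputable abbrev FunctionFieldOf (f : MvPolynomial (Fin 2) ℂ) : Type :=
  FractionRing (MvPolynomial (Fin 2) ℂ ⧸ Ideal.span {f})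

/-- Two non-singular projective plane curves over `ℂ`, given by the dehomogenized
defining polynomials `f` and `g`, are isomorphic as algebraic curves over `ℂ`
if and only if their function fields are isomorphic as `ℂ`-algebras. -/
def CurvesIsomorphic (f g : MvPolynomial (Fin 2) ℂ) : Prop :=
  Nonempty (FunctionFieldOf f ≃ₐ[ℂ] FunctionFieldOf g)

/-- The equation `(X³+aY³) ∏_j (b_j²X² + b_j c_j XY + c_j² Y²) = L Z^n` defines a
non-singular plane projective curve of degree `n` which violates the
local-global principle. -/
def GoodCurve (a : ℤ) (n : ℕ) {m : ℕ} (bc : Fin m → ℤ × ℤ) (L : ℤ) : Prop :=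
  ViolatesLGP a L n bc ∧ (curvePoly a L n bc).totalDegree = n ∧
    IsNonsingular (curvePoly a L n bc)

/-- The ring of Eisenstein integers `ℤ[ω]`, `ω² = -1 - ω`. -/
abbrev Eis : Type := QuadraticAlgebra ℤ (-1) (-1)

namespace Eis

/-- The norm form `u² - uv + v²`, as a natural number. -/
def nrm (z : Eis) : ℕ := (z.re ^ 2 - z.re * z.im + z.im ^ 2).natAbs

theorem nrm_cast (z : Eis) : (nrm z : ℤ) = z.re ^ 2 - z.re * z.im + z.im ^ 2 := by
  rw [nrm, Int.natAbs_of_nonneg]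
  nlinarith [sq_nonneg (z.re - z.im), sq_nonneg z.re, sq_nonneg z.im]

theorem nrm_mul (z w : Eis) : nrm (z * w) = nrm z * nrm w := by
  zify
  simp only [nrm_cast, QuadraticAlgebra.re_mul, QuadraticAlgebra.im_mul]
  ring

theorem nrm_eq_zero {z : Eis} : nrm z = 0 ↔ z = 0 := by
  constructor
  · intro h
    have h' : z.re ^ 2 - z.re * z.im + z.im ^ 2 = 0 := by
      rw [← nrm_cast, h]; rfl
    have h1 : z.im ^ 2 = 0 := by
      nlinarith [sq_nonneg (2 * z.re - z.im), sq_nonneg z.im]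
    have h2 : z.re ^ 2 = 0 := by
      nlinarith [sq_nonneg (2 * z.im - z.re), sq_nonneg z.re]
    ext
    · simpa using h2
    · simpa using h1
  · rintro rfl
    simp [nrm]

instance : NoZeroDivisors Eis where
  eq_zero_or_eq_zero_of_mul_eq_zero {z w} h := by
    rw [← nrm_eq_zero, nrm_mul, mul_eq_zero] at h
    simpa only [nrm_eq_zero] using h

instance : IsDomain Eis := NoZeroDivisors.to_isDomain _

theorem exists_quotient (z w : Eis) (hw : w ≠ 0) : ∃ q : Eis, nrm (z - w * q) < nrm w := by
  have hN : 0 < nrm w := Nat.pos_of_ne_zero (by rwa [Ne, nrm_eq_zero])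
  have hNz : (0 : ℚ) < nrm w := by exact_mod_cast hN
  set s : Eis := z * star w with hs
  refine ⟨⟨round ((s.re : ℚ) / nrm w), round ((s.im : ℚ) / nrm w)⟩, ?_⟩
  set u := round ((s.re : ℚ) / nrm w) with hu
  set v := round ((s.im : ℚ) / nrm w) with hv
  have h1 := abs_sub_round ((s.re : ℚ) / nrm w)
  have h2 := abs_sub_round ((s.im : ℚ) / nrm w)
  rw [← hu] at h1
  rw [← hv] at h2
  have hstar : nrm (star w) = nrm w := by
    zify; rw [nrm_cast, nrm_cast]; simp; ring
  have hww : w * star w = (⟨(nrm w : ℤ), 0⟩ : Eis) := by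
    rw [nrm_cast]
    ext
    · simp; ring
    · simp; ring
  have key : nrm (s - ⟨(nrm w : ℤ), 0⟩ * ⟨u, v⟩) < nrm w * nrm w := by
    zify
    rw [nrm_cast]
    simp only [QuadraticAlgebra.re_sub, QuadraticAlgebra.im_sub, QuadraticAlgebra.re_mul,
      QuadraticAlgebra.im_mul]
    have e1 : |(s.re : ℚ) - nrm w * u| ≤ nrm w / 2 := by
      have : (s.re : ℚ) - nrm w * u = nrm w * ((s.re : ℚ) / nrm w - u) := by field_simp
      rw [this, abs_mul, abs_of_pos hNz]
      nlinarith
    have e2 : |(s.im : ℚ) - nrm w * v| ≤ nrm w / 2 := by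
      have : (s.im : ℚ) - nrm w * v = nrm w * ((s.im : ℚ) / nrm w - v) := by field_simp
      rw [this, abs_mul, abs_of_pos hNz]
      nlinarith
    rify at *
    have f1 := abs_le.1 e1
    have f2 := abs_le.1 e2
    obtain ⟨f11, f12⟩ := f1
    obtain ⟨f21, f22⟩ := f2
    simp only [zero_mul, mul_zero, add_zero]
    generalize (s.re : ℝ) - (nrm w : ℝ) * u = A at *
    generalize (s.im : ℝ) - (nrm w : ℝ) * v = B at *
    nlinarith [mul_nonneg (sub_nonneg.2 f12) (sub_nonneg.2 f11),
      mul_nonneg (sub_nonneg.2 f22) (sub_nonneg.2 f21),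
      mul_nonneg (sub_nonneg.2 f12) (sub_nonneg.2 f22),
      mul_nonneg (sub_nonneg.2 f11) (sub_nonneg.2 f21), mul_pos hNz hNz]
  have h3 : nrm (z - w * ⟨u, v⟩) * nrm (star w) < nrm w * nrm w := by
    rw [← nrm_mul]
    convert key using 2
    rw [← hww, hs]; ring
  rw [hstar] at h3
  exact lt_of_mul_lt_mul_right h3 (Nat.zero_le _)

noncomputable instance : EuclideanDomain Eis where
  quotient z w := open Classical in if h : w = 0 then 0 else (exists_quotient z w h).choose
  quotient_zero z := by simp
  remainder z w := open Classical in
    z - w * (if h : w = 0 then 0 else (exists_quotient z w h).choose)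
  quotient_mul_add_remainder_eq z w := by ring
  r z w := nrm z < nrm w
  r_wellFounded := InvImage.wf nrm wellFounded_lt
  remainder_lt z w hw := by
    simp only [dif_neg hw]
    exact (exists_quotient z w hw).choose_spec
  mul_left_not_lt z w hw := by
    rw [nrm_mul, not_lt]
    exact Nat.le_mul_of_pos_right _ (Nat.pos_of_ne_zero (by rwa [Ne, nrm_eq_zero]))

theorem finite_nrm_le (K : ℕ) : {z : Eis | nrm z ≤ K}.Finite := by
  have h : (((Set.Icc (-2 * K : ℤ) (2 * K)) ×ˢ (Set.Icc (-2 * K : ℤ) (2 * K))).image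
      (fun q : ℤ × ℤ ↦ (⟨q.1, q.2⟩ : Eis))).Finite :=
    ((Set.finite_Icc _ _).prod (Set.finite_Icc _ _)).image _
  refine h.subset fun z hz ↦ ⟨(z.re, z.im), ?_, rfl⟩
  have hz' : z.re ^ 2 - z.re * z.im + z.im ^ 2 ≤ K := by
    rw [← nrm_cast]; exact_mod_cast hz
  have h1 : z.re ^ 2 ≤ 2 * K := by nlinarith [sq_nonneg (z.re - 2 * z.im), sq_nonneg z.im]
  have h2 : z.im ^ 2 ≤ 2 * K := by nlinarith [sq_nonneg (z.im - 2 * z.re), sq_nonneg z.re]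
  have h3 := Int.le_self_sq z.re
  have h4 := Int.le_self_sq z.im
  have h5 := Int.le_self_sq (-z.re)
  have h6 := Int.le_self_sq (-z.im)
  simp only [neg_sq] at h5 h6
  exact ⟨⟨by linarith, by linarith⟩, ⟨by linarith, by linarith⟩⟩

/-- If all primes not dividing `N` divide `B` to an order divisible by `p`, then `B` is a `p`-th
power up to a divisor of `N ^ (p - 1)`. -/
theorem exists_eq_mul_pow {p : ℕ} (hp : 0 < p) {N B : Eis} (hB : B ≠ 0)
    (h : ∀ π : Eis, Prime π → ¬ π ∣ N → p ∣ multiplicity π B) :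
    ∃ d w : Eis, B = d * w ^ p ∧ d ∣ N ^ (p - 1) := by
  induction B using UniqueFactorizationMonoid.induction_on_coprime with
  | h0 => exact absurd rfl hB
  | h1 hx =>
    exact ⟨_, 1, by simp, hx.dvd⟩
  | hpr k hq =>
    rename_i π
    by_cases hd : π ∣ N
    · refine ⟨π ^ (k % p), π ^ (k / p), ?_, ?_⟩
      · rw [← pow_mul, ← pow_add, mul_comm, Nat.mod_add_div]
      · exact (pow_dvd_pow_of_dvd hd _).trans
          (pow_dvd_pow _ (Nat.le_sub_one_of_lt (Nat.mod_lt _ hp)))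
    · have := h π hq hd
      rw [multiplicity_pow_self_of_prime hq] at this
      obtain ⟨t, rfl⟩ := this
      exact ⟨1, π ^ t, by rw [one_mul, ← pow_mul, mul_comm], one_dvd _⟩
  | hcp hrel ihx ihy =>
    rename_i x y
    have hx : x ≠ 0 := left_ne_zero_of_mul hB
    have hy : y ≠ 0 := right_ne_zero_of_mul hB
    have hfin : ∀ π : Eis, Prime π → FiniteMultiplicity π (x * y) := fun π hπ ↦
      FiniteMultiplicity.of_prime_left hπ hB
    have hx' : ∀ π : Eis, Prime π → ¬ π ∣ N → p ∣ multiplicity π x := by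
      intro π hπ hπN
      by_cases hd : π ∣ x
      · have hdy : ¬ π ∣ y := fun h' ↦ hπ.not_isUnit (hrel hd h')
        have := h π hπ hπN
        rwa [multiplicity_mul hπ (hfin π hπ), multiplicity_eq_zero.2 hdy, add_zero] at this
      · rw [multiplicity_eq_zero.2 hd]; exact dvd_zero _
    have hy' : ∀ π : Eis, Prime π → ¬ π ∣ N → p ∣ multiplicity π y := by
      intro π hπ hπN
      by_cases hd : π ∣ y
      · have hdx : ¬ π ∣ x := fun h' ↦ hπ.not_isUnit (hrel h' hd)
        have := h π hπ hπN
        rwa [multiplicity_mul hπ (hfin π hπ), multiplicity_eq_zero.2 hdx, zero_add] at this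
      · rw [multiplicity_eq_zero.2 hd]; exact dvd_zero _
    obtain ⟨d, w, h1, h2⟩ := ihx hx hx'
    obtain ⟨d', w', h1', h2'⟩ := ihy hy hy'
    refine ⟨d * d', w * w', ?_, ?_⟩
    · rw [mul_pow]; nth_rewrite 1 [h1]; nth_rewrite 1 [h1']; ring
    · refine IsRelPrime.mul_dvd (fun u hu hu' ↦ hrel (hu.trans ?_) (hu'.trans ?_)) h2 h2'
      · exact Dvd.intro _ h1.symm
      · exact Dvd.intro _ h1'.symm

end Eis

section DirichletLowerBound

open ArithmeticFunction ArithmeticFunction.vonMangoldt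

/-- The primes larger than `N` in the residue class `b` modulo `q`. -/
def primesInClass {q : ℕ} (b : ZMod q) (N : ℕ) : Set ℕ :=
  {l | l.Prime ∧ N < l ∧ (l : ZMod q) = b}

theorem LSeries_ofReal (f : ℕ → ℝ) {x : ℝ} (hx : x ≠ 0) :
    LSeries (fun n ↦ (f n : ℂ)) x = ((∑' n, f n / (n : ℝ) ^ x : ℝ) : ℂ) := by
  rw [LSeries, Complex.ofReal_tsum]
  refine tsum_congr fun n ↦ ?_
  rcases eq_or_ne n 0 with rfl | hn
  · simp [LSeries.term, Real.zero_rpow hx]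
  · simp only [LSeries.term, if_neg hn, Complex.ofReal_div, Complex.ofReal_cpow n.cast_nonneg,
      Complex.ofReal_natCast]

theorem abscissa_indicator_le_one (P : Set ℕ) :
    LSeries.abscissaOfAbsConv (fun n ↦ ((P.indicator 1 n : ℝ) : ℂ)) ≤ 1 := by
  refine LSeries.abscissaOfAbsConv_le_of_le_const ⟨1, fun n _ ↦ ?_⟩
  by_cases h : n ∈ P <;> simp [h]

theorem summable_indicator_div (P : Set ℕ) {x : ℝ} (hx : 1 < x) :
    Summable fun n : ℕ ↦ P.indicator (1 : ℕ → ℝ) n / (n : ℝ) ^ x :=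
  LSeries.summable_real_of_abscissaOfAbsConv_lt
    ((abscissa_indicator_le_one P).trans_lt (by exact_mod_cast hx))

theorem hasDerivAt_indicator_series (P : Set ℕ) {x : ℝ} (hx : 1 < x) :
    HasDerivAt (fun y : ℝ ↦ ∑' n : ℕ, P.indicator (1 : ℕ → ℝ) n / (n : ℝ) ^ y)
      (-∑' n : ℕ, P.indicator (fun n : ℕ ↦ Real.log n) n / (n : ℝ) ^ x) x := by
  have h := (LSeries_hasDerivAt (f := fun n ↦ ((P.indicator 1 n : ℝ) : ℂ)) (s := (x : ℂ))
    ((abscissa_indicator_le_one P).trans_lt (by exact_mod_cast hx))).real_of_complex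
  have hlog : LSeries.logMul (fun n ↦ ((P.indicator 1 n : ℝ) : ℂ)) =
      fun n ↦ ((P.indicator (fun n : ℕ ↦ Real.log n) n : ℝ) : ℂ) := by
    ext n
    by_cases hn : n ∈ P <;> simp [LSeries.logMul, hn]
  rw [hlog, LSeries_ofReal _ (by positivity), ← Complex.ofReal_neg, Complex.ofReal_re] at h
  refine h.congr_of_eventuallyEq ?_
  filter_upwards [lt_mem_nhds hx] with y hy
  rw [LSeries_ofReal _ (by positivity), Complex.ofReal_re]

theorem summable_indicator_log_div (P : Set ℕ) {x : ℝ} (hx : 1 < x) :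
    Summable fun n : ℕ ↦ P.indicator (fun n : ℕ ↦ Real.log n) n / (n : ℝ) ^ x := by
  refine LSeries.summable_real_of_abscissaOfAbsConv_lt ?_
  have hlog : LSeries.logMul (fun n ↦ ((P.indicator 1 n : ℝ) : ℂ)) =
      fun n ↦ ((P.indicator (fun n : ℕ ↦ Real.log n) n : ℝ) : ℂ) := by
    ext n
    by_cases hn : n ∈ P <;> simp [LSeries.logMul, hn]
  rw [← hlog, LSeries.abscissaOfAbsConv_logMul]
  exact (abscissa_indicator_le_one P).trans_lt (by exact_mod_cast hx)

theorem exists_log_series_lower_bound {q : ℕ} [NeZero q] {b : ZMod q} (hb : IsUnit b) (N : ℕ) :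
    ∃ C : ℝ, ∀ x : ℝ, x ∈ Set.Ioc 1 2 → (q.totient : ℝ)⁻¹ / (x - 1) - C ≤
      ∑' n : ℕ, (primesInClass b N).indicator (fun n : ℕ ↦ Real.log n) n / (n : ℝ) ^ x := by
  obtain ⟨C, hC⟩ := LSeries_residueClass_lower_bound hb
  set g : ℕ → ℝ := fun n ↦ (if n.Prime then 0 else residueClass b n) / n with hg
  have hgs : Summable g := summable_residueClass_non_primes_div b
  set h : ℕ → ℝ := fun n ↦ if n ∈ Finset.range (N + 1) then vonMangoldt n else 0 with hh
  have hhs : Summable h := summable_of_ne_finset_zero (s := Finset.range (N + 1)) fun n hn ↦ by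
    simp only [hh, if_neg hn]
  have hh0 : ∀ n, 0 ≤ h n := fun n ↦ by
    simp only [hh]; split_ifs
    · exact vonMangoldt_nonneg
    · exact le_rfl
  have hg0 : ∀ n, 0 ≤ g n := fun n ↦ by
    simp only [hg]; split_ifs
    · simp
    · exact div_nonneg (residueClass_nonneg b n) n.cast_nonneg
  refine ⟨C + (∑' n, g n + ∑' n, h n), fun x hx ↦ ?_⟩
  have hT := summable_indicator_log_div (primesInClass b N) hx.1
  have hle : ∑' n, residueClass b n / (n : ℝ) ^ x ≤
      ∑' n : ℕ, ((primesInClass b N).indicator (fun n : ℕ ↦ Real.log n) n / (n : ℝ) ^ x +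
        (g n + h n)) := by
    refine Summable.tsum_le_tsum (fun n ↦ ?_) ?_ (hT.add (hgs.add hhs))
    · rcases Nat.eq_zero_or_pos n with rfl | hn
      · have := hg0 0
        have := hh0 0
        have h0 : (0:ℕ) ∉ primesInClass b N := fun h0 ↦ Nat.not_prime_zero h0.1
        simp only [residueClass_apply_zero, zero_div, Set.indicator_of_notMem h0]
        linarith
      have hn1 : (1 : ℝ) ≤ n := by exact_mod_cast hn
      have hnx : (n : ℝ) ≤ (n : ℝ) ^ x := by
        conv_lhs => rw [← Real.rpow_one (n : ℝ)]
        exact Real.rpow_le_rpow_of_exponent_le hn1 hx.1.le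
      have hnx1 : 1 ≤ (n : ℝ) ^ x := hn1.trans hnx
      have hind : 0 ≤ (primesInClass b N).indicator (fun n : ℕ ↦ Real.log n) n / (n : ℝ) ^ x := by
        refine div_nonneg (Set.indicator_nonneg (fun k _ ↦ Real.log_natCast_nonneg k) n) ?_
        positivity
      by_cases hp : n.Prime
      · by_cases hb' : (n : ZMod q) = b
        · by_cases hN : N < n
          · have hmem : n ∈ primesInClass b N := ⟨hp, hN, hb'⟩
            have : residueClass b n = Real.log n := by
              rw [residueClass, Set.indicator_of_mem (by exact hb'), vonMangoldt_apply_prime hp]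
            rw [Set.indicator_of_mem hmem, this]
            linarith [hg0 n, hh0 n]
          · have : residueClass b n / (n : ℝ) ^ x ≤ h n := by
              simp only [hh, if_pos (Finset.mem_range.2 (Nat.lt_succ_of_le (not_lt.1 hN)))]
              exact (div_le_self (residueClass_nonneg b n) hnx1).trans (residueClass_le b n)
            linarith [hg0 n]
        · have : residueClass b n = 0 := Set.indicator_of_notMem (by exact hb') _
          rw [this, zero_div]
          linarith [hg0 n, hh0 n]
      · have : residueClass b n / (n : ℝ) ^ x ≤ g n := by
          simp only [hg, if_neg hp]
          exact div_le_div_of_nonneg_left (residueClass_nonneg b n) (by positivity) hnx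
        linarith [hh0 n]
    · exact LSeries.summable_real_of_abscissaOfAbsConv_lt
        ((abscissaOfAbsConv_residueClass_le_one b).trans_lt (by exact_mod_cast hx.1))
  rw [hT.tsum_add (hgs.add hhs), hgs.tsum_add hhs] at hle
  linarith [hC hx]

theorem exists_prime_series_lower_bound {q : ℕ} [NeZero q] {b : ZMod q} (hb : IsUnit b) (N : ℕ) :
    ∃ C : ℝ, ∀ x : ℝ, x ∈ Set.Ioc 1 2 → -(q.totient : ℝ)⁻¹ * Real.log (x - 1) - C ≤
      ∑' n : ℕ, (primesInClass b N).indicator (1 : ℕ → ℝ) n / (n : ℝ) ^ x := by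
  obtain ⟨C, hC⟩ := exists_log_series_lower_bound hb N
  set S : ℝ → ℝ := fun x ↦ ∑' n : ℕ, (primesInClass b N).indicator (1 : ℕ → ℝ) n / (n : ℝ) ^ x
    with hS
  have hd : ∀ x : ℝ, 1 < x → HasDerivAt
      (fun y ↦ S y + (q.totient : ℝ)⁻¹ * Real.log (y - 1) - C * y)
      (-(∑' n : ℕ, (primesInClass b N).indicator (fun n : ℕ ↦ Real.log n) n / (n : ℝ) ^ x) +
        (q.totient : ℝ)⁻¹ * (1 / (x - 1)) - C * 1) x := fun x hx ↦
    ((hasDerivAt_indicator_series _ hx).add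
      ((((hasDerivAt_id x).sub_const 1).log (by simpa using (sub_pos.2 hx).ne')).const_mul _)).sub
      ((hasDerivAt_id x).const_mul C)
  have hanti : AntitoneOn (fun y ↦ S y + (q.totient : ℝ)⁻¹ * Real.log (y - 1) - C * y)
      (Set.Ioc 1 2) := by
    refine antitoneOn_of_deriv_nonpos (convex_Ioc 1 2)
      (fun x hx ↦ (hd x hx.1).continuousAt.continuousWithinAt) (fun x hx ↦ ?_) (fun x hx ↦ ?_)
    · rw [interior_Ioc] at hx
      exact (hd x hx.1).differentiableAt.differentiableWithinAt
    · rw [interior_Ioc] at hx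
      rw [(hd x hx.1).deriv]
      have := hC x ⟨hx.1, hx.2.le⟩
      rw [div_eq_mul_one_div] at this
      linarith
  refine ⟨|C| * 2 + |S 2 - C * 2|, fun x hx ↦ ?_⟩
  have h2 := hanti hx (⟨one_lt_two, le_rfl⟩ : (2 : ℝ) ∈ Set.Ioc (1 : ℝ) 2) hx.2
  simp only at h2
  norm_num at h2
  have h3 := neg_abs_le (S 2 - C * 2)
  have h4 : -(|C| * 2) ≤ C * x := by
    have := neg_abs_le C
    have h5 := abs_nonneg C
    nlinarith [hx.1, hx.2, neg_abs_le C, abs_nonneg C, mul_nonneg h5 (sub_nonneg.2 hx.2),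
      mul_nonneg (by linarith : 0 ≤ C + |C|) (by linarith [hx.1] : (0:ℝ) ≤ x)]
  have h6 : S x = ∑' n : ℕ, (primesInClass b N).indicator (1 : ℕ → ℝ) n / (n : ℝ) ^ x := rfl
  rw [← h6]
  linarith

end DirichletLowerBound

section IdealCounting

open NumberField

variable (F : Type*) [Field F] [NumberField F]

/-- The number of ideals of norm `n`. -/
noncomputable def idealCount (n : ℕ) : ℕ := Nat.card {I : Ideal (𝓞 F) // Ideal.absNorm I = n}

theorem idealCount_one : idealCount F 1 = 1 := by
  rw [idealCount, Nat.card_eq_one_iff_unique]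
  refine ⟨⟨fun I J ↦ Subtype.ext ?_⟩, ⟨⟨⊤, Ideal.absNorm_top⟩⟩⟩
  rw [Ideal.absNorm_eq_one_iff.1 I.2, Ideal.absNorm_eq_one_iff.1 J.2]

theorem idealCount_mul_le {l M : ℕ} (hl : l.Prime) (hlM : ¬ l ∣ M) :
    idealCount F l * idealCount F M ≤ idealCount F (l * M) := by
  have : Finite {I : Ideal (𝓞 F) // Ideal.absNorm I = l * M} :=
    Ideal.finite_setOfPred_absNorm_eq (l * M)
  rw [idealCount, idealCount, ← Nat.card_prod]
  refine Nat.card_le_card_of_injective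
    (fun q ↦ (⟨q.1.1 * q.2.1, by rw [map_mul, q.1.2, q.2.2]⟩ :
      {I : Ideal (𝓞 F) // Ideal.absNorm I = l * M})) ?_
  rintro ⟨⟨I, hI⟩, ⟨J, hJ⟩⟩ ⟨⟨I', hI'⟩, ⟨J', hJ'⟩⟩ h
  simp only [Subtype.mk.injEq] at h
  have hIp : I.IsPrime := Ideal.isPrime_of_irreducible_absNorm (by rw [hI]; exact hl)
  have hI'p : I'.IsPrime := Ideal.isPrime_of_irreducible_absNorm (by rw [hI']; exact hl)
  have hI0 : I ≠ ⊥ := by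
    rintro rfl; rw [Ideal.absNorm_bot] at hI; exact hl.ne_zero hI.symm
  have hle : I' * J' ≤ I := h ▸ Ideal.mul_le_left
  have hII : I' ≤ I := by
    rcases (Ideal.IsPrime.mul_le hIp).1 hle with h1 | h1
    · exact h1
    · exfalso
      have := Ideal.absNorm_dvd_absNorm_of_le h1
      rw [hI, hJ'] at this
      exact hlM this
  have hI'0 : I' ≠ ⊥ := by
    rintro rfl; rw [Ideal.absNorm_bot] at hI'; exact hl.ne_zero hI'.symm
  have hEq : I' = I := (hI'p.isMaximal hI'0).eq_of_le hIp.ne_top hII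
  subst hEq
  have hJJ : J = J' := mul_left_cancel₀ (by simpa using hI0) h
  subst hJJ
  rfl

theorem pow_card_le_idealCount {k : ℕ} (T : Finset ℕ) (hT : ∀ l ∈ T, l.Prime)
    (h : ∀ l ∈ T, k ≤ idealCount F l) : k ^ T.card ≤ idealCount F (∏ l ∈ T, l) := by
  induction T using Finset.induction_on with
  | empty => simp [idealCount_one]
  | insert l T hl ih =>
    rw [Finset.card_insert_of_notMem hl, Finset.prod_insert hl, pow_succ, mul_comm]
    have h1 := ih (fun m hm ↦ hT m (Finset.mem_insert_of_mem hm))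
      (fun m hm ↦ h m (Finset.mem_insert_of_mem hm))
    refine (Nat.mul_le_mul (h l (Finset.mem_insert_self _ _)) h1).trans
      (idealCount_mul_le F (hT l (Finset.mem_insert_self _ _)) ?_)
    rw [(hT l (Finset.mem_insert_self _ _)).prime.dvd_finsetProd_iff]
    rintro ⟨m, hm, hd⟩
    rw [(Nat.prime_dvd_prime_iff_eq (hT l (Finset.mem_insert_self _ _))
      (hT m (Finset.mem_insert_of_mem hm))).1 hd] at hl
    exact hl hm

theorem exists_zeta_bound : ∃ δ > 0, ∃ K : ℝ, ∀ x : ℝ, 1 < x → x < 1 + δ →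
    (Summable fun n : ℕ ↦ (idealCount F n : ℝ) / (n : ℝ) ^ x) ∧
      ∑' n : ℕ, (idealCount F n : ℝ) / (n : ℝ) ^ x ≤ K / (x - 1) := by
  have h := tendsto_sub_one_mul_dedekindZeta_nhdsGT F
  have hpos := dedekindZeta_residue_pos F
  have h2 := ((Complex.continuous_re.tendsto _).comp h)
  rw [Complex.ofReal_re] at h2
  have h3 : ∀ᶠ x : ℝ in nhdsWithin 1 (Set.Ioi 1),
      ((x - 1) * dedekindZeta F x : ℂ).re ∈ Set.Ioo 0 (dedekindZeta_residue F + 1) :=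
    h2.eventually (Ioo_mem_nhds hpos (lt_add_one _))
  rw [eventually_nhdsWithin_iff, Metric.eventually_nhds_iff] at h3
  obtain ⟨δ, hδ, h4⟩ := h3
  refine ⟨δ, hδ, dedekindZeta_residue F + 1, fun x hx1 hx2 ↦ ?_⟩
  have h5 := h4 (y := x) (by rw [Real.dist_eq, abs_of_pos (by linarith)]; linarith) hx1
  have e : dedekindZeta F x = ((∑' n, (idealCount F n : ℝ) / (n : ℝ) ^ x : ℝ) : ℂ) := by
    rw [← LSeries_ofReal _ (by positivity : x ≠ 0)]
    simp [dedekindZeta, idealCount]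
  rw [e, ← Complex.ofReal_one, ← Complex.ofReal_sub, ← Complex.ofReal_mul, Complex.ofReal_re] at h5
  constructor
  · by_contra hns
    rw [tsum_eq_zero_of_not_summable hns, mul_zero] at h5
    exact lt_irrefl _ h5.1
  · rw [le_div_iff₀ (sub_pos.2 hx1), mul_comm]
    exact h5.2.le

theorem prod_one_add_le_zeta {k : ℕ} {x : ℝ}
    (hs : Summable fun n : ℕ ↦ (idealCount F n : ℝ) / (n : ℝ) ^ x)
    (T : Finset ℕ) (hT : ∀ l ∈ T, l.Prime) (h : ∀ l ∈ T, k ≤ idealCount F l) :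
    ∏ l ∈ T, (1 + k / (l : ℝ) ^ x) ≤ ∑' n : ℕ, (idealCount F n : ℝ) / (n : ℝ) ^ x := by
  rw [Finset.prod_one_add]
  have hinj : Set.InjOn (fun t : Finset ℕ ↦ ∏ l ∈ t, l) (T.powerset : Set (Finset ℕ)) := by
    intro t ht t' ht' hEq
    simp only [Finset.coe_powerset, Set.mem_preimage, Set.mem_powerset_iff, Finset.coe_subset]
      at ht ht'
    have key : ∀ s : Finset ℕ, s ⊆ T → ∀ l, l.Prime → (l ∣ ∏ m ∈ s, m ↔ l ∈ s) := by
      intro s hs l hl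
      rw [hl.prime.dvd_finsetProd_iff]
      constructor
      · rintro ⟨m, hm, hd⟩
        rwa [(Nat.prime_dvd_prime_iff_eq hl (hT m (hs hm))).1 hd]
      · exact fun hm ↦ ⟨l, hm, dvd_rfl⟩
    dsimp only at hEq
    ext l
    constructor
    · intro hl
      rw [← key t' ht' l (hT l (ht hl)), ← hEq]
      exact (key t ht l (hT l (ht hl))).2 hl
    · intro hl
      rw [← key t ht l (hT l (ht' hl)), hEq]
      exact (key t' ht' l (hT l (ht' hl))).2 hl
  calc ∑ t ∈ T.powerset, ∏ l ∈ t, ((k : ℝ) / (l : ℝ) ^ x)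
      ≤ ∑ t ∈ T.powerset, (idealCount F (∏ l ∈ t, l) : ℝ) / ((∏ l ∈ t, l : ℕ) : ℝ) ^ x := by
        refine Finset.sum_le_sum fun t ht ↦ ?_
        rw [Finset.mem_powerset] at ht
        rw [Finset.prod_div_distrib, Finset.prod_const, Nat.cast_prod,
          Real.finsetProd_rpow _ _ fun l _ ↦ Nat.cast_nonneg l]
        gcongr
        exact_mod_cast pow_card_le_idealCount F t (fun l hl ↦ hT l (ht hl))
          (fun l hl ↦ h l (ht hl))
    _ = ∑ n ∈ T.powerset.image (fun t : Finset ℕ ↦ ∏ l ∈ t, l),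
          (idealCount F n : ℝ) / (n : ℝ) ^ x := by
        rw [Finset.sum_image hinj]
    _ ≤ _ := hs.sum_le_tsum _ fun n _ ↦ by positivity

/-- A number field cannot have more than `φ(q)` prime ideals of degree one above almost every
prime of a residue class modulo `q`. -/
theorem exists_prime_idealCount_lt {q : ℕ} [NeZero q] {b : ZMod q} (hb : IsUnit b) (N : ℕ)
    {k : ℕ} (hk : q.totient < k) :
    ∃ l : ℕ, l.Prime ∧ N < l ∧ (l : ZMod q) = b ∧ idealCount F l < k := by
  by_contra! hcon
  obtain ⟨C, hC⟩ := exists_prime_series_lower_bound hb N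
  obtain ⟨δ, hδ, K, hK⟩ := exists_zeta_bound F
  set P := primesInClass b N with hP
  have hφ : (0 : ℝ) < q.totient := by exact_mod_cast Nat.totient_pos.2 (NeZero.pos q)
  have hk' : (q.totient : ℝ) < k := by exact_mod_cast hk
  set c2 : ℝ := ∑' n : ℕ, (k : ℝ) ^ 2 / (n : ℝ) ^ (2 : ℝ) with hc2
  have hsum2 : Summable fun n : ℕ ↦ (k : ℝ) ^ 2 / (n : ℝ) ^ (2 : ℝ) :=
    (Real.summable_nat_rpow_inv.2 one_lt_two).mul_left ((k : ℝ) ^ 2)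
  have main : ∀ x : ℝ, 1 < x → x < 1 + δ → x ≤ 2 →
      ((k : ℝ) * (q.totient : ℝ)⁻¹ - 1) * -Real.log (x - 1) ≤ Real.log K + c2 + k * C := by
    intro x hx1 hx2 hx3
    obtain ⟨hs, hz⟩ := hK x hx1 hx2
    have hfin : ∀ T : Finset ℕ, ∑ n ∈ T, k * (P.indicator (1 : ℕ → ℝ) n / (n : ℝ) ^ x) ≤
        Real.log K - Real.log (x - 1) + c2 := by
      classical
      intro T
      have hTP : ∀ l ∈ T.filter (· ∈ P), l.Prime := fun l hl ↦ (Finset.mem_filter.1 hl).2.1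
      have hprod := prod_one_add_le_zeta F hs (T.filter (· ∈ P)) hTP
        (fun l hl ↦ by
          have := (Finset.mem_filter.1 hl).2
          exact hcon l this.1 this.2.1 this.2.2)
      have hpos : 0 < ∏ l ∈ T.filter (· ∈ P), (1 + (k : ℝ) / (l : ℝ) ^ x) :=
        Finset.prod_pos fun l _ ↦ by positivity
      have hlog := Real.log_le_log hpos (hprod.trans hz)
      have hKpos : K ≠ 0 := by
        rintro rfl
        rw [zero_div] at hz
        linarith
      rw [Real.log_prod (fun l _ ↦ by positivity),
        Real.log_div hKpos (sub_pos.2 hx1).ne'] at hlog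
      have hterm : ∀ l ∈ T.filter (· ∈ P), (k : ℝ) / (l : ℝ) ^ x - k ^ 2 / (l : ℝ) ^ (2 : ℝ) ≤
          Real.log (1 + (k : ℝ) / (l : ℝ) ^ x) := by
        intro l hl
        have hl1 : (1 : ℝ) ≤ l := by exact_mod_cast (hTP l hl).one_lt.le
        have hlx : 0 < (l : ℝ) ^ x := by positivity
        have hu : 0 ≤ (k : ℝ) / (l : ℝ) ^ x := by positivity
        have h1 := Real.le_log_one_add_of_nonneg hu
        have h2 : ((k : ℝ) / (l : ℝ) ^ x) ^ 2 ≤ k ^ 2 / (l : ℝ) ^ (2 : ℝ) := by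
          rw [div_pow]
          refine div_le_div_of_nonneg_left (by positivity) (by positivity) ?_
          rw [Real.rpow_two]
          refine pow_le_pow_left₀ (by positivity) ?_ 2
          conv_lhs => rw [← Real.rpow_one (l : ℝ)]
          exact Real.rpow_le_rpow_of_exponent_le hl1 hx1.le
        refine le_trans ?_ h1
        rw [le_div_iff₀ (by positivity)]
        nlinarith [sq_nonneg ((k : ℝ) / (l : ℝ) ^ x), mul_nonneg hu (sub_nonneg.2 h2)]
      have h3 := (Finset.sum_le_sum hterm).trans hlog
      rw [Finset.sum_sub_distrib] at h3
      have h4 : ∑ l ∈ T.filter (· ∈ P), (k : ℝ) ^ 2 / (l : ℝ) ^ (2 : ℝ) ≤ c2 :=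
        hsum2.sum_le_tsum _ fun n _ ↦ by positivity
      have h5 : ∑ n ∈ T, k * (P.indicator (1 : ℕ → ℝ) n / (n : ℝ) ^ x) =
          ∑ l ∈ T.filter (· ∈ P), (k : ℝ) / (l : ℝ) ^ x := by
        rw [Finset.sum_filter]
        refine Finset.sum_congr rfl fun n _ ↦ ?_
        by_cases hn : n ∈ P
        · simp [hn, div_eq_mul_inv]
        · simp [hn]
      rw [h5]
      linarith
    have hS := (summable_indicator_div P hx1).mul_left (k : ℝ)
    have h6 := hS.tsum_le_of_sum_le hfin
    rw [tsum_mul_left] at h6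
    have h7 := mul_le_mul_of_nonneg_left (hC x ⟨hx1, hx3⟩) (Nat.cast_nonneg k : (0 : ℝ) ≤ k)
    nlinarith
  have hA : 0 < (k : ℝ) * (q.totient : ℝ)⁻¹ - 1 := by
    rw [sub_pos, ← div_eq_mul_inv, one_lt_div hφ]
    exact hk'
  set A := (k : ℝ) * (q.totient : ℝ)⁻¹ - 1 with hAdef
  set D := Real.log K + c2 + k * C with hD
  set t : ℝ := min (min (δ / 2) 1) (Real.exp (-(D / A + 1))) with ht
  have ht0 : 0 < t := lt_min (lt_min (by linarith) one_pos) (Real.exp_pos _)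
  have ht1 : t ≤ δ / 2 := (min_le_left _ _).trans (min_le_left _ _)
  have ht2 : t ≤ 1 := (min_le_left _ _).trans (min_le_right _ _)
  have ht3 : t ≤ Real.exp (-(D / A + 1)) := min_le_right _ _
  have h8 := main (1 + t) (by linarith) (by linarith) (by linarith)
  rw [add_sub_cancel_left] at h8
  have h9 : Real.log t ≤ -(D / A + 1) := by
    rw [Real.log_le_iff_le_exp ht0]; exact ht3
  have h10 : A * (D / A + 1) ≤ D := (mul_le_mul_of_nonneg_left (by linarith) hA.le).trans h8
  rw [mul_add, mul_div_cancel₀ _ hA.ne'] at h10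
  linarith

end IdealCounting

section DegreeOnePrimes

open NumberField

theorem exists_bound_map_ne_zero {Ω : Type*} [Field Ω] [CharZero Ω] {y : 𝓞 Ω} (hy : y ≠ 0) :
    ∃ N : ℕ, ∀ l : ℕ, l.Prime → N < l → ∀ (k : Type) [Field k] [CharP k l] (r : 𝓞 Ω →+* k),
      r y ≠ 0 := by
  have halg : IsAlgebraic ℤ y := (Algebra.IsIntegral.isIntegral (R := ℤ) y).isAlgebraic
  obtain ⟨c, hc, hd⟩ := halg.exists_nonzero_dvd (mem_nonZeroDivisors_of_ne_zero hy)
  refine ⟨c.natAbs, fun l hl hlN k _ _ r h0 ↦ ?_⟩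
  have h1 : r (algebraMap ℤ (𝓞 Ω) c) = 0 := by
    obtain ⟨z, hz⟩ := hd
    rw [hz, map_mul, h0, zero_mul]
  rw [eq_intCast, map_intCast, CharP.intCast_eq_zero_iff k l] at h1
  have h2 := Nat.le_of_dvd (Int.natAbs_pos.2 hc) (Int.natCast_dvd.1 h1)
  omega

variable {F : Type*} [Field F] [NumberField F]

theorem exists_smul_mem_adjoin {s : Set (𝓞 F)}
    (hs : Algebra.adjoin ℚ ((fun x : 𝓞 F ↦ (x : F)) '' s) = ⊤) :
    ∃ m : ℤ, m ≠ 0 ∧ ∀ x : 𝓞 F, m • x ∈ Algebra.adjoin ℤ s := by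
  have h1 : ∀ x : F, ∃ m : ℤ, m ≠ 0 ∧ ∃ z ∈ Algebra.adjoin ℤ s, (z : F) = m • x := by
    intro x
    have hx : x ∈ Algebra.adjoin ℚ ((fun x : 𝓞 F ↦ (x : F)) '' s) := hs ▸ Algebra.mem_top
    induction hx using Algebra.adjoin_induction with
    | mem x hx =>
      obtain ⟨z, hz, rfl⟩ := hx
      exact ⟨1, one_ne_zero, z, Algebra.subset_adjoin hz, by simp⟩
    | algebraMap q =>
      refine ⟨q.den, by exact_mod_cast q.den_ne_zero, algebraMap ℤ _ q.num,
        Subalgebra.algebraMap_mem _ _, ?_⟩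
      rw [eq_ratCast, zsmul_eq_mul]
      have := Rat.mul_den_eq_num q
      have h2 : ((q * q.den : ℚ) : F) = ((q.num : ℚ) : F) := by rw [this]
      push_cast at h2
      simp [← h2, mul_comm]
    | add x y _ _ hx hy =>
      obtain ⟨m, hm, z, hz, h⟩ := hx
      obtain ⟨m', hm', z', hz', h'⟩ := hy
      refine ⟨m * m', mul_ne_zero hm hm', m' • z + m • z',
        add_mem (zsmul_mem hz _) (zsmul_mem hz' _), ?_⟩
      change algebraMap (𝓞 F) F _ = _ at h h' ⊢
      simp only [zsmul_eq_mul, map_add, map_mul, map_intCast] at h h' ⊢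
      rw [h, h']; push_cast; ring
    | mul x y _ _ hx hy =>
      obtain ⟨m, hm, z, hz, h⟩ := hx
      obtain ⟨m', hm', z', hz', h'⟩ := hy
      refine ⟨m * m', mul_ne_zero hm hm', z * z', mul_mem hz hz', ?_⟩
      change algebraMap (𝓞 F) F _ = _ at h h' ⊢
      simp only [zsmul_eq_mul, map_mul] at h h' ⊢
      rw [h, h']; push_cast; ring
  have h2 : ∀ x : 𝓞 F, ∃ m : ℤ, m ≠ 0 ∧ m • x ∈ Algebra.adjoin ℤ s := by
    intro x
    obtain ⟨m, hm, z, hz, h⟩ := h1 x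
    refine ⟨m, hm, ?_⟩
    convert hz
    apply RingOfIntegers.ext
    rw [h]; simp
  choose m hm hms using h2
  obtain ⟨T, hT⟩ := (Module.finite_def (R := ℤ) (M := 𝓞 F)).1 inferInstance
  refine ⟨∏ x ∈ T, m x, Finset.prod_ne_zero_iff.2 fun x _ ↦ hm x, fun x ↦ ?_⟩
  have hx : x ∈ Submodule.span ℤ (T : Set (𝓞 F)) := hT ▸ Submodule.mem_top
  induction hx using Submodule.span_induction with
  | mem x hx =>
    obtain ⟨c, hc⟩ := Finset.dvd_prod_of_mem m hx
    rw [hc, mul_comm, mul_smul]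
    exact zsmul_mem (hms x) _
  | zero => simp
  | add x y _ _ hx hy => rw [smul_add]; exact add_mem hx hy
  | smul a x _ hx => rw [smul_comm]; exact zsmul_mem hx _

theorem mem_range_intCast_of_pow_eq {k : Type*} [Field k] {l : ℕ} [CharP k l] (hl : l.Prime)
    {x : k} (hx : x ^ l = x) : ∃ c : ℤ, (c : k) = x := by
  have : Fact l.Prime := ⟨hl⟩
  let _ := ZMod.algebra k l
  have h := FiniteField.roots_X_pow_card_sub_X (ZMod l)
  classical
  have hinj : Function.Injective (algebraMap (ZMod l) k) := (algebraMap (ZMod l) k).injective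
  have h0 : (Polynomial.X ^ l - Polynomial.X : Polynomial k) ≠ 0 :=
    FiniteField.X_pow_card_sub_X_ne_zero k hl.one_lt
  have hsub : (Finset.univ.image (algebraMap (ZMod l) k)).val ⊆
      (Polynomial.X ^ l - Polynomial.X : Polynomial k).roots := by
    intro y hy
    simp only [Finset.mem_val, Finset.mem_image] at hy
    obtain ⟨c, -, rfl⟩ := hy
    rw [Polynomial.mem_roots h0]
    simp [← map_pow, ZMod.pow_card]
  have hle : (Finset.univ.image (algebraMap (ZMod l) k)).val ≤
      (Polynomial.X ^ l - Polynomial.X : Polynomial k).roots :=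
    (Multiset.le_iff_subset (Finset.nodup _)).2 hsub
  have hcard : (Polynomial.X ^ l - Polynomial.X : Polynomial k).roots.card ≤
      (Finset.univ.image (algebraMap (ZMod l) k)).val.card := by
    rw [Finset.card_val, Finset.card_image_of_injective _ hinj, Finset.card_univ, ZMod.card]
    exact (Polynomial.card_roots' _).trans
      (FiniteField.X_pow_card_sub_X_natDegree_eq k hl.one_lt).le
  have heq := Multiset.eq_of_le_of_card_le hle hcard
  have hxm : x ∈ (Polynomial.X ^ l - Polynomial.X : Polynomial k).roots := by
    rw [Polynomial.mem_roots h0]; simp [hx]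
  rw [← heq, Finset.mem_val, Finset.mem_image] at hxm
  obtain ⟨c, -, hc⟩ := hxm
  refine ⟨c.val, ?_⟩
  rw [← hc, Int.cast_natCast, ← map_natCast (algebraMap (ZMod l) k), ZMod.natCast_zmod_val]

theorem exists_bound_card_le_idealCount (Ω : Type*) [Field Ω] [CharZero Ω] {s : Set (𝓞 F)}
    (hs : Algebra.adjoin ℚ ((fun x : 𝓞 F ↦ (x : F)) '' s) = ⊤) :
    ∃ N : ℕ, ∀ l : ℕ, l.Prime → N < l → ∀ (k : Type) [Field k] [CharP k l] (r : 𝓞 Ω →+* k)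
      (S : Finset (F →ₐ[ℚ] Ω)),
      (∀ σ ∈ S, ∀ g ∈ s, r (RingOfIntegers.mapRingHom (σ : F →+* Ω) g) ^ l =
        r (RingOfIntegers.mapRingHom (σ : F →+* Ω) g)) →
      S.card ≤ idealCount F l := by
  classical
  obtain ⟨m, hm, hms⟩ := exists_smul_mem_adjoin hs
  obtain ⟨x0, hx0⟩ := Field.exists_primitive_element ℚ F
  obtain ⟨x1, hx1⟩ : ∃ x1 : 𝓞 F, ∀ σ τ : F →ₐ[ℚ] Ω, σ x1 = τ x1 → σ = τ := by
    obtain ⟨c, hc, hci⟩ := ((IsFractionRing.isAlgebraic_iff ℤ ℚ F).2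
      (Algebra.IsAlgebraic.isAlgebraic (R := ℚ) x0)).exists_integral_multiple
    refine ⟨⟨c • x0, hci⟩, fun σ τ h ↦ ?_⟩
    have h' : σ x0 = τ x0 := by
      simp only [zsmul_eq_mul, RingOfIntegers.map_mk, map_mul, map_intCast] at h
      exact mul_left_cancel₀ (by exact_mod_cast hc) h
    have hadj : Algebra.adjoin ℚ {x0} = ⊤ := by
      have hh := IntermediateField.adjoin_simple_toSubalgebra_of_isAlgebraic
        (Algebra.IsAlgebraic.isAlgebraic (R := ℚ) x0)
      rw [← hh, hx0]; rfl
    refine AlgHom.ext_of_adjoin_eq_top hadj ?_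
    rintro _ rfl
    exact h'
  have hNpair : ∀ q : (F →ₐ[ℚ] Ω) × (F →ₐ[ℚ] Ω), ∃ N : ℕ, q.1 ≠ q.2 →
      ∀ l : ℕ, l.Prime → N < l → ∀ (k : Type) [Field k] [CharP k l] (r : 𝓞 Ω →+* k),
      r (RingOfIntegers.mapRingHom (q.1 : F →+* Ω) x1) ≠
        r (RingOfIntegers.mapRingHom (q.2 : F →+* Ω) x1) := by
    intro q
    by_cases hq : q.1 = q.2
    · exact ⟨0, fun h ↦ absurd hq h⟩
    · have hy : RingOfIntegers.mapRingHom (q.1 : F →+* Ω) x1 -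
          RingOfIntegers.mapRingHom (q.2 : F →+* Ω) x1 ≠ 0 := by
        rw [sub_ne_zero]
        intro h
        exact hq (hx1 _ _ (congrArg (fun z : 𝓞 Ω ↦ (z : Ω)) h))
      obtain ⟨N, hN⟩ := exists_bound_map_ne_zero hy
      refine ⟨N, fun _ l hl hlN k _ _ r h ↦ hN l hl hlN k r ?_⟩
      rw [map_sub, h, sub_self]
  choose Np hNp using hNpair
  refine ⟨m.natAbs + ∑ q, Np q, fun l hl hlN k _ _ r S hS ↦ ?_⟩
  have : Fact l.Prime := ⟨hl⟩
  have hlm : ((m : ℤ) : k) ≠ 0 := by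
    rw [Ne, CharP.intCast_eq_zero_iff k l]
    intro h
    have h2 := Nat.le_of_dvd (Int.natAbs_pos.2 hm) (Int.natCast_dvd.1 h)
    omega
  set f : (F →ₐ[ℚ] Ω) → (𝓞 F →+* k) := fun σ ↦
    r.comp (RingOfIntegers.mapRingHom (σ : F →+* Ω)) with hf
  have hfix : ∀ σ ∈ S, ∀ x : 𝓞 F, f σ x ^ l = f σ x := by
    intro σ hσ x
    have h1 : ∀ y ∈ Algebra.adjoin ℤ s, f σ y ^ l = f σ y := by
      intro y hy
      induction hy using Algebra.adjoin_induction with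
      | mem y hy => exact hS σ hσ y hy
      | algebraMap c =>
        rw [eq_intCast, map_intCast, ← frobenius_def, map_intCast]
      | add y z _ _ hy hz => rw [map_add, add_pow_char, hy, hz]
      | mul y z _ _ hy hz => rw [map_mul, mul_pow, hy, hz]
    have h2 := h1 _ (hms x)
    rw [zsmul_eq_mul, map_mul, map_intCast, mul_pow, ← frobenius_def l (m : k), map_intCast] at h2
    exact mul_left_cancel₀ hlm h2
  have hint : ∀ σ ∈ S, ∀ x : 𝓞 F, ∃ c : ℤ, (c : k) = f σ x := fun σ hσ x ↦
    mem_range_intCast_of_pow_eq hl (hfix σ hσ x)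
  have hnorm : ∀ σ ∈ S, Ideal.absNorm (RingHom.ker (f σ)) = l := by
    intro σ hσ
    let _ := ZMod.algebra k l
    have e1 : (𝓞 F ⧸ RingHom.ker (f σ)) ≃+* (f σ).range := RingHom.quotientKerEquivRange _
    have e2 : ZMod l ≃+* (algebraMap (ZMod l) k).range :=
      RingEquiv.ofBijective (algebraMap (ZMod l) k).rangeRestrict
        ⟨fun x y h ↦ (algebraMap (ZMod l) k).injective (congrArg Subtype.val h),
          RingHom.rangeRestrict_surjective _⟩
    have hr : (f σ).range = (algebraMap (ZMod l) k).range := by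
      apply le_antisymm
      · rintro _ ⟨x, rfl⟩
        obtain ⟨c, hc⟩ := hint σ hσ x
        exact ⟨c, by rw [map_intCast, hc]⟩
      · rintro _ ⟨x, rfl⟩
        refine ⟨(x.val : 𝓞 F), ?_⟩
        rw [map_natCast, ← map_natCast (algebraMap (ZMod l) k), ZMod.natCast_zmod_val]
    rw [hr] at e1
    rw [Ideal.absNorm_apply, Submodule.cardQuot_apply, Nat.card_congr (e1.trans e2.symm).toEquiv,
      Nat.card_zmod]
  have hfin : Finite {I : Ideal (𝓞 F) // Ideal.absNorm I = l} :=
    Ideal.finite_setOfPred_absNorm_eq l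
  rw [idealCount, ← Nat.card_eq_finsetCard S]
  refine Nat.card_le_card_of_injective
    (fun σ : S ↦ (⟨RingHom.ker (f σ), hnorm σ σ.2⟩ :
      {I : Ideal (𝓞 F) // Ideal.absNorm I = l})) ?_
  rintro ⟨σ, hσ⟩ ⟨τ, hτ⟩ h
  simp only [Subtype.mk.injEq] at h ⊢
  by_contra hne
  refine hNp (σ, τ) hne l hl ?_ k r ?_
  · have := Finset.single_le_sum (f := Np) (fun _ _ ↦ Nat.zero_le _) (Finset.mem_univ (σ, τ))
    omega
  · obtain ⟨c, hc⟩ := hint σ hσ x1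
    have h1 : x1 - (c : 𝓞 F) ∈ RingHom.ker (f σ) := by
      rw [RingHom.mem_ker, map_sub, map_intCast, hc, sub_self]
    have h2 := h ▸ h1
    rw [RingHom.mem_ker, map_sub, map_intCast, hc, sub_eq_zero] at h2
    exact h2.symm

end DegreeOnePrimes

section FrobeniusFixed

theorem add_pow_eq_add_of_pow_eq {k : Type*} [Field k] {l p e : ℕ} [Fact l.Prime] [CharP k l]
    (hp : Odd p) (he : l + 1 = p * e) {u v x y : k} (hu : u ≠ 0) (huv : u ^ l = v)
    (hvu : v ^ l = u) (hx : x ^ p = u * v ^ (p - 1)) (hxy : x * y = u * v)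
    (h1 : u ^ ((l - 1) * e) = 1) : (x + y) ^ l = x + y := by
  have hl : l.Prime := Fact.out
  have hp0 : 0 < p := hp.pos
  obtain ⟨P, rfl⟩ : ∃ P, p = P + 1 := ⟨p - 1, by omega⟩
  obtain ⟨L, rfl⟩ : ∃ L, l = L + 1 := ⟨l - 1, by have := hl.pos; omega⟩
  simp only [Nat.add_sub_cancel] at *
  have hv : v ≠ 0 := by rw [← huv]; exact pow_ne_zero _ hu
  have hx0 : x ≠ 0 := by
    rintro rfl
    rw [zero_mul] at hxy
    exact mul_ne_zero hu hv hxy.symm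
  have hy0 : y ≠ 0 := by
    rintro rfl
    rw [mul_zero] at hxy
    exact mul_ne_zero hu hv hxy.symm
  have hv1 : v ^ (L * e) = 1 := by
    rw [← huv, ← pow_mul, mul_comm, pow_mul, h1, one_pow]
  have hxL : x ^ (L * (L + 1 + 1)) = 1 := by
    rw [he, show L * ((P + 1) * e) = (P + 1) * (L * e) by ring, pow_mul, hx, mul_pow, h1,
      ← pow_mul, mul_comm P, pow_mul, hv1, one_pow, one_mul]
  have hyp : y ^ (P + 1) = u ^ P * v := by
    have h2 : x ^ (P + 1) * y ^ (P + 1) = u ^ (P + 1) * v ^ (P + 1) := by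
      rw [← mul_pow, hxy, mul_pow]
    rw [hx] at h2
    have h3 : (u * v ^ P) * y ^ (P + 1) = (u * v ^ P) * (u ^ P * v) := by rw [h2]; ring
    exact mul_left_cancel₀ (mul_ne_zero hu (pow_ne_zero _ hv)) h3
  have hzp : (x ^ (L + 1) / y) ^ (P + 1) = 1 := by
    rw [div_pow, div_eq_one_iff_eq (pow_ne_zero _ hy0), hyp, ← pow_mul, mul_comm, pow_mul, hx,
      mul_pow, huv, ← pow_mul, mul_comm P, pow_mul, hvu, mul_comm]
  have hxyL : x ^ L * y ^ L = 1 := by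
    rw [← mul_pow, hxy]
    have : (u * v) ^ L * (u * v) = 1 * (u * v) := by
      rw [← pow_succ, mul_pow, huv, hvu]; ring
    exact mul_right_cancel₀ (mul_ne_zero hu hv) this
  have hzl : (x ^ (L + 1) / y) ^ L = 1 := by
    rw [div_pow, div_eq_one_iff_eq (pow_ne_zero _ hy0)]
    refine mul_left_cancel₀ (pow_ne_zero L hx0) ?_
    rw [hxyL, ← hxL, ← pow_mul, ← pow_add]; congr 1; ring
  have hcop : Nat.gcd (P + 1) L = 1 := by
    have hd1 := Nat.gcd_dvd_left (P + 1) L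
    have hd2 := Nat.gcd_dvd_right (P + 1) L
    have hd3 : Nat.gcd (P + 1) L ∣ L + 2 := by
      rw [show L + 2 = (P + 1) * e by omega]; exact hd1.mul_right _
    have hd4 : Nat.gcd (P + 1) L ∣ 2 := (Nat.dvd_add_right hd2).1 hd3
    have hodd : Odd (Nat.gcd (P + 1) L) := Odd.of_dvd_nat hp hd1
    rcases (Nat.dvd_prime Nat.prime_two).1 hd4 with h | h
    · exact h
    · rw [h] at hodd; exact absurd hodd (by decide)
  have hz : x ^ (L + 1) / y = 1 := by
    have h2 := Nat.dvd_gcd (orderOf_dvd_of_pow_eq_one hzp) (orderOf_dvd_of_pow_eq_one hzl)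
    rwa [hcop, Nat.dvd_one, orderOf_eq_one_iff] at h2
  have hxy' : x ^ (L + 1) = y := (div_eq_one_iff_eq hy0).1 hz
  have hyx : y ^ (L + 1) = x := by
    rw [← hxy', ← pow_mul, show (L + 1) * (L + 1) = L * (L + 1 + 1) + 1 by ring, pow_succ, hxL,
      one_mul]
  rw [add_pow_char, hxy', hyx, add_comm]

theorem isSquare_of_legendre {p l : ℕ} (hp : p.Prime) (hp5 : 5 ≤ p) (hl : l.Prime) (hl5 : 5 ≤ l)
    (h3 : l % 3 = 2) (hlp : p ∣ l + 1) (hne : p ≠ l) :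
    IsSquare (((if p % 4 = 1 then p else 3 * p : ℕ) : ℤ) : ZMod l) := by
  have : Fact p.Prime := ⟨hp⟩
  have : Fact l.Prime := ⟨hl⟩
  have hpl : ((l : ℤ) : ZMod p) = ((-1 : ℤ) : ZMod p) := by
    have : ((l + 1 : ℕ) : ZMod p) = 0 := (ZMod.natCast_eq_zero_iff _ _).2 hlp
    push_cast at this ⊢
    linear_combination this
  have hp2 : p % 2 = 1 := hp.mod_two_eq_one_iff_ne_two.2 (by omega)
  have hl2 : l % 2 = 1 := hl.mod_two_eq_one_iff_ne_two.2 (by omega)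
  have hL1 : legendreSym p l = ZMod.χ₄ p := by
    rw [legendreSym, hpl]
    exact legendreSym.at_neg_one (by omega)
  have hcast : ∀ {z : ℕ}, ((z : ℤ) : ZMod l) ≠ 0 → legendreSym l z = 1 →
      IsSquare ((z : ℤ) : ZMod l) := fun hz h ↦ (legendreSym.eq_one_iff l hz).1 h
  have hpne : ((p : ℤ) : ZMod l) ≠ 0 := by
    rw [Int.cast_natCast, Ne, ZMod.natCast_eq_zero_iff]
    intro h
    exact hne ((Nat.prime_dvd_prime_iff_eq hl hp).1 h).symm
  have h3ne : ((3 : ℤ) : ZMod l) ≠ 0 := by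
    have : ((3 : ℕ) : ZMod l) ≠ 0 := by
      rw [Ne, ZMod.natCast_eq_zero_iff]
      intro h
      have := (Nat.prime_dvd_prime_iff_eq hl Nat.prime_three).1 h
      omega
    exact_mod_cast this
  split_ifs with h4
  · apply hcast hpne
    have := legendreSym.quadratic_reciprocity_one_mod_four h4 (q := l) (by omega)
    rw [this, hL1, ZMod.χ₄_nat_one_mod_four h4]
  · have h4' : p % 4 = 3 := by omega
    apply hcast
    · push_cast at hpne h3ne ⊢
      exact mul_ne_zero h3ne hpne
    · have hq1 := legendreSym.quadratic_reciprocity' (p := p) (q := l) (by omega) (by omega)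
      have hq3 := legendreSym.quadratic_reciprocity' (p := 3) (q := l) (by omega) (by omega)
      have hL3 : legendreSym 3 l = -1 := by
        have : ((l : ℤ) : ZMod 3) = ((2 : ℤ) : ZMod 3) := by
          rw [ZMod.intCast_eq_intCast_iff]
          show (l : ℤ) % 3 = 2 % 3
          omega
        rw [legendreSym, this]; decide
      rw [hL1, ZMod.χ₄_nat_three_mod_four h4'] at hq1
      rw [hL3] at hq3
      push_cast
      push_cast at hq1 hq3
      rw [legendreSym.mul, hq3, hq1]
      have ho : Odd (p / 2) := by
        rw [Nat.odd_iff]; omega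
      rw [one_mul, pow_mul, ho.neg_one_pow]
      rcases neg_one_pow_eq_or ℤ (l / 2) with h | h <;> rw [h] <;> norm_num

end FrobeniusFixed

section CubicField

open Polynomial

/-- The polynomial `T³ - a` over `ℚ`. -/
noncomputable abbrev cubicPoly (a : ℤ) : ℚ[X] := Polynomial.X ^ 3 - Polynomial.C (a : ℚ)

/-- The pure cubic extension `ℚ(a^{1/3})`. -/
abbrev CubicField (a : ℤ) : Type := AdjoinRoot (cubicPoly a)

theorem irreducible_cubicPoly {a : ℤ} (ha : ∀ x : ℤ, x ^ 3 ≠ a) : Irreducible (cubicPoly a) := by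
  refine X_pow_sub_C_irreducible_of_prime Nat.prime_three fun b hb ↦ ?_
  have hint : IsIntegral ℤ b := by
    refine IsIntegral.of_pow (n := 3) (by norm_num) ?_
    rw [hb]
    exact isIntegral_algebraMap (R := ℤ) (x := a)
  obtain ⟨z, rfl⟩ := (IsIntegrallyClosed.isIntegral_iff (R := ℤ)).1 hint
  refine ha z ?_
  simp only [eq_intCast] at hb
  exact_mod_cast hb

/-- `ℚ(a^{1/3}, ω)` with `ω² + ω + 1 = 0`. -/
abbrev CubicClosure (a : ℤ) : Type := QuadraticAlgebra (CubicField a) (-1) (-1)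

theorem CubicField.sq_ne {a : ℤ} [Fact (Irreducible (cubicPoly a))] (r : CubicField a) :
    r ^ 2 ≠ -1 + -1 * r := by
  intro h
  obtain ⟨t, ht⟩ : ∃ t : ℝ, t ^ 3 = a := by
    have ho : Odd 3 := by decide
    rcases le_total 0 (a : ℝ) with h0 | h0
    · exact ⟨(a : ℝ) ^ ((1 : ℝ) / 3), by rw [← Real.rpow_natCast, ← Real.rpow_mul h0]; norm_num⟩
    · refine ⟨-(-(a : ℝ)) ^ ((1 : ℝ) / 3), ?_⟩
      rw [ho.neg_pow, ← Real.rpow_natCast, ← Real.rpow_mul (by linarith)]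
      norm_num
  let f : CubicField a →+* ℝ := AdjoinRoot.lift (algebraMap ℚ ℝ) t (by
    rw [Polynomial.eval₂_sub, Polynomial.eval₂_X_pow, Polynomial.eval₂_C, ht]; simp)
  have h2 := congrArg f h
  simp only [map_pow, map_add, map_neg, map_one, map_mul] at h2
  nlinarith [sq_nonneg (f r + 1 / 2)]

instance {a : ℤ} [Fact (Irreducible (cubicPoly a))] :
    Fact (∀ r : CubicField a, r ^ 2 ≠ -1 + -1 * r) := ⟨CubicField.sq_ne⟩

variable {a : ℤ}

/-- The cube root of `a` in `ℚ(a^{1/3}, ω)`. -/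
noncomputable def cubicRoot (a : ℤ) : CubicClosure a := ⟨AdjoinRoot.root _, 0⟩

/-- The cube root of unity in `ℚ(a^{1/3}, ω)`. -/
noncomputable def unityRoot (a : ℤ) : CubicClosure a := ⟨0, 1⟩

theorem unityRoot_sq (a : ℤ) : unityRoot a ^ 2 = -1 - unityRoot a := by
  rw [unityRoot, sq]
  ext <;> simp [QuadraticAlgebra.re_one, QuadraticAlgebra.im_one]

theorem root_pow (a : ℤ) : (AdjoinRoot.root (cubicPoly a)) ^ 3 = (a : CubicField a) := by
  have := AdjoinRoot.eval₂_root (cubicPoly a)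
  rw [Polynomial.eval₂_sub, Polynomial.eval₂_X_pow, Polynomial.eval₂_C, sub_eq_zero] at this
  rw [this]; simp

theorem cubicRoot_pow (a : ℤ) : cubicRoot a ^ 3 = (a : CubicClosure a) := by
  have h : (cubicRoot a) = algebraMap (CubicField a) _ (AdjoinRoot.root _) := rfl
  rw [h, ← map_pow, root_pow, map_intCast]

theorem exists_padic_root {a c : ℤ} {q : ℕ} [Fact q.Prime] (hq3 : q % 3 = 2)
    (hqa : ¬ (q : ℤ) ∣ a) (h1 : (q : ℤ) ∣ c ^ 3 + a) (h2 : ¬ (q : ℤ) ^ 2 ∣ c ^ 3 + a) :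
    ∃ t : ℤ_[q], t ^ 3 = a ∧ (t + c : ℤ_[q]).valuation = 1 ∧
      (t ^ 2 - t * c + c ^ 2 : ℤ_[q]).valuation = 0 ∧ t + c ≠ 0 ∧ t ^ 2 - t * c + c ^ 2 ≠ 0 := by
  have hq : q.Prime := Fact.out
  have hqc : ¬ (q : ℤ) ∣ c := fun h ↦ hqa ((Int.dvd_add_right (dvd_pow h (by norm_num))).1 h1)
  have hq3' : ¬ (q : ℤ) ∣ 3 := by
    intro h
    have : q ∣ 3 := by exact_mod_cast h
    have := (Nat.prime_dvd_prime_iff_eq hq Nat.prime_three).1 this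
    omega
  have hu : ‖(3 * c ^ 2 : ℤ_[q])‖ = 1 := by
    have h3 : ((3 * c ^ 2 : ℤ) : ℤ_[q]) = 3 * c ^ 2 := by push_cast; ring
    rw [← h3]
    refine le_antisymm (PadicInt.norm_le_one _) (not_lt.1 fun h ↦ ?_)
    rw [PadicInt.norm_int_lt_one_iff_dvd] at h
    rcases (Nat.prime_iff_prime_int.1 hq).dvd_or_dvd h with h | h
    · exact hq3' h
    · exact hqc ((Nat.prime_iff_prime_int.1 hq).dvd_of_dvd_pow h)
  have hlt : ‖((c ^ 3 + a : ℤ) : ℤ_[q])‖ < 1 := (PadicInt.norm_int_lt_one_iff_dvd _).2 h1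
  obtain ⟨t, ht, htc, -⟩ := hensels_lemma (p := q) (R := ℤ_[q])
    (F := (Polynomial.X ^ 3 - Polynomial.C (a : ℤ_[q])))
    (a := -(c : ℤ_[q])) (by
      have e1 : aeval (-(c : ℤ_[q])) (Polynomial.X ^ 3 - Polynomial.C (a : ℤ_[q])) =
          -((c ^ 3 + a : ℤ) : ℤ_[q]) := by
        simp; ring
      have e2 : aeval (-(c : ℤ_[q]))
          (derivative (Polynomial.X ^ 3 - Polynomial.C (a : ℤ_[q]))) = 3 * c ^ 2 := by
        simp; norm_num
      rw [e1, e2, hu, norm_neg]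
      simpa using hlt)
  have ht3 : t ^ 3 = a := by simpa [sub_eq_zero] using ht
  have hder : aeval (-(c : ℤ_[q]))
      (derivative (Polynomial.X ^ 3 - Polynomial.C (a : ℤ_[q]))) = 3 * c ^ 2 := by
    simp; norm_num
  rw [hder, hu, sub_neg_eq_add] at htc
  have hunit : ‖(t ^ 2 - t * c + c ^ 2 : ℤ_[q])‖ = 1 := by
    refine le_antisymm (PadicInt.norm_le_one _) (not_lt.1 fun h ↦ ?_)
    have e : (3 * c ^ 2 : ℤ_[q]) = (t ^ 2 - t * c + c ^ 2) - (t + c) * (t - 2 * c) := by ring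
    have h3 : ‖((t + c) * (t - 2 * c) : ℤ_[q])‖ < 1 := by
      rw [norm_mul]
      exact (mul_le_of_le_one_right (norm_nonneg _) (PadicInt.norm_le_one _)).trans_lt htc
    have h4 := PadicInt.nonarchimedean (t ^ 2 - t * c + c ^ 2 : ℤ_[q]) (-((t + c) * (t - 2 * c)))
    rw [← sub_eq_add_neg, ← e, hu, norm_neg] at h4
    exact absurd h4 (not_le.2 (max_lt h h3))
  have hne : (t ^ 2 - t * c + c ^ 2 : ℤ_[q]) ≠ 0 := by
    intro h; rw [h] at hunit; simp at hunit
  have hval0 : (t ^ 2 - t * c + c ^ 2 : ℤ_[q]).valuation = 0 := by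
    by_contra h
    have := (PadicInt.norm_le_pow_iff_le_valuation _ hne 1).2 (Nat.one_le_iff_ne_zero.2 h)
    rw [hunit] at this
    have h1q : (1 : ℝ) < q := by exact_mod_cast hq.one_lt
    rw [Nat.cast_one, zpow_neg_one] at this
    exact absurd this (not_le.2 (inv_lt_one_of_one_lt₀ h1q))
  have hfac : ((t + c) * (t ^ 2 - t * c + c ^ 2) : ℤ_[q]) = ((c ^ 3 + a : ℤ) : ℤ_[q]) := by
    push_cast; linear_combination ht3
  have hz0 : c ^ 3 + a ≠ 0 := fun h ↦ h2 (h ▸ dvd_zero _)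
  have hz0' : ((c ^ 3 + a : ℤ) : ℤ_[q]) ≠ 0 := by exact_mod_cast hz0
  have htc0 : (t + c : ℤ_[q]) ≠ 0 := by
    intro h; rw [h, zero_mul] at hfac; exact hz0' hfac.symm
  refine ⟨t, ht3, ?_, hval0, htc0, hne⟩
  have hv1 : 1 ≤ (((c ^ 3 + a : ℤ) : ℤ_[q])).valuation := by
    rw [← PadicInt.norm_le_pow_iff_le_valuation _ hz0', PadicInt.norm_int_le_pow_iff_dvd, pow_one]
    exact h1
  have hv2 : ¬ 2 ≤ (((c ^ 3 + a : ℤ) : ℤ_[q])).valuation := by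
    rw [← PadicInt.norm_le_pow_iff_le_valuation _ hz0', PadicInt.norm_int_le_pow_iff_dvd]
    exact_mod_cast h2
  rw [← hfac, PadicInt.valuation_mul htc0 hne, hval0] at hv1 hv2
  omega

/-- `ℚ_q[ω]` with `ω² + ω + 1 = 0`. -/
abbrev PadicEis (q : ℕ) [Fact q.Prime] : Type := QuadraticAlgebra ℚ_[q] (-1) (-1)

theorem exists_hom_padicEis {a : ℤ} {q : ℕ} [Fact q.Prime] {t : ℚ_[q]} (ht : t ^ 3 = a) :
    ∃ j : CubicClosure a →+* PadicEis q, j (cubicRoot a) = ⟨0, t⟩ ∧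
      j (unityRoot a) = ⟨0, 1⟩ := by
  let f : CubicField a →+* PadicEis q := AdjoinRoot.lift (algebraMap ℚ (PadicEis q)) ⟨0, t⟩ (by
    have h3 : ((⟨0, t⟩ : PadicEis q)) ^ 3 = a := by
      ext
      · simp [pow_succ]
        linear_combination ht
      · simp [pow_succ]
    rw [Polynomial.eval₂_sub, Polynomial.eval₂_X_pow, Polynomial.eval₂_C, h3]
    simp)
  have hf : f (AdjoinRoot.root _) = ⟨0, t⟩ := AdjoinRoot.lift_root _
  let _ : Algebra (CubicField a) (PadicEis q) := f.toAlgebra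
  let j : CubicClosure a →ₐ[CubicField a] PadicEis q :=
    QuadraticAlgebra.lift ⟨(⟨0, 1⟩ : PadicEis q), by
      rw [neg_smul, neg_smul, one_smul, one_smul]
      ext <;> simp [QuadraticAlgebra.re_one, QuadraticAlgebra.im_one]⟩
  refine ⟨j, ?_, ?_⟩
  · rw [← hf]
    exact j.commutes _
  · change j (unityRoot a) = _
    simp [j, unityRoot]

theorem exists_valuation {a c : ℤ} [Fact (Irreducible (cubicPoly a))] {q : ℕ} (hq : q.Prime)
    (hq3 : q % 3 = 2) (hqa : ¬ (q : ℤ) ∣ a) (h1 : (q : ℤ) ∣ c ^ 3 + a)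
    (h2 : ¬ (q : ℤ) ^ 2 ∣ c ^ 3 + a) :
    ∃ v : CubicClosure a → ℤ, (∀ x y, x ≠ 0 → y ≠ 0 → v (x * y) = v x + v y) ∧
      v (cubicRoot a + c * unityRoot a) = 2 ∧ v (cubicRoot a + c * unityRoot a ^ 2) = 0 ∧
      cubicRoot a + c * unityRoot a ^ 2 ≠ 0 ∧
      ∀ x y : ℤ, v (x + y * unityRoot a) = v (x + y * unityRoot a ^ 2) := by
  have : Fact q.Prime := ⟨hq⟩
  obtain ⟨t, ht3, hv1, hv0, hne1, hne0⟩ := exists_padic_root hq3 hqa h1 h2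
  have h4 : (t : ℚ_[q]) ^ 3 = a := by rw [← PadicInt.coe_pow, ht3, PadicInt.coe_intCast]
  obtain ⟨j, hj1, hj2⟩ := exists_hom_padicEis h4
  have hj3 : j (unityRoot a ^ 2) = ⟨-1, -1⟩ := by
    rw [map_pow, hj2, sq]
    ext <;> simp
  refine ⟨fun x ↦ (QuadraticAlgebra.norm (j x)).valuation, fun x y hx hy ↦ ?_, ?_, ?_, ?_, ?_⟩
  · have hn : ∀ z, z ≠ 0 → QuadraticAlgebra.norm (j z) ≠ 0 := by
      intro z hz h
      have h3 : QuadraticAlgebra.norm (j (z * z⁻¹)) = 0 := by rw [map_mul, map_mul, h, zero_mul]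
      rw [mul_inv_cancel₀ hz, map_one, map_one] at h3
      exact one_ne_zero h3
    simp only
    rw [map_mul, map_mul, Padic.valuation_mul (hn x hx) (hn y hy)]
  · have : QuadraticAlgebra.norm (j (cubicRoot a + c * unityRoot a)) =
        (((t + c) ^ 2 : ℤ_[q]) : ℚ_[q]) := by
      rw [map_add, map_mul, map_intCast, hj1, hj2, QuadraticAlgebra.norm_def]
      simp; ring
    simp only
    rw [this, PadicInt.valuation_coe, PadicInt.valuation_pow, hv1]; rfl
  · have : QuadraticAlgebra.norm (j (cubicRoot a + c * unityRoot a ^ 2)) =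
        ((t ^ 2 - t * c + c ^ 2 : ℤ_[q]) : ℚ_[q]) := by
      rw [map_add, map_mul, map_intCast, hj1, hj3, QuadraticAlgebra.norm_def]
      simp; ring
    simp only
    rw [this, PadicInt.valuation_coe, hv0]; rfl
  · intro h
    have h3 : QuadraticAlgebra.norm (j (cubicRoot a + c * unityRoot a ^ 2)) =
        ((t ^ 2 - t * c + c ^ 2 : ℤ_[q]) : ℚ_[q]) := by
      rw [map_add, map_mul, map_intCast, hj1, hj3, QuadraticAlgebra.norm_def]
      simp; ring
    rw [h, map_zero, QuadraticAlgebra.norm_zero] at h3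
    exact hne0 (PadicInt.coe_eq_zero.1 h3.symm)
  · intro x y
    have e1 : j (x + y * unityRoot a) = x + y * ⟨0, 1⟩ := by
      rw [map_add, map_mul, map_intCast, map_intCast, hj2]
    have e2 : j (x + y * unityRoot a ^ 2) = x + y * ⟨-1, -1⟩ := by
      rw [map_add, map_mul, map_intCast, map_intCast, hj3]
    simp only [e1, e2]
    congr 1
    rw [QuadraticAlgebra.norm_def, QuadraticAlgebra.norm_def]
    simp; ring

end CubicField

section Conjugates

open Polynomial NumberField

theorem exists_bound_card_le_idealCount_adjoin (Ω : Type) [Field Ω] [CharZero Ω]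
    (S : Set (𝓞 Ω)) [Finite S] : ∃ (F : Type) (_ : Field F) (_ : NumberField F) (N : ℕ),
      ∀ l : ℕ, l.Prime → N < l → ∀ (k : Type) [Field k] [CharP k l] (r : 𝓞 Ω →+* k)
        (T : Type) [Fintype T] (σ : T → (Ω →+* Ω)),
        (∀ i j, (∀ g ∈ S, σ i g = σ j g) → i = j) →
        (∀ i, ∀ g ∈ S, r (RingOfIntegers.mapRingHom (σ i) g) ^ l =
          r (RingOfIntegers.mapRingHom (σ i) g)) → Fintype.card T ≤ idealCount F l := by
  classical
  set S' : Set Ω := (fun x : 𝓞 Ω ↦ (x : Ω)) '' S with hS'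
  have hint : ∀ x ∈ S', IsIntegral ℚ x := by
    rintro _ ⟨x, -, rfl⟩
    exact x.isIntegral_coe.tower_top
  have : FiniteDimensional ℚ (IntermediateField.adjoin ℚ S') :=
    IntermediateField.finiteDimensional_adjoin hint
  have : NumberField (IntermediateField.adjoin ℚ S') := ⟨⟩
  set F := IntermediateField.adjoin ℚ S' with hF
  have hsub : ∀ x : 𝓞 F, IsIntegral ℤ ((x : F) : Ω) := fun x ↦
    x.isIntegral_coe.map (F.val.restrictScalars ℤ)
  set s : Set (𝓞 F) := {x | ∃ g ∈ S, ((x : F) : Ω) = g} with hs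
  have hval : (fun x : F ↦ (x : Ω)) '' ((fun x : 𝓞 F ↦ (x : F)) '' s) = S' := by
    ext z
    constructor
    · rintro ⟨_, ⟨x, ⟨g, hg, h⟩, rfl⟩, rfl⟩
      exact ⟨g, hg, h.symm⟩
    · rintro ⟨g, hg, rfl⟩
      have hmem : (g : Ω) ∈ F := IntermediateField.subset_adjoin _ _ ⟨g, hg, rfl⟩
      have hi : IsIntegral ℤ (⟨g, hmem⟩ : F) :=
        (isIntegral_algHom_iff (F.val.restrictScalars ℤ) F.val.injective).1 g.isIntegral_coe
      exact ⟨⟨g, hmem⟩, ⟨⟨⟨g, hmem⟩, hi⟩, ⟨g, hg, rfl⟩, rfl⟩, rfl⟩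
  have htop : Algebra.adjoin ℚ ((fun x : 𝓞 F ↦ (x : F)) '' s) = ⊤ := by
    have key : ∀ z ∈ Algebra.adjoin ℚ S',
        ∃ w ∈ Algebra.adjoin ℚ ((fun x : 𝓞 F ↦ (x : F)) '' s), (w : Ω) = z := by
      intro z hz
      induction hz using Algebra.adjoin_induction with
      | mem x hx =>
        rw [← hval] at hx
        obtain ⟨w, hw, rfl⟩ := hx
        exact ⟨w, Algebra.subset_adjoin hw, rfl⟩
      | algebraMap q => exact ⟨q, by rw [← eq_ratCast (algebraMap ℚ F)]; exact Subalgebra.algebraMap_mem _ _, by simp⟩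
      | add x y _ _ hx hy =>
        obtain ⟨u, hu, rfl⟩ := hx
        obtain ⟨v, hv, rfl⟩ := hy
        exact ⟨u + v, add_mem hu hv, rfl⟩
      | mul x y _ _ hx hy =>
        obtain ⟨u, hu, rfl⟩ := hx
        obtain ⟨v, hv, rfl⟩ := hy
        exact ⟨u * v, mul_mem hu hv, rfl⟩
    refine eq_top_iff.2 fun x _ ↦ ?_
    have hx : (x : Ω) ∈ Algebra.adjoin ℚ S' := by
      rw [← IntermediateField.adjoin_toSubalgebra_of_isAlgebraic
        (fun x hx ↦ (hint x hx).isAlgebraic)]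
      exact x.2
    obtain ⟨w, hw, h⟩ := key _ hx
    rwa [← Subtype.ext h]
  obtain ⟨N, hN⟩ := exists_bound_card_le_idealCount (F := F) Ω htop
  refine ⟨F, inferInstance, inferInstance, N, fun l hl hlN k _ _ r T _ σ hinj hfix ↦ ?_⟩
  let τ : T → (F →ₐ[ℚ] Ω) := fun i ↦ ((σ i).comp (algebraMap F Ω)).toRatAlgHom
  have hτ : Function.Injective τ := by
    intro i j hij
    refine hinj i j fun g hg ↦ ?_
    have hmem : (g : Ω) ∈ F := IntermediateField.subset_adjoin _ _ ⟨g, hg, rfl⟩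
    exact congrArg (fun f : F →ₐ[ℚ] Ω ↦ f ⟨g, hmem⟩) hij
  have := hN l hl hlN k r (Finset.univ.map ⟨τ, hτ⟩) ?_
  · simpa using this
  · intro f hf g hg
    simp only [Finset.mem_map, Finset.mem_univ, true_and, Function.Embedding.coeFn_mk] at hf
    obtain ⟨i, rfl⟩ := hf
    obtain ⟨g', hg', h⟩ := hg
    have : RingOfIntegers.mapRingHom (τ i : F →+* Ω) g = RingOfIntegers.mapRingHom (σ i) g' := by
      apply RingOfIntegers.ext
      change σ i (((g : F) : Ω)) = σ i g'
      rw [h]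
    rw [this]
    exact hfix i g' hg'

theorem exists_algEquiv_neg {K Ω : Type*} [Field K] [CharZero K] [Field Ω] [Algebra K Ω]
    [IsAlgClosed Ω] [Algebra.IsAlgebraic K Ω] {d : K} (hd : ∀ x : K, x ^ 2 ≠ d) {δ : Ω}
    (hδ : δ ^ 2 = algebraMap K Ω d) : ∃ τ : Ω ≃ₐ[K] Ω, τ δ = -δ := by
  have : IsAlgClosure K Ω := ⟨inferInstance, inferInstance⟩
  have hirr := X_pow_sub_C_irreducible_of_prime Nat.prime_two hd
  have hmin : minpoly K δ = Polynomial.X ^ 2 - Polynomial.C d :=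
    (minpoly.eq_of_irreducible_of_monic hirr (by simp [hδ]) (monic_X_pow_sub_C d two_ne_zero)).symm
  refine minpoly.exists_algEquiv_of_root' (Algebra.IsAlgebraic.isAlgebraic δ) ?_
  rw [hmin]; simp [hδ]

theorem exists_algEquiv_of_pow_eq {M Ω : Type*} [Field M] [Field Ω] [Algebra M Ω] [IsAlgClosed Ω]
    [Algebra.IsAlgebraic M Ω] {p : ℕ} (hp : p.Prime) {β d : M}
    (hβ : ∀ f, f = 1 ∨ f = 2 → ∀ μ : M, μ ^ p ≠ β ^ f) {δ : Ω} (hδ : δ ^ 2 = algebraMap M Ω d)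
    {ρ ρ' : Ω} (hρ : ρ ^ p = algebraMap M Ω β) (hρ' : ρ' ^ p = algebraMap M Ω β) :
    ∃ σ : Ω ≃ₐ[M] Ω, σ δ = δ ∧ σ ρ = ρ' := by
  set L := IntermediateField.adjoin M {δ} with hL
  have : Algebra.IsAlgebraic L Ω := Algebra.IsAlgebraic.tower_top (K := M) L
  have : IsAlgClosure L Ω := ⟨inferInstance, inferInstance⟩
  have hδi : IsIntegral M δ := (Algebra.IsAlgebraic.isAlgebraic δ).isIntegral
  have : FiniteDimensional M L := IntermediateField.adjoin.finiteDimensional hδi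
  have hdeg : Module.finrank M L = 1 ∨ Module.finrank M L = 2 := by
    have h1 : Module.finrank M L ≤ 2 := by
      rw [hL, IntermediateField.adjoin.finrank hδi]
      refine (minpoly.min M δ (p := Polynomial.X ^ 2 - Polynomial.C d)
        (monic_X_pow_sub_C d two_ne_zero)
        (by simp [hδ]) |> natDegree_le_natDegree).trans ?_
      rw [natDegree_X_pow_sub_C]
    have h2 : 0 < Module.finrank M L := Module.finrank_pos
    omega
  have hirr : Irreducible (Polynomial.X ^ p - Polynomial.C (algebraMap M L β)) := by
    refine X_pow_sub_C_irreducible_of_prime hp fun b hb ↦ ?_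
    refine hβ _ hdeg (Algebra.norm M b) ?_
    rw [← map_pow, hb, Algebra.norm_algebraMap]
  have hmin : minpoly L ρ = Polynomial.X ^ p - Polynomial.C (algebraMap M L β) := by
    refine (minpoly.eq_of_irreducible_of_monic hirr ?_ (monic_X_pow_sub_C _ hp.ne_zero)).symm
    simp [hρ, ← IsScalarTower.algebraMap_apply]
  obtain ⟨σ, hσ⟩ := minpoly.exists_algEquiv_of_root' (K := L) (x := ρ') (y := ρ)
    (Algebra.IsAlgebraic.isAlgebraic ρ) (by
      rw [hmin]; simp [hρ', ← IsScalarTower.algebraMap_apply])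
  refine ⟨σ.restrictScalars M, ?_, hσ⟩
  exact σ.commutes (⟨δ, IntermediateField.mem_adjoin_simple_self M δ⟩ : L)

theorem sq_ne_of_cubicField {a : ℤ} [Fact (Irreducible (cubicPoly a))] {d : ℤ}
    (hd : ∀ x : ℤ, x ^ 2 ≠ d) (x : CubicField a) : x ^ 2 ≠ d := by
  intro h
  have hmon : (cubicPoly a).Monic := monic_X_pow_sub_C _ (by norm_num)
  have hfr : Module.finrank ℚ (CubicField a) = 3 := by
    rw [(AdjoinRoot.powerBasis' hmon).finrank, AdjoinRoot.powerBasis'_dim]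
    exact natDegree_X_pow_sub_C
  have h1 := congrArg (Algebra.norm ℚ) h
  have h2 : Algebra.norm ℚ ((d : ℤ) : CubicField a) = (d : ℚ) ^ 3 := by
    have : ((d : ℤ) : CubicField a) = algebraMap ℚ _ (d : ℚ) := by simp
    rw [this, Algebra.norm_algebraMap, hfr]
  rw [map_pow, h2] at h1
  have hd0 : (d : ℚ) ≠ 0 := by
    intro h0
    have : d = 0 := by exact_mod_cast h0
    exact hd 0 (by rw [this]; rfl)
  have h3 : (Algebra.norm ℚ x / d) ^ 2 = d := by
    rw [div_pow, h1]; field_simp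
  have hint : IsIntegral ℤ (Algebra.norm ℚ x / d) := by
    refine IsIntegral.of_pow (n := 2) (by norm_num) ?_
    rw [h3]
    exact isIntegral_algebraMap (R := ℤ) (x := d)
  obtain ⟨z, hz⟩ := (IsIntegrallyClosed.isIntegral_iff (R := ℤ)).1 hint
  rw [← hz, eq_intCast] at h3
  exact hd z (by exact_mod_cast h3)

theorem eq_of_add_eq_add {Ω : Type*} [Field Ω] {p : ℕ} {β β' c x x' y y' : Ω}
    (hβ : β ≠ β') (hx : x ^ p = β) (hy' : y' ^ p = β')
    (hxx : x * x' = c) (hyy : y * y' = c) (h : x + x' = y + y') : x = y := by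
  have h1 : (x - y) * (x - y') = 0 := by
    linear_combination x * h - hxx + hyy
  rcases mul_eq_zero.1 h1 with h2 | h2
  · exact sub_eq_zero.1 h2
  · rw [sub_eq_zero] at h2
    exact absurd (by rw [← hx, h2, hy']) hβ

end Conjugates

section Twist

/-- The element `(θ + cω) η(ω)^{p-1}` attached to `η ∈ ℤ[ω]`. -/
def twist {R : Type*} [CommRing R] (θ ω : R) (c : ℤ) (η : Eis) (p : ℕ) : R :=
  (θ + c * ω) * (η.re + η.im * ω) ^ (p - 1)

theorem map_twist {R S : Type*} [CommRing R] [CommRing S] (f : R →+* S) (θ ω : R) (c : ℤ) (η : Eis)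
    (p : ℕ) : f (twist θ ω c η p) = twist (f θ) (f ω) c η p := by
  simp [twist]

theorem twist_ne_zero_and_pow_ne {a c : ℤ} [Fact (Irreducible (cubicPoly a))] {q : ℕ}
    (hq : q.Prime) (hq3 : q % 3 = 2) (hqa : ¬ (q : ℤ) ∣ a) (h1 : (q : ℤ) ∣ c ^ 3 + a)
    (h2 : ¬ (q : ℤ) ^ 2 ∣ c ^ 3 + a) {η : Eis} (hη : η ≠ 0) {p : ℕ} (hp : p.Prime) (hp2 : Odd p)
    {ξ ξ' : CubicClosure a} (hξ : ξ = twist (cubicRoot a) (unityRoot a) c η p)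
    (hξ' : ξ' = twist (cubicRoot a) (unityRoot a ^ 2) c η p) :
    ξ ≠ 0 ∧ ξ' ≠ 0 ∧ (∀ f, f = 1 ∨ f = 2 → ∀ μ, μ ^ p ≠ (ξ * ξ' ^ (p - 1)) ^ f) ∧
      ξ * ξ' ^ (p - 1) ≠ ξ' * ξ ^ (p - 1) := by
  obtain ⟨v, hmul, hv2, hv0, hne, hconj⟩ := exists_valuation hq hq3 hqa h1 h2
  have hp3 : 3 ≤ p := by
    have := hp.two_le
    rcases hp2 with ⟨k, hk⟩
    omega
  have hv1 : v 1 = 0 := by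
    have := hmul 1 1 one_ne_zero one_ne_zero
    rw [mul_one] at this
    omega
  have hpow : ∀ (x : CubicClosure a) (n : ℕ), x ≠ 0 → v (x ^ n) = n * v x := by
    intro x n hx
    induction n with
    | zero => simp [hv1]
    | succ n ih =>
      rw [pow_succ, hmul _ _ (pow_ne_zero _ hx) hx, ih]
      push_cast
      ring
  have hω : unityRoot a ^ 2 = ⟨-1, -1⟩ := by
    rw [unityRoot_sq]
    ext <;> simp [unityRoot, QuadraticAlgebra.re_one, QuadraticAlgebra.im_one]
  have hne' : cubicRoot a + c * unityRoot a ≠ 0 := by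
    intro h
    have hr := congrArg QuadraticAlgebra.re h
    have hi := congrArg QuadraticAlgebra.im h
    have hc : (c : CubicField a) = 0 := by simpa [cubicRoot, unityRoot] using hi
    have hroot : AdjoinRoot.root (cubicPoly a) = 0 := by
      simpa [cubicRoot, unityRoot] using hr
    apply hne
    rw [hω]
    ext <;> simp [cubicRoot, hroot, hc]
  set e : CubicClosure a := η.re + η.im * unityRoot a with he
  set e' : CubicClosure a := η.re + η.im * unityRoot a ^ 2 with he'
  have hee : v e' = v e := (hconj _ _).symm
  have hη' : η.re ≠ 0 ∨ η.im ≠ 0 := by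
    by_contra! h
    exact hη (by ext <;> simp [h])
  have he0 : e ≠ 0 := by
    intro h
    have hr := congrArg QuadraticAlgebra.re h
    have hi := congrArg QuadraticAlgebra.im h
    simp [he, unityRoot] at hr hi
    omega
  have he0' : e' ≠ 0 := by
    intro h
    rw [he', hω] at h
    have hr := congrArg QuadraticAlgebra.re h
    have hi := congrArg QuadraticAlgebra.im h
    simp at hr hi
    rw [hi] at hr
    simp at hr
    omega
  have hX : ξ ≠ 0 := by rw [hξ]; exact mul_ne_zero hne' (pow_ne_zero _ he0)
  have hX' : ξ' ≠ 0 := by rw [hξ']; exact mul_ne_zero hne (pow_ne_zero _ he0')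
  have hvX : v ξ = 2 + (p - 1) * v e := by
    rw [hξ, twist, hmul _ _ hne' (pow_ne_zero _ he0), hv2, hpow _ _ he0,
      Nat.cast_sub (by omega)]
    simp
  have hvX' : v ξ' = (p - 1) * v e := by
    rw [hξ', twist, hmul _ _ hne (pow_ne_zero _ he0'), hv0, hpow _ _ he0', hee,
      Nat.cast_sub (by omega)]
    simp
  have hβ0 : ξ * ξ' ^ (p - 1) ≠ 0 := mul_ne_zero hX (pow_ne_zero _ hX')
  have hvβ : v (ξ * ξ' ^ (p - 1)) = 2 + p * ((p - 1) * v e) := by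
    rw [hmul _ _ hX (pow_ne_zero _ hX'), hpow _ _ hX', hvX, hvX', Nat.cast_sub (by omega)]
    push_cast
    ring
  have hp4 : ¬ p ∣ 2 * 1 ∧ ¬ p ∣ 2 * 2 := by
    constructor <;> intro h
    · have := Nat.le_of_dvd (by norm_num) h; omega
    · rcases (hp.dvd_mul).1 h with h | h <;>
      · have := Nat.le_of_dvd (by norm_num) h; omega
  refine ⟨hX, hX', fun f hf μ hμ ↦ ?_, fun h ↦ ?_⟩
  · have hμ0 : μ ≠ 0 := by
      rintro rfl
      rw [zero_pow hp.ne_zero] at hμ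
      exact pow_ne_zero _ hβ0 hμ.symm
    have h3 := congrArg v hμ
    rw [hpow _ _ hμ0, hpow _ _ hβ0, hvβ] at h3
    have h4 : (p : ℤ) ∣ ((2 * f : ℕ) : ℤ) :=
      ⟨v μ - f * ((p - 1) * v e), by push_cast; linear_combination -h3⟩
    rw [Int.natCast_dvd_natCast] at h4
    rcases hf with rfl | rfl
    · exact hp4.1 h4
    · exact hp4.2 h4
  · have h3 := congrArg v h
    rw [hvβ, hmul _ _ hX' (pow_ne_zero _ hX), hpow _ _ hX, hvX, hvX',
      Nat.cast_sub (by omega)] at h3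
    push_cast at h3
    have h4 : (p : ℤ) = 2 := by nlinarith
    omega

theorem frobenius_fixed {k : Type*} [Field k] {l p e : ℕ} [Fact l.Prime] [CharP k l]
    (hl3 : l % 3 = 2) (hp : Odd p) (he : l + 1 = p * e) {θ ω ρ ρ' : k} (hω : ω ^ 2 = -1 - ω)
    {c : ℤ} {η w : Eis} {x y : ℤ} (hy : ¬ (l : ℤ) ∣ y) (hxy : (y : k) * θ = -x)
    (hw : (⟨x, -c * y⟩ : Eis) = η * w ^ p) (hu : twist θ ω c η p ≠ 0)
    (hρ : ρ ^ p = twist θ ω c η p * twist θ (ω ^ 2) c η p ^ (p - 1))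
    (hρρ : ρ * ρ' = twist θ ω c η p * twist θ (ω ^ 2) c η p) :
    θ ^ l = θ ∧ (ρ + ρ') ^ l = ρ + ρ' := by
  have hl : l.Prime := Fact.out
  have hy0 : (y : k) ≠ 0 := by rwa [Ne, CharP.intCast_eq_zero_iff k l]
  have hθ : θ = -x / y := by rw [eq_div_iff hy0, mul_comm, hxy]
  have hθl : θ ^ l = θ := by
    have h := map_div₀ (frobenius k l) (-(x : k)) y
    rw [map_neg, map_intCast, map_intCast] at h
    rw [hθ]
    exact h
  have hω3 : ω ^ 3 = 1 := by linear_combination (ω - 1) * hω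
  have hωl : ω ^ l = ω ^ 2 := by
    conv_lhs => rw [← Nat.div_add_mod l 3, hl3, pow_add, pow_mul, hω3, one_pow, one_mul]
  have hωl' : (ω ^ 2) ^ l = ω := by
    rw [← pow_mul, mul_comm, pow_mul, hωl]
    linear_combination ω * hω3
  set u := twist θ ω c η p with hu_def
  set u' := twist θ (ω ^ 2) c η p with hu'_def
  have huu : u ^ l = u' := by
    have := map_twist (frobenius k l) θ ω c η p
    simp only [frobenius_def, hθl, hωl] at this
    exact this
  have huu' : u' ^ l = u := by
    have := map_twist (frobenius k l) θ (ω ^ 2) c η p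
    simp only [frobenius_def, hθl, hωl'] at this
    exact this
  let f : Eis →ₐ[ℤ] k := QuadraticAlgebra.lift ⟨ω, by
    rw [← sq, hω]; simp; ring⟩
  have hf : ∀ z : Eis, f z = z.re + z.im * ω := by
    intro z
    simp [f, QuadraticAlgebra.lift]
  set v := f η * f w with hv
  have hvp : -(y : k) * u = v ^ p := by
    have h1 := congrArg f hw
    rw [map_mul, map_pow, hf ⟨x, -c * y⟩] at h1
    simp only [Int.cast_mul, Int.cast_neg] at h1
    obtain ⟨n, hn⟩ : ∃ n, p = n + 1 := ⟨p - 1, by have := hp.pos; omega⟩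
    rw [hv, mul_pow, hu_def, twist, ← hf η, hn, Nat.add_sub_cancel]
    rw [hn] at h1
    linear_combination (f η) ^ n * h1 - (f η) ^ n * hxy
  have hv0 : v ≠ 0 := by
    intro h
    rw [h, zero_pow hp.pos.ne'] at hvp
    exact mul_ne_zero (neg_ne_zero.2 hy0) hu hvp
  have hvl : (v ^ l) ^ l = v := by
    have hfl : ∀ z : Eis, ((f z) ^ l) ^ l = f z := by
      intro z
      rw [hf]
      have h1 : frobenius k l ω = ω ^ 2 := hωl
      have h2 : frobenius k l (ω ^ 2) = ω := hωl'
      change frobenius k l (frobenius k l _) = _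
      rw [map_add, map_mul, map_intCast, map_intCast, h1, map_add, map_mul, map_intCast,
        map_intCast, h2]
    rw [hv, mul_pow, mul_pow, hfl, hfl]
  obtain ⟨n, rfl⟩ : ∃ n, l = n + 1 := ⟨l - 1, by have := hl.pos; omega⟩
  have hv1 : v ^ (n * (n + 1 + 1)) = 1 := by
    apply mul_right_cancel₀ hv0
    rw [one_mul, ← pow_succ, show n * (n + 1 + 1) + 1 = (n + 1) * (n + 1) by ring, pow_mul, hvl]
  have hy1 : (-(y : k)) ^ n = 1 := by
    apply mul_right_cancel₀ (neg_ne_zero.2 hy0)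
    rw [one_mul, ← pow_succ]
    have h := map_intCast (frobenius k (n + 1)) (-y)
    simpa [frobenius_def] using h
  have hu1 : u ^ ((n + 1 - 1) * e) = 1 := by
    rw [Nat.add_sub_cancel]
    have : (-(y : k) * u) ^ (n * e) = 1 := by
      rw [hvp, ← pow_mul, show p * (n * e) = n * (p * e) by ring, ← he, hv1]
    rwa [mul_pow, pow_mul, hy1, one_pow, one_mul] at this
  exact ⟨hθl, add_pow_eq_add_of_pow_eq hp he hu huu huu' hρ hρρ hu1⟩

end Twist

section InertPrimes

open Polynomial NumberField

/-- An algebraic closure of `ℚ(a^{1/3}, ω)`. -/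
abbrev CubicAlgClosure (a : ℤ) [Fact (Irreducible (cubicPoly a))] : Type :=
  AlgebraicClosure (CubicClosure a)

theorem exists_residue_hom (Ω : Type) [Field Ω] [CharZero Ω] {l : ℕ} (hl : l.Prime) :
    ∃ (k : Type) (_ : Field k) (_ : CharP k l), Nonempty (𝓞 Ω →+* k) := by
  have hne : ¬ IsUnit ((l : ℕ) : 𝓞 Ω) := by
    intro h
    obtain ⟨z, hz⟩ := h.exists_right_inv
    have h1 : (z : Ω) = algebraMap ℚ Ω (1 / l) := by
      have h2 := congrArg (fun x : 𝓞 Ω ↦ (x : Ω)) hz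
      simp only [map_mul, map_natCast, map_one] at h2
      have hl0 : (l : Ω) ≠ 0 := Nat.cast_ne_zero.2 hl.ne_zero
      rw [map_div₀, map_one, map_natCast, eq_div_iff hl0, mul_comm, h2]
    have h3 : IsIntegral ℤ ((1 : ℚ) / l) := by
      rw [← isIntegral_algebraMap_iff (algebraMap ℚ Ω).injective, ← h1]
      exact z.isIntegral_coe
    obtain ⟨y, hy⟩ := (IsIntegrallyClosed.isIntegral_iff (R := ℤ)).1 h3
    rw [eq_intCast, eq_div_iff (by exact_mod_cast hl.ne_zero)] at hy
    have h4 : y * l = 1 := by exact_mod_cast hy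
    have h5 : (l : ℤ) ∣ 1 := ⟨y, by rw [mul_comm, h4]⟩
    have h6 : l ∣ 1 := by exact_mod_cast h5
    exact hl.one_lt.ne' (Nat.dvd_one.1 h6)
  obtain ⟨m, hm, hmem⟩ := exists_max_ideal_of_mem_nonunits (mem_nonunits_iff.2 hne)
  let _ := Ideal.Quotient.field m
  refine ⟨𝓞 Ω ⧸ m, inferInstance, ?_, ⟨Ideal.Quotient.mk m⟩⟩
  refine (CharP.charP_iff_prime_eq_zero hl).2 ?_
  rw [← map_natCast (Ideal.Quotient.mk m), Ideal.Quotient.eq_zero_iff_mem]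
  exact hmem

theorem exists_residue_hom_root {a : ℤ} (hirr : Irreducible (cubicPoly a)) {Ω : Type} [Field Ω]
    [CharZero Ω] [IsAlgClosed Ω] [Algebra.IsAlgebraic ℚ Ω] {θ ω : 𝓞 Ω} (hθ : θ ^ 3 = a)
    (hω : ω ^ 2 = -1 - ω) {l : ℕ} (hl : l.Prime) {x y : ℤ} (h : (l : ℤ) ∣ x ^ 3 + a * y ^ 3) :
    ∃ (k : Type) (_ : Field k) (_ : CharP k l) (r : 𝓞 Ω →+* k), (y : k) * r θ = -x := by
  have : IsAlgClosure ℚ Ω := ⟨inferInstance, inferInstance⟩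
  obtain ⟨k, _, _, ⟨r⟩⟩ := exists_residue_hom Ω hl
  have hω3 : ω ^ 3 = 1 := by linear_combination (ω - 1) * hω
  obtain ⟨θ', hθ', hr⟩ : ∃ θ' : 𝓞 Ω, θ' ^ 3 = a ∧ (y : k) * r θ' = -x := by
    have h1 : (x : k) ^ 3 + a * y ^ 3 = 0 := by
      have := (CharP.intCast_eq_zero_iff k l _).2 h
      exact_mod_cast this
    have h2 : (r θ) ^ 3 = a := by rw [← map_pow, hθ, map_intCast]
    have h3 : (r ω) ^ 2 = -1 - r ω := by rw [← map_pow, hω]; simp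
    have h4 : (y * r θ + x) * ((y * r (θ * ω) + x) * (y * r (θ * ω ^ 2) + x)) = 0 := by
      simp only [map_mul, map_pow]
      have h33 : (r ω) ^ 3 = 1 := by rw [← map_pow, hω3, map_one]
      linear_combination h1 + y ^ 3 * h2 * (r ω) ^ 3 + a * y ^ 3 * h33 +
        (y * r θ * x ^ 2 + y ^ 2 * (r θ) ^ 2 * x * r ω) * h3
    rcases mul_eq_zero.1 h4 with h5 | h5
    · exact ⟨θ, hθ, by linear_combination h5⟩
    rcases mul_eq_zero.1 h5 with h5 | h5
    · exact ⟨θ * ω, by rw [mul_pow, hω3, hθ, mul_one], by linear_combination h5⟩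
    · exact ⟨θ * ω ^ 2, by rw [mul_pow, ← pow_mul, mul_comm 2, pow_mul, hω3, hθ, one_pow, mul_one],
        by linear_combination h5⟩
  have hmin : minpoly ℚ (θ : Ω) = cubicPoly a := by
    refine (minpoly.eq_of_irreducible_of_monic hirr ?_ (monic_X_pow_sub_C _ three_ne_zero)).symm
    have := congrArg (fun z : 𝓞 Ω ↦ (z : Ω)) hθ
    simp only [map_pow, map_intCast] at this
    simp [this]
  obtain ⟨g, hg⟩ := minpoly.exists_algEquiv_of_root' (K := ℚ) (x := (θ' : Ω)) (y := (θ : Ω))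
    (Algebra.IsAlgebraic.isAlgebraic _) (by
      rw [hmin]
      have := congrArg (fun z : 𝓞 Ω ↦ (z : Ω)) hθ'
      simp only [map_pow, map_intCast] at this
      simp [this])
  refine ⟨k, inferInstance, inferInstance,
    r.comp (RingOfIntegers.mapRingHom (g : Ω →+* Ω)), ?_⟩
  have h6 : RingOfIntegers.mapRingHom (g : Ω →+* Ω) θ = θ' := RingOfIntegers.ext hg
  rw [RingHom.comp_apply, h6, hr]

end InertPrimes

section InertPrimesCore

open Polynomial NumberField

theorem exists_inert_prime_core {a c : ℤ} [Fact (Irreducible (cubicPoly a))] {q₀ : ℕ}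
    (hq : q₀.Prime) (hq3 : q₀ % 3 = 2) (hqa : ¬ (q₀ : ℤ) ∣ a) (h1 : (q₀ : ℤ) ∣ c ^ 3 + a)
    (h2 : ¬ (q₀ : ℤ) ^ 2 ∣ c ^ 3 + a) {η : Eis} (hη : η ≠ 0) {p : ℕ} (hp : p.Prime) (hp2 : Odd p)
    (N : ℕ) {q : ℕ} [NeZero q] {b : ZMod q} (hb : IsUnit b) {D : ℤ} {J : Type} [Fintype J]
    (hk : q.totient < p * Fintype.card J) {δ : CubicAlgClosure a} (hδ : δ ^ 2 = D)
    (τ : J → (CubicAlgClosure a ≃ₐ[CubicField a] CubicAlgClosure a))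
    (hτ : ∀ i j, τ i δ = τ j δ → i = j)
    (hl : ∀ l : ℕ, l.Prime → N < l → (l : ZMod q) = b →
      l % 3 = 2 ∧ p ∣ l + 1 ∧ ∃ s : ℤ, (l : ℤ) ∣ s ^ 2 - D) :
    ∃ l : ℕ, l.Prime ∧ N < l ∧ l % 3 = 2 ∧ ∀ (x y : ℤ) (w : Eis),
      (l : ℤ) ∣ x ^ 3 + a * y ^ 3 → ¬ (l : ℤ) ∣ y → (⟨x, -c * y⟩ : Eis) ≠ η * w ^ p := by
  classical
  have : CharZero (CubicAlgClosure a) := charZero_of_injective_algebraMap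
    (algebraMap (CubicClosure a) _).injective
  have : Module.Finite ℚ (CubicField a) :=
    (monic_X_pow_sub_C (a : ℚ) three_ne_zero).finite_adjoinRoot
  have : Algebra.IsAlgebraic ℚ (CubicClosure a) :=
    Algebra.IsAlgebraic.trans ℚ (CubicField a) (CubicClosure a)
  have : Algebra.IsAlgebraic ℚ (CubicAlgClosure a) :=
    Algebra.IsAlgebraic.trans ℚ (CubicClosure a) (CubicAlgClosure a)
  set ι := algebraMap (CubicClosure a) (CubicAlgClosure a) with hι
  set ξ := twist (cubicRoot a) (unityRoot a) c η p with hξ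
  set ξ' := twist (cubicRoot a) (unityRoot a ^ 2) c η p with hξ'
  obtain ⟨hξ0, hξ0', hβ, hββ⟩ := twist_ne_zero_and_pow_ne hq hq3 hqa h1 h2 hη hp hp2 hξ hξ'
  obtain ⟨ρ, hρ⟩ := IsAlgClosed.exists_pow_nat_eq (ι (ξ * ξ' ^ (p - 1))) hp.pos
  have hρ0 : ρ ≠ 0 := by
    rintro rfl
    rw [zero_pow hp.ne_zero] at hρ
    exact mul_ne_zero hξ0 (pow_ne_zero _ hξ0') ((map_eq_zero ι).1 hρ.symm)
  set ρ' := ι (ξ * ξ') / ρ with hρ'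
  have hρρ : ρ * ρ' = ι (ξ * ξ') := mul_div_cancel₀ _ hρ0
  have hρp' : ρ' ^ p = ι (ξ' * ξ ^ (p - 1)) := by
    apply mul_left_cancel₀ (pow_ne_zero p hρ0)
    rw [← mul_pow, hρρ, hρ, ← map_pow, ← map_mul]
    congr 1
    obtain ⟨n, rfl⟩ : ∃ n, p = n + 1 := ⟨p - 1, by have := hp.pos; omega⟩
    rw [Nat.add_sub_cancel]
    ring
  have hω3 : unityRoot a ^ 3 = 1 := by linear_combination (unityRoot a - 1) * unityRoot_sq a
  have hθi : IsIntegral ℤ (ι (cubicRoot a)) := by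
    refine IsIntegral.of_pow (n := 3) (by norm_num) ?_
    rw [← map_pow, cubicRoot_pow, map_intCast, ← eq_intCast (algebraMap ℤ (CubicAlgClosure a))]
    exact isIntegral_algebraMap
  have hωi : IsIntegral ℤ (ι (unityRoot a)) := by
    refine IsIntegral.of_pow (n := 3) (by norm_num) ?_
    rw [← map_pow, hω3, map_one]
    exact isIntegral_one
  have hδi : IsIntegral ℤ δ := by
    refine IsIntegral.of_pow (n := 2) (by norm_num) ?_
    rw [hδ, ← eq_intCast (algebraMap ℤ (CubicAlgClosure a))]
    exact isIntegral_algebraMap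
  let θ : 𝓞 (CubicAlgClosure a) := ⟨ι (cubicRoot a), hθi⟩
  let ω : 𝓞 (CubicAlgClosure a) := ⟨ι (unityRoot a), hωi⟩
  have hcoe : ∀ x y : 𝓞 (CubicAlgClosure a), algebraMap _ (CubicAlgClosure a) x =
      algebraMap _ (CubicAlgClosure a) y → x = y := fun x y h ↦ RingOfIntegers.ext h
  have hθc : algebraMap _ (CubicAlgClosure a) θ = ι (cubicRoot a) := rfl
  have hωc : algebraMap _ (CubicAlgClosure a) ω = ι (unityRoot a) := rfl
  have htw : algebraMap _ (CubicAlgClosure a) (twist θ ω c η p) = ι ξ := by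
    rw [map_twist, hξ, map_twist, hθc, hωc]
  have htw' : algebraMap _ (CubicAlgClosure a) (twist θ (ω ^ 2) c η p) = ι ξ' := by
    rw [map_twist, hξ', map_twist, map_pow, hθc, hωc, map_pow]
  have hρi : IsIntegral ℤ ρ := by
    refine IsIntegral.of_pow hp.pos ?_
    rw [hρ, map_mul, map_pow, ← htw, ← htw', ← map_pow, ← map_mul]
    exact RingOfIntegers.isIntegral_coe _
  have hρi' : IsIntegral ℤ ρ' := by
    refine IsIntegral.of_pow hp.pos ?_
    rw [hρp', map_mul, map_pow, ← htw, ← htw', ← map_pow, ← map_mul]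
    exact RingOfIntegers.isIntegral_coe _
  let r₁ : 𝓞 (CubicAlgClosure a) := ⟨ρ, hρi⟩
  let r₂ : 𝓞 (CubicAlgClosure a) := ⟨ρ', hρi'⟩
  let d : 𝓞 (CubicAlgClosure a) := ⟨δ, hδi⟩
  have hr₁c : algebraMap _ (CubicAlgClosure a) r₁ = ρ := rfl
  have hr₂c : algebraMap _ (CubicAlgClosure a) r₂ = ρ' := rfl
  have hdc : algebraMap _ (CubicAlgClosure a) d = δ := rfl
  have hθ3 : θ ^ 3 = a := hcoe _ _ (by
    rw [map_pow, hθc, ← map_pow, cubicRoot_pow, map_intCast, map_intCast])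
  have hω2 : ω ^ 2 = -1 - ω := hcoe _ _ (by
    rw [map_pow, hωc, ← map_pow, unityRoot_sq, map_sub, map_sub, hωc, map_neg, map_neg, map_one,
      map_one])
  have hd2 : d ^ 2 = D := hcoe _ _ (by rw [map_pow, hdc, hδ, map_intCast])
  have hr₁p : r₁ ^ p = twist θ ω c η p * twist θ (ω ^ 2) c η p ^ (p - 1) := hcoe _ _ (by
    rw [map_pow, hr₁c, hρ, map_mul, map_mul, map_pow, map_pow, htw, htw'])
  have hr₁₂ : r₁ * r₂ = twist θ ω c η p * twist θ (ω ^ 2) c η p := hcoe _ _ (by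
    rw [map_mul, hr₁c, hr₂c, hρρ, map_mul, map_mul, htw, htw'])
  have htw0 : twist θ ω c η p ≠ 0 := by
    intro h
    rw [h, map_zero] at htw
    exact hξ0 ((map_eq_zero ι).1 htw.symm)
  let S : Set (𝓞 (CubicAlgClosure a)) := {θ, r₁ + r₂, d}
  obtain ⟨F, _, _, N₁, hF⟩ := exists_bound_card_le_idealCount_adjoin (CubicAlgClosure a) S
  obtain ⟨N₂, hN₂⟩ := exists_bound_map_ne_zero htw0
  obtain ⟨l, hlp, hlN, hlb, hlk⟩ :=
    exists_prime_idealCount_lt F hb (N + N₁ + N₂) hk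
  obtain ⟨hl3, ⟨e, he⟩, s, hs⟩ := hl l hlp (by omega) hlb
  refine ⟨l, hlp, by omega, hl3, fun x y w hxy hy hw ↦ ?_⟩
  obtain ⟨k, _, _, r, hr⟩ := exists_residue_hom_root (Fact.out : Irreducible (cubicPoly a))
    hθ3 hω2 hlp hxy
  have : Fact l.Prime := ⟨hlp⟩
  have : NeZero (p : CubicAlgClosure a) := ⟨Nat.cast_ne_zero.2 hp.ne_zero⟩
  obtain ⟨ζ, hζ⟩ := HasEnoughRootsOfUnity.exists_primitiveRoot (CubicAlgClosure a) p
  have hσ : ∀ i : Fin p, ∃ σ : CubicAlgClosure a ≃ₐ[CubicClosure a] CubicAlgClosure a,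
      σ δ = δ ∧ σ ρ = ρ * ζ ^ (i : ℕ) := fun i ↦
    exists_algEquiv_of_pow_eq hp hβ (d := (D : CubicClosure a)) (by rw [hδ, map_intCast]) hρ (by
      rw [mul_pow, hρ, ← pow_mul, mul_comm (i : ℕ), pow_mul, hζ.pow_eq_one, one_pow, mul_one])
  choose σ hσδ hσρ using hσ
  let f : J × Fin p → (CubicAlgClosure a →+* CubicAlgClosure a) := fun i ↦
    ((τ i.1 : CubicAlgClosure a →+* CubicAlgClosure a)).comp
      (σ i.2 : CubicAlgClosure a →+* CubicAlgClosure a)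
  have hfθ : ∀ i, RingOfIntegers.mapRingHom (f i) θ = θ := by
    intro i
    apply hcoe
    change τ i.1 (σ i.2 (ι (cubicRoot a))) = ι (cubicRoot a)
    rw [hι, (σ i.2).commutes]
    have : cubicRoot a = algebraMap (CubicField a) (CubicClosure a) (AdjoinRoot.root _) := rfl
    rw [this, ← IsScalarTower.algebraMap_apply, (τ i.1).commutes]
  have hcard := hF l hlp (by omega) k r (J × Fin p) f ?_ ?_
  · rw [Fintype.card_prod, Fintype.card_fin, mul_comm] at hcard
    omega
  · rintro ⟨i, j⟩ ⟨i', j'⟩ h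
    have hd : τ i (σ j δ) = τ i' (σ j' δ) := h d (by simp [S])
    rw [hσδ, hσδ] at hd
    obtain rfl := hτ _ _ hd
    have hκ : τ i (σ j (ρ + ρ')) = τ i (σ j' (ρ + ρ')) := h (r₁ + r₂) (by simp [S])
    have hκ' := (τ i).injective hκ
    rw [map_add, map_add] at hκ'
    have h3 := eq_of_add_eq_add (p := p) (ι.injective.ne hββ)
      (by rw [← map_pow, hρ, hι, (σ j).commutes]) (by rw [← map_pow, hρp', hι, (σ j').commutes])
      (c := ι (ξ * ξ'))
      (by rw [← map_mul, hρρ, hι, (σ j).commutes]) (by rw [← map_mul, hρρ, hι, (σ j').commutes])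
      hκ'
    rw [hσρ, hσρ] at h3
    have h4 := hζ.pow_inj j.2 j'.2 (mul_left_cancel₀ hρ0 h3)
    rw [Fin.ext h4]
  · intro i
    let r' := r.comp (RingOfIntegers.mapRingHom (f i))
    have hr'θ : r' θ = r θ := by
      change r (RingOfIntegers.mapRingHom (f i) θ) = _
      rw [hfθ]
    have hfix := frobenius_fixed (k := k) (θ := r' θ) (ω := r' ω) (ρ := r' r₁) (ρ' := r' r₂)
      hl3 hp2 he (by rw [← map_pow, hω2]; simp) hy (by rw [hr'θ, hr]) hw
      (by
        rw [← map_twist]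
        exact hN₂ l hlp (by omega) k r')
      (by rw [← map_pow, ← map_pow, hr₁p, map_mul, map_pow, map_twist, map_twist])
      (by rw [← map_pow, ← map_mul, hr₁₂, map_mul, map_twist, map_twist])
    intro g hg
    simp only [S, Set.mem_insert_iff, Set.mem_singleton_iff] at hg
    rcases hg with rfl | rfl | rfl
    · exact hfix.1
    · rw [map_add, map_add]
      exact hfix.2
    · change (r' d) ^ l = r' d
      have h5 : (s : k) ^ 2 - D = 0 := by
        have := (CharP.intCast_eq_zero_iff k l _).2 hs
        exact_mod_cast this
      have h6 : (r' d) ^ 2 = D := by rw [← map_pow, hd2, map_intCast]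
      have h7 : (r' d - s) * (r' d + s) = 0 := by linear_combination h6 - h5
      rcases mul_eq_zero.1 h7 with h8 | h8
      · rw [sub_eq_zero.1 h8]
        exact map_intCast (frobenius k l) s
      · rw [eq_neg_of_add_eq_zero_left h8]
        simpa [frobenius_def] using map_intCast (frobenius k l) (-s)

end InertPrimesCore

section InertPrimesFinal

open Polynomial

theorem sq_ne_ite_prime {p : ℕ} (hp : p.Prime) (hp5 : 5 ≤ p) (x : ℤ) :
    x ^ 2 ≠ ((if p % 4 = 1 then p else 3 * p : ℕ) : ℤ) := by
  intro h
  have h1 : x.natAbs ^ 2 = if p % 4 = 1 then p else 3 * p := by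
    have h0 := congrArg Int.natAbs h
    rwa [Int.natAbs_pow, Int.natAbs_natCast] at h0
  have h2 : p ∣ x.natAbs ^ 2 := by
    rw [h1]; split_ifs
    · exact dvd_rfl
    · exact dvd_mul_left _ _
  obtain ⟨y, hy⟩ := hp.dvd_of_dvd_pow h2
  rw [hy, mul_pow] at h1
  have h3 : p * y ^ 2 * p = (if p % 4 = 1 then 1 else 3) * p := by
    rw [show p * y ^ 2 * p = p ^ 2 * y ^ 2 by ring, h1]
    split_ifs <;> ring
  have h4 := Nat.eq_of_mul_eq_mul_right hp.pos h3
  have h5 : p ∣ (if p % 4 = 1 then 1 else 3) := ⟨_, h4.symm⟩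
  have h6 : p ≤ 3 := (Nat.le_of_dvd (by split_ifs <;> norm_num) h5).trans
    (by split_ifs <;> norm_num)
  omega

/-- There are arbitrarily large primes `l ≡ 2 (mod 3)` such that no primitive zero of
`x³ + ay³` modulo `l` satisfies `x - cωy = η wᵖ`. -/
theorem exists_inert_prime {a c : ℤ} (ha : ∀ x : ℤ, x ^ 3 ≠ a) {q₀ : ℕ}
    (hq : q₀.Prime) (hq3 : q₀ % 3 = 2) (hqa : ¬ (q₀ : ℤ) ∣ a) (h1 : (q₀ : ℤ) ∣ c ^ 3 + a)
    (h2 : ¬ (q₀ : ℤ) ^ 2 ∣ c ^ 3 + a) {p : ℕ} (hp : p.Prime) (hp2 : Odd p) {η : Eis} (hη : η ≠ 0)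
    (N : ℕ) : ∃ l : ℕ, l.Prime ∧ N < l ∧ l % 3 = 2 ∧ ∀ (x y : ℤ) (w : Eis),
      (l : ℤ) ∣ x ^ 3 + a * y ^ 3 → ¬ (l : ℤ) ∣ y → (⟨x, -c * y⟩ : Eis) ≠ η * w ^ p := by
  have : Fact (Irreducible (cubicPoly a)) := ⟨irreducible_cubicPoly ha⟩
  have : CharZero (CubicAlgClosure a) := charZero_of_injective_algebraMap
    (algebraMap (CubicClosure a) _).injective
  rcases Nat.lt_or_ge p 5 with hp5 | hp5
  · obtain rfl : p = 3 := by
      have := hp.two_le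
      have h4 : p ≠ 4 := by rintro rfl; revert hp; norm_num
      rcases hp2 with ⟨k, hk⟩
      omega
    refine exists_inert_prime_core hq hq3 hqa h1 h2 hη hp hp2 N (q := 3) (b := -1) (by decide)
      (D := 1) (J := Unit) (by decide) (δ := 1) (by simp) (fun _ ↦ AlgEquiv.refl)
      (fun _ _ _ ↦ rfl) fun l hl _ hlb ↦ ?_
    have h3 : ((l + 1 : ℕ) : ZMod 3) = 0 := by push_cast; rw [hlb]; rfl
    rw [ZMod.natCast_eq_zero_iff] at h3
    exact ⟨by omega, h3, 1, by simp⟩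
  · set D : ℤ := ((if p % 4 = 1 then p else 3 * p : ℕ) : ℤ) with hD
    have : NeZero (3 * p) := ⟨by have := hp.pos; positivity⟩
    obtain ⟨δ, hδ⟩ := IsAlgClosed.exists_pow_nat_eq (D : CubicAlgClosure a) (n := 2) (by norm_num)
    have : Algebra.IsAlgebraic (CubicField a) (CubicAlgClosure a) :=
      Algebra.IsAlgebraic.trans (CubicField a) (CubicClosure a) (CubicAlgClosure a)
    obtain ⟨τ, hτ⟩ := exists_algEquiv_neg (K := CubicField a) (d := (D : CubicField a))
      (sq_ne_of_cubicField (sq_ne_ite_prime hp hp5)) (δ := δ) (by rw [hδ, map_intCast])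
    have hδ0 : δ ≠ 0 := by
      rintro rfl
      have h0 : (D : CubicAlgClosure a) = 0 := by rw [← hδ]; simp
      exact sq_ne_ite_prime hp hp5 0 (by rw [← hD, Int.cast_eq_zero.1 h0]; rfl)
    have hne : -δ ≠ δ := fun h ↦ hδ0 (neg_eq_self.1 h)
    have hcop : Nat.Coprime 3 p := (Nat.coprime_primes Nat.prime_three hp).2 (by omega)
    obtain ⟨l, hl, hlN, h⟩ := exists_inert_prime_core hq hq3 hqa h1 h2 hη hp hp2 (N + 5)
      (q := 3 * p) (b := -1) isUnit_one.neg (D := D) (J := Bool) (by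
        rw [Nat.totient_mul hcop, Nat.totient_prime hp, Fintype.card_bool,
          Nat.totient_prime Nat.prime_three]
        omega) (δ := δ) hδ (fun i ↦ if i then τ else AlgEquiv.refl) (by
        intro i j hij
        cases i <;> cases j
        · rfl
        · exact absurd (by simpa [hτ] using hij.symm) hne
        · exact absurd (by simpa [hτ] using hij) hne
        · rfl) fun l hl hlN hlb ↦ by
        have h3 : ((l + 1 : ℕ) : ZMod (3 * p)) = 0 := by push_cast; rw [hlb]; ring
        rw [ZMod.natCast_eq_zero_iff] at h3
        have h4 : 3 ∣ l + 1 := (dvd_mul_right _ _).trans h3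
        have h5 : p ∣ l + 1 := (dvd_mul_left _ _).trans h3
        have h6 : p ≠ l := by
          rintro rfl
          have h7 : p ∣ 1 := (Nat.dvd_add_right dvd_rfl).1 h5
          have := hp.one_lt
          have := Nat.le_of_dvd one_pos h7
          omega
        obtain ⟨s, hs⟩ := isSquare_of_legendre hp hp5 hl (by omega) (by omega) h5 h6
        obtain ⟨t, rfl⟩ := ZMod.intCast_surjective s
        refine ⟨by omega, h5, t, ?_⟩
        rw [← ZMod.intCast_eq_intCast_iff_dvd_sub, hD, hs]
        push_cast
        ring
    exact ⟨l, hl, by omega, h⟩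

end InertPrimesFinal

section Inert

theorem ZMod.pow_three_injective {l : ℕ} [Fact l.Prime] (h3 : l % 3 = 2) :
    Function.Injective fun x : ZMod l ↦ x ^ 3 := by
  refine Function.LeftInverse.injective (g := fun x ↦ x ^ (2 * (l / 3) + 1)) fun x ↦ ?_
  change (x ^ 3) ^ (2 * (l / 3) + 1) = x
  rw [← pow_mul]
  by_cases hx : x = 0
  · rw [hx, zero_pow (by omega)]
  · rw [show 3 * (2 * (l / 3) + 1) = (l - 1) * 2 + 1 by omega, pow_succ, pow_mul,
      ZMod.pow_card_sub_one_eq_one hx, one_pow, one_mul]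

theorem dvd_and_dvd_of_dvd_form {l : ℕ} (hl : l.Prime) (h3 : l % 3 = 2) {u v : ℤ}
    (h : (l : ℤ) ∣ u ^ 2 + u * v + v ^ 2) : (l : ℤ) ∣ u ∧ (l : ℤ) ∣ v := by
  have : Fact l.Prime := ⟨hl⟩
  simp only [← ZMod.intCast_zmod_eq_zero_iff_dvd] at h ⊢
  push_cast at h
  have h1 : (u : ZMod l) = v := ZMod.pow_three_injective h3 (by
    change (u : ZMod l) ^ 3 = (v : ZMod l) ^ 3
    linear_combination ((u : ZMod l) - v) * h)
  have h4 : ((3 : ℕ) : ZMod l) ≠ 0 := by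
    rw [Ne, ZMod.natCast_eq_zero_iff]
    intro h5
    have := (Nat.prime_dvd_prime_iff_eq hl Nat.prime_three).1 h5
    omega
  rw [h1] at h
  have h5 : ((3 : ℕ) : ZMod l) * (v : ZMod l) ^ 2 = 0 := by
    push_cast; linear_combination h
  have h6 : (v : ZMod l) = 0 := by
    simpa only [sq, mul_self_eq_zero] using (mul_eq_zero.1 h5).resolve_left h4
  exact ⟨h1.trans h6, h6⟩

end Inert

section Descent

variable {m : ℕ}

/-- The integer whose prime divisors may obstruct `x - cωy` from being a `p`-th power. -/
def badInt (a : ℤ) (cs : Fin m → ℤ) (j₀ : Fin m) : ℤ :=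
  3 * cs j₀ * (cs j₀ ^ 3 + a) * ∏ j ∈ Finset.univ.erase j₀, (cs j₀ ^ 3 - cs j ^ 3)

theorem quadratic_form_pos {c x y : ℤ} (hc : c ≠ 0) (hxy : IsCoprime x y) :
    0 < x ^ 2 + c * x * y + c ^ 2 * y ^ 2 := by
  by_contra! h
  have h1 : c * y = 0 := by
    have : (c * y) ^ 2 = 0 := by nlinarith [sq_nonneg (2 * x + c * y), sq_nonneg (c * y)]
    simpa using this
  have hy : y = 0 := by simpa [hc] using h1
  have hx : x = 0 := by
    rw [hy] at h
    have : x ^ 2 = 0 := by nlinarith [sq_nonneg x]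
    simpa using this
  rw [hx, hy, isCoprime_zero_left] at hxy
  exact not_isUnit_zero hxy

theorem cubic_form_ne_zero {a x y : ℤ} (ha : ∀ t : ℤ, t ^ 3 ≠ a) (hxy : IsCoprime x y) :
    x ^ 3 + a * y ^ 3 ≠ 0 := by
  intro h
  have hy : IsUnit y := by
    have h1 : IsCoprime (x ^ 3) y := hxy.pow_left
    refine h1.isUnit_of_dvd' ⟨-a * y ^ 2, by linear_combination h⟩ dvd_rfl
  rcases Int.isUnit_iff.1 hy with rfl | rfl
  · exact ha (-x) (by linear_combination -h)
  · exact ha x (by linear_combination h)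

theorem no_primitive_solution {a : ℤ} {p n : ℕ} (hp : 0 < p) (hn0 : n ≠ 0) (hpn : p ∣ n)
    (ha : ∀ t : ℤ, t ^ 3 ≠ a) {cs : Fin m → ℤ} (hcs0 : ∀ j, cs j ≠ 0) (j₀ : Fin m) {L : ℤ}
    (hL : ∀ l : ℕ, l.Prime → (l : ℤ) ∣ L → l % 3 = 2 ∧ ∀ j, ¬ (l : ℤ) ∣ cs j) (hL0 : L ≠ 0)
    (hsel : ∀ d : Eis, d ∣ (badInt a cs j₀ : Eis) ^ (p - 1) →
      ∃ l : ℕ, l.Prime ∧ (l : ℤ) ∣ L ∧ ∀ (x y : ℤ) (w : Eis),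
        (l : ℤ) ∣ x ^ 3 + a * y ^ 3 → ¬ (l : ℤ) ∣ y → (⟨x, -cs j₀ * y⟩ : Eis) ≠ d * w ^ p)
    {x y z : ℤ} (hxy : IsCoprime x y)
    (h : (x ^ 3 + a * y ^ 3) * ∏ j, (x ^ 2 + cs j * x * y + cs j ^ 2 * y ^ 2) = L * z ^ n) :
    False := by
  have hlA : ∀ l : ℕ, l.Prime → (l : ℤ) ∣ L → (l : ℤ) ∣ x ^ 3 + a * y ^ 3 ∧ ¬ (l : ℤ) ∣ y := by
    intro l hl hlL
    have hl' : Prime (l : ℤ) := Nat.prime_iff_prime_int.1 hl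
    have hnot : ¬ ((l : ℤ) ∣ x ∧ (l : ℤ) ∣ y) := fun h' ↦
      hl'.not_isUnit (hxy.isUnit_of_dvd' h'.1 h'.2)
    have h1 : (l : ℤ) ∣ x ^ 3 + a * y ^ 3 := by
      have h2 : (l : ℤ) ∣ (x ^ 3 + a * y ^ 3) *
          ∏ j, (x ^ 2 + cs j * x * y + cs j ^ 2 * y ^ 2) := h ▸ hlL.mul_right _
      rcases hl'.dvd_or_dvd h2 with h3 | h3
      · exact h3
      · obtain ⟨j, -, hj⟩ := (hl'.dvd_finsetProd_iff _).1 h3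
        have h4 := dvd_and_dvd_of_dvd_form hl (hL l hl hlL).1 (u := x) (v := cs j * y)
          (by rwa [show x ^ 2 + x * (cs j * y) + (cs j * y) ^ 2 =
            x ^ 2 + cs j * x * y + cs j ^ 2 * y ^ 2 by ring])
        exact absurd ⟨h4.1, (hl'.dvd_or_dvd h4.2).resolve_left ((hL l hl hlL).2 j)⟩ hnot
    refine ⟨h1, fun hy ↦ hnot ⟨?_, hy⟩⟩
    have h5 : (l : ℤ) ∣ x ^ 3 :=
      (Int.dvd_add_left ((dvd_pow hy three_ne_zero).mul_left a)).1 h1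
    exact hl'.dvd_of_dvd_pow h5
  set c := cs j₀ with hc
  set A : ℤ := x ^ 3 + a * y ^ 3 with hA
  have hz0 : z ≠ 0 := by
    rintro rfl
    rw [zero_pow hn0, mul_zero] at h
    refine mul_ne_zero (cubic_form_ne_zero ha hxy) (Finset.prod_ne_zero_iff.2 fun j _ ↦ ?_) h
    exact (quadratic_form_pos (hcs0 j) hxy).ne'
  set ω : Eis := ⟨0, 1⟩ with hω
  have hω2 : ω ^ 2 = -1 - ω := by
    rw [sq]; ext <;> simp [hω, QuadraticAlgebra.re_one, QuadraticAlgebra.im_one]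
  have hω3 : ω ^ 3 = 1 := by linear_combination (ω - 1) * hω2
  set B : Eis := x - c * ω * y with hB
  set B' : Eis := x - c * ω ^ 2 * y with hB'
  have hBeq : B = ⟨x, -c * y⟩ := by
    rw [hB]; ext <;> simp [hω]
  have hB0 : B ≠ 0 := by
    intro h0
    rw [hBeq] at h0
    have hr := congrArg QuadraticAlgebra.re h0
    have hi := congrArg QuadraticAlgebra.im h0
    simp only [QuadraticAlgebra.re_zero, QuadraticAlgebra.im_zero, neg_mul, neg_eq_zero,
      mul_eq_zero] at hr hi
    rcases hi with hi | hi
    · exact hcs0 j₀ hi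
    · rw [hr, hi, isCoprime_zero_left] at hxy
      exact not_isUnit_zero hxy
  set U : Eis := A * B' * ∏ j ∈ Finset.univ.erase j₀, ((x : Eis) ^ 2 + cs j * x * y +
    cs j ^ 2 * y ^ 2) with hU
  have hmain : B * U = L * z ^ n := by
    have h1 := congrArg (Int.cast : ℤ → Eis) h
    rw [← Finset.mul_prod_erase _ _ (Finset.mem_univ j₀)] at h1
    push_cast at h1
    rw [← h1, hU, hA]
    push_cast
    linear_combination (((x : Eis) ^ 3 + a * y ^ 3) * ∏ j ∈ Finset.univ.erase j₀,
      ((x : Eis) ^ 2 + cs j * x * y + cs j ^ 2 * y ^ 2)) * (c ^ 2 * y ^ 2 * hω3 - c * x * y * hω2)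
  have hcop : ∀ π : Eis, Prime π → ¬ (π ∣ x ∧ π ∣ y) := by
    rintro π hπ ⟨h1, h2⟩
    obtain ⟨u, v, huv⟩ := hxy
    refine hπ.not_isUnit (isUnit_of_dvd_one ?_)
    have : (1 : Eis) = u * x + v * y := by
      have := congrArg (Int.cast : ℤ → Eis) huv
      push_cast at this
      exact this.symm
    rw [this]
    exact dvd_add (h1.mul_left _) (h2.mul_left _)
  have hmult : ∀ π : Eis, Prime π → ¬ π ∣ (badInt a cs j₀ : Eis) → p ∣ multiplicity π B := by
    intro π hπ hπN
    by_cases hπB : π ∣ B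
    swap
    · rw [multiplicity_eq_zero.2 hπB]
      exact dvd_zero _
    rw [badInt, ← hc] at hπN
    push_cast at hπN
    have hπy : ¬ π ∣ (y : Eis) := by
      intro hy
      refine hcop π hπ ⟨?_, hy⟩
      have : (x : Eis) = B + c * ω * y := by rw [hB]; ring
      rw [this]
      exact dvd_add hπB (hy.mul_left _)
    have hπ3 : ¬ π ∣ (3 : Eis) := fun h3 ↦ hπN (((h3.mul_right _).mul_right _).mul_right _)
    have hπc : ¬ π ∣ (c : Eis) := fun h3 ↦ hπN (((h3.mul_left _).mul_right _).mul_right _)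
    have hπca : ¬ π ∣ ((c : Eis) ^ 3 + a) := fun h3 ↦ hπN ((h3.mul_left _).mul_right _)
    have hπcj : ∀ j ∈ Finset.univ.erase j₀, ¬ π ∣ ((c : Eis) ^ 3 - cs j ^ 3) := fun j hj h3 ↦
      hπN ((h3.trans (Finset.dvd_prod_of_mem (fun j ↦ ((c : Eis) ^ 3 - cs j ^ 3)) hj)).mul_left _)
    have hx3 : π ∣ (x : Eis) ^ 3 - c ^ 3 * y ^ 3 := by
      refine hπB.trans ⟨x ^ 2 + c * ω * x * y + c ^ 2 * ω ^ 2 * y ^ 2, ?_⟩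
      rw [hB]
      linear_combination (c ^ 3 * y ^ 3 : Eis) * hω3
    have hπA : ¬ π ∣ (A : Eis) := by
      intro h1
      have h2 : π ∣ ((c : Eis) ^ 3 + a) * y ^ 3 := by
        have : ((c : Eis) ^ 3 + a) * y ^ 3 = A - ((x : Eis) ^ 3 - c ^ 3 * y ^ 3) := by
          rw [hA]; push_cast; ring
        rw [this]
        exact dvd_sub h1 hx3
      rcases hπ.dvd_or_dvd h2 with h3 | h3
      · exact hπca h3
      · exact hπy (hπ.dvd_of_dvd_pow h3)
    have hπB' : ¬ π ∣ B' := by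
      intro h1
      have h2 : π ∣ 3 * (c ^ 2 * y ^ 2 : Eis) := by
        have : 3 * (c ^ 2 * y ^ 2 : Eis) = (B - B') * (-(c * y * (ω ^ 2 - ω))) := by
          rw [hB, hB']
          linear_combination (c ^ 2 * y ^ 2 : Eis) * ((ω - 2) * hω3 + hω2)
        rw [this]
        exact (dvd_sub hπB h1).mul_right _
      rcases hπ.dvd_or_dvd h2 with h3 | h3
      · exact hπ3 h3
      · rcases hπ.dvd_or_dvd h3 with h3 | h3
        · exact hπc (hπ.dvd_of_dvd_pow h3)
        · exact hπy (hπ.dvd_of_dvd_pow h3)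
    have hπL : ¬ π ∣ (L : Eis) := by
      intro h1
      obtain ⟨l, hl, hlL, hπl⟩ : ∃ l : ℕ, l.Prime ∧ (l : ℤ) ∣ L ∧ π ∣ ((l : ℤ) : Eis) := by
        have h2 : π ∣ ((L.natAbs : ℤ) : Eis) :=
          h1.trans ((Int.castRingHom Eis).map_dvd (Int.dvd_natAbs.2 dvd_rfl))
        rw [← Nat.prod_primeFactorsList (Int.natAbs_ne_zero.2 hL0)] at h2
        rw [Int.cast_natCast, Nat.cast_list_prod, hπ.dvd_prod_iff] at h2
        obtain ⟨t, ht, hπt⟩ := h2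
        obtain ⟨l, hl, rfl⟩ := List.mem_map.1 ht
        exact ⟨l, Nat.prime_of_mem_primeFactorsList hl,
          Int.natCast_dvd.2 (Nat.dvd_of_mem_primeFactorsList hl), by simpa using hπt⟩
      exact hπA (hπl.trans ((Int.castRingHom Eis).map_dvd (hlA l hl hlL).1))
    have hπU : ¬ π ∣ U := by
      rw [hU]
      intro h1
      rcases hπ.dvd_or_dvd h1 with h1 | h1
      · rcases hπ.dvd_or_dvd h1 with h1 | h1
        · exact hπA h1
        · exact hπB' h1
      · obtain ⟨j, hj, h2⟩ := (hπ.dvd_finsetProd_iff _).1 h1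
        have h3 : π ∣ ((c : Eis) ^ 3 - cs j ^ 3) * y ^ 3 := by
          have : ((c : Eis) ^ 3 - cs j ^ 3) * y ^ 3 =
              (x - cs j * y) * ((x : Eis) ^ 2 + cs j * x * y + cs j ^ 2 * y ^ 2) -
                ((x : Eis) ^ 3 - c ^ 3 * y ^ 3) := by ring
          rw [this]
          exact dvd_sub (h2.mul_left _) hx3
        rcases hπ.dvd_or_dvd h3 with h4 | h4
        · exact hπcj j hj h4
        · exact hπy (hπ.dvd_of_dvd_pow h4)
    have hz0' : (z : Eis) ≠ 0 := by
      intro h0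
      have := congrArg QuadraticAlgebra.re h0
      simp at this
      exact hz0 this
    have hL0' : (L : Eis) ≠ 0 := by
      intro h0
      have := congrArg QuadraticAlgebra.re h0
      simp at this
      exact hL0 this
    have hfin : ∀ t : Eis, t ≠ 0 → FiniteMultiplicity π t := fun t ht ↦
      FiniteMultiplicity.of_prime_left hπ ht
    have h1 := congrArg (multiplicity π) hmain
    rw [multiplicity_mul hπ (hfin _ (hmain ▸ mul_ne_zero hL0' (pow_ne_zero _ hz0'))),
      multiplicity_mul hπ (hfin _ (mul_ne_zero hL0' (pow_ne_zero _ hz0'))),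
      multiplicity_eq_zero.2 hπU, multiplicity_eq_zero.2 hπL,
      FiniteMultiplicity.multiplicity_pow hπ (hfin _ hz0'), add_zero, zero_add] at h1
    rw [h1]
    exact hpn.mul_right _
  obtain ⟨d, w, hdw, hd⟩ := Eis.exists_eq_mul_pow hp hB0 hmult
  obtain ⟨l, hl, hlL, hne⟩ := hsel d hd
  exact hne x y w (hlA l hl hlL).1 (hlA l hl hlL).2 (hBeq ▸ hdw)

end Descent

section RationalPoints

variable {m : ℕ}

theorem exists_int_of_squarefree_mul_pow {L K : ℤ} (hL : Squarefree L) {n : ℕ} (hn : 2 ≤ n) {z : ℚ}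
    (h : (L : ℚ) * z ^ n = K) : ∃ w : ℤ, z = w := by
  have h1 : L * z.num ^ n = K * (z.den : ℤ) ^ n := by
    have h2 : (z.den : ℚ) ≠ 0 := by exact_mod_cast z.den_ne_zero
    have h3 : (L : ℚ) * z.num ^ n = K * (z.den : ℚ) ^ n := by
      rw [← h, mul_assoc, ← mul_pow, Rat.mul_den_eq_num]
    exact_mod_cast h3
  have hcop : IsCoprime ((z.den : ℤ) ^ n) (z.num ^ n) := by
    refine IsCoprime.pow (Int.isCoprime_iff_gcd_eq_one.2 ?_)
    have := z.reduced
    rw [Int.gcd_comm]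
    simpa [Int.gcd, Nat.Coprime] using this
  have h4 : (z.den : ℤ) ^ n ∣ L := hcop.dvd_of_dvd_mul_right ⟨K, by rw [h1, mul_comm]⟩
  have h5 : IsUnit (z.den : ℤ) := hL _ (by
    rw [← sq]
    exact (pow_dvd_pow _ hn).trans h4)
  have h6 : z.den = 1 := by
    have := Int.isUnit_iff.1 h5
    omega
  exact ⟨z.num, (Rat.den_eq_one_iff z).1 h6 |>.symm⟩

theorem exists_primitive_pair {X Y : ℚ} (h : X ≠ 0 ∨ Y ≠ 0) :
    ∃ (g : ℚ) (x y : ℤ), g ≠ 0 ∧ IsCoprime x y ∧ X = g * x ∧ Y = g * y := by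
  set u : ℤ := X.num * Y.den with hu
  set v : ℤ := Y.num * X.den with hv
  have hX : (X.den : ℚ) ≠ 0 := by exact_mod_cast X.den_ne_zero
  have hY : (Y.den : ℚ) ≠ 0 := by exact_mod_cast Y.den_ne_zero
  have huv : Int.gcd u v ≠ 0 := by
    rw [Ne, Int.gcd_eq_zero_iff]
    rintro ⟨h1, h2⟩
    rcases h with h | h
    · rcases mul_eq_zero.1 h1 with h1 | h1
      · exact h (Rat.num_eq_zero.1 h1)
      · exact Y.den_ne_zero (by exact_mod_cast h1)
    · rcases mul_eq_zero.1 h2 with h1 | h1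
      · exact h (Rat.num_eq_zero.1 h1)
      · exact X.den_ne_zero (by exact_mod_cast h1)
  obtain ⟨x, hx⟩ := Int.gcd_dvd_left (a := u) (b := v)
  obtain ⟨y, hy⟩ := Int.gcd_dvd_right (a := u) (b := v)
  have hgQ : (Int.gcd u v : ℚ) ≠ 0 := by exact_mod_cast huv
  refine ⟨Int.gcd u v / (X.den * Y.den), x, y, div_ne_zero hgQ (mul_ne_zero hX hY), ?_, ?_, ?_⟩
  · refine Int.isCoprime_iff_gcd_eq_one.2 ?_
    have h1 : ∀ G : ℕ, u = G * x → v = G * y → Int.gcd u v = G * Int.gcd x y := by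
      intro G h1 h2
      rw [h1, h2, Int.gcd_mul_left, Int.natAbs_natCast]
    exact Nat.eq_of_mul_eq_mul_left (Nat.pos_of_ne_zero huv) (by rw [← h1 _ hx hy, mul_one])
  · have h1 : (X.num * Y.den : ℚ) = Int.gcd u v * x := by exact_mod_cast hx
    rw [div_mul_eq_mul_div, ← h1, eq_div_iff (mul_ne_zero hX hY), ← mul_assoc,
      Rat.mul_den_eq_num]
  · have h1 : (Y.num * X.den : ℚ) = Int.gcd u v * y := by exact_mod_cast hy
    rw [div_mul_eq_mul_div, ← h1, eq_div_iff (mul_ne_zero hX hY), mul_comm (X.den : ℚ),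
      ← mul_assoc, Rat.mul_den_eq_num]

theorem eq_zero_of_eqnHolds {a : ℤ} {p n : ℕ} (hp : 0 < p) (hn : n = 3 + 2 * m) (hpn : p ∣ n)
    (ha : ∀ t : ℤ, t ^ 3 ≠ a) {cs : Fin m → ℤ} (hcs0 : ∀ j, cs j ≠ 0) (j₀ : Fin m) {L : ℤ}
    (hL : ∀ l : ℕ, l.Prime → (l : ℤ) ∣ L → l % 3 = 2 ∧ ∀ j, ¬ (l : ℤ) ∣ cs j)
    (hLsq : Squarefree L)
    (hsel : ∀ d : Eis, d ∣ (badInt a cs j₀ : Eis) ^ (p - 1) →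
      ∃ l : ℕ, l.Prime ∧ (l : ℤ) ∣ L ∧ ∀ (x y : ℤ) (w : Eis),
        (l : ℤ) ∣ x ^ 3 + a * y ^ 3 → ¬ (l : ℤ) ∣ y → (⟨x, -cs j₀ * y⟩ : Eis) ≠ d * w ^ p)
    {X Y Z : ℚ} (h : EqnHolds a L n (fun j ↦ ((1 : ℤ), cs j)) X Y Z) : (X, Y, Z) = (0, 0, 0) := by
  have hL0 : (L : ℚ) ≠ 0 := by exact_mod_cast hLsq.ne_zero
  simp only [EqnHolds, Int.cast_one, one_pow, one_mul] at h
  by_cases hXY : X ≠ 0 ∨ Y ≠ 0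
  · obtain ⟨g, x, y, hg, hxy, rfl, rfl⟩ := exists_primitive_pair hXY
    exfalso
    have h1 : (L : ℚ) * (Z / g) ^ n = (((x ^ 3 + a * y ^ 3) *
        ∏ j, (x ^ 2 + cs j * x * y + cs j ^ 2 * y ^ 2) : ℤ) : ℚ) := by
      rw [div_pow, ← mul_div_assoc, ← h, div_eq_iff (pow_ne_zero _ hg)]
      have h2 : ∀ j, (g * x : ℚ) ^ 2 + cs j * (g * x) * (g * y) + cs j ^ 2 * (g * y) ^ 2 =
          g ^ 2 * (x ^ 2 + cs j * x * y + cs j ^ 2 * y ^ 2) := fun j ↦ by ring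
      simp only [h2, Finset.prod_mul_distrib, Finset.prod_const, Finset.card_univ,
        Fintype.card_fin]
      rw [hn, pow_add, pow_mul]
      push_cast
      ring
    obtain ⟨w, hw⟩ := exists_int_of_squarefree_mul_pow hLsq (by omega) h1
    rw [hw] at h1
    refine no_primitive_solution hp (by omega) hpn ha hcs0 j₀ hL hLsq.ne_zero hsel hxy (z := w) ?_
    exact_mod_cast h1.symm
  · push Not at hXY
    obtain ⟨rfl, rfl⟩ := hXY
    have hZ : Z = 0 := by
      have h3 : (L : ℚ) * Z ^ n = 0 := by rw [← h]; simp
      exact (pow_eq_zero_iff (by omega)).1 ((mul_eq_zero.1 h3).resolve_left hL0)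
    rw [hZ]

end RationalPoints

section LocalSolvability

variable {m : ℕ}

theorem PadicInt.exists_root_of_aeval_int {l : ℕ} [Fact l.Prime] (F : Polynomial ℤ) (u : ℤ)
    (h0 : (l : ℤ) ∣ F.eval u) (h1 : ¬ (l : ℤ) ∣ F.derivative.eval u) :
    ∃ t : ℤ_[l], Polynomial.aeval t F = 0 := by
  have e (G : Polynomial ℤ) : Polynomial.aeval (u : ℤ_[l]) G = ((G.eval u : ℤ) : ℤ_[l]) := by
    simpa using (Polynomial.aeval_algebraMap_apply (A := ℤ) ℤ_[l] u G)
  obtain ⟨t, ht, -⟩ := hensels_lemma (p := l) (R := ℤ) (F := F) (a := (u : ℤ_[l])) (by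
    rw [e, e]
    have h2 : ‖((F.derivative.eval u : ℤ) : ℤ_[l])‖ = 1 :=
      le_antisymm (PadicInt.norm_le_one _) (not_lt.1 fun h ↦
        h1 ((PadicInt.norm_int_lt_one_iff_dvd _).1 h))
    rw [h2, one_pow]
    exact (PadicInt.norm_int_lt_one_iff_dvd _).2 h0)
  exact ⟨t, ht⟩

theorem PadicInt.exists_unity_root {l : ℕ} [Fact l.Prime] (h3 : l % 3 = 1) :
    ∃ t : ℤ_[l], t ^ 2 + t + 1 = 0 := by
  have hl : l.Prime := Fact.out
  have hc : 3 ∣ Fintype.card (ZMod l)ˣ := by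
    rw [ZMod.card_units]; omega
  have : Fact (Nat.Prime 3) := ⟨Nat.prime_three⟩
  obtain ⟨u, hu⟩ := exists_prime_orderOf_dvd_card 3 hc
  have hu3 : ((u : ZMod l)) ^ 3 = 1 := by
    rw [← Units.val_pow_eq_pow_val, ← hu, pow_orderOf_eq_one, Units.val_one]
  have hu1 : (u : ZMod l) ≠ 1 := by
    intro h
    have : u = 1 := Units.ext h
    rw [this, orderOf_one] at hu
    omega
  have hq : (u : ZMod l) ^ 2 + u + 1 = 0 := by
    have : ((u : ZMod l) - 1) * ((u : ZMod l) ^ 2 + u + 1) = 0 := by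
      linear_combination hu3
    exact (mul_eq_zero.1 this).resolve_left (sub_ne_zero.2 hu1)
  obtain ⟨x, hx⟩ := ZMod.intCast_surjective (u : ZMod l)
  rw [← hx] at hq
  have hq' : (l : ℤ) ∣ x ^ 2 + x + 1 := by
    rw [← ZMod.intCast_zmod_eq_zero_iff_dvd]; exact_mod_cast hq
  obtain ⟨t, ht⟩ := PadicInt.exists_root_of_aeval_int (l := l)
    (Polynomial.X ^ 2 + Polynomial.X + 1) x (by simpa using hq') (by
      intro h
      simp only [Polynomial.derivative_add, Polynomial.derivative_X_pow, Polynomial.derivative_X,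
        Polynomial.derivative_one, Polynomial.eval_add, Polynomial.eval_mul] at h
      norm_num at h
      have h4 : (l : ℤ) ∣ 3 := by
        have e : (3 : ℤ) = 4 * (x ^ 2 + x + 1) - (2 * x + 1) * (2 * x + 1) := by ring
        rw [e]
        exact dvd_sub (hq'.mul_left _) (h.mul_left _)
      have h5 : l ∣ 3 := by exact_mod_cast h4
      have := (Nat.prime_dvd_prime_iff_eq hl Nat.prime_three).1 h5
      omega)
  exact ⟨t, by simpa using ht⟩

theorem PadicInt.exists_cube_root {l : ℕ} [Fact l.Prime] (h3 : l % 3 = 2) {a : ℤ}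
    (ha : ¬ (l : ℤ) ∣ a) : ∃ t : ℤ_[l], t ^ 3 = a := by
  have hl : l.Prime := Fact.out
  obtain ⟨y, hy⟩ := (Finite.injective_iff_surjective.1 (ZMod.pow_three_injective h3)) (a : ZMod l)
  obtain ⟨x, rfl⟩ := ZMod.intCast_surjective y
  have hx : (l : ℤ) ∣ x ^ 3 - a := by
    rw [← ZMod.intCast_zmod_eq_zero_iff_dvd]; push_cast; exact sub_eq_zero.2 hy
  obtain ⟨t, ht⟩ := PadicInt.exists_root_of_aeval_int (l := l)
    (Polynomial.X ^ 3 - Polynomial.C a) x (by simpa using hx) (by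
      intro h
      simp only [Polynomial.derivative_sub, Polynomial.derivative_X_pow, Polynomial.derivative_C,
        Polynomial.eval_mul, sub_zero] at h
      norm_num at h
      have hpr := Nat.prime_iff_prime_int.1 hl
      rcases hpr.dvd_or_dvd h with h | h
      · have h5 : l ∣ 3 := by exact_mod_cast h
        have := (Nat.prime_dvd_prime_iff_eq hl Nat.prime_three).1 h5
        omega
      · have h6 := hpr.dvd_of_dvd_pow h
        exact ha (by simpa using dvd_sub (dvd_pow h6 three_ne_zero) hx))
  refine ⟨t, ?_⟩
  simpa [sub_eq_zero] using ht

theorem PadicInt.exists_pow_eq_of_dvd_sub_one {l : ℕ} [Fact l.Prime] {n : ℕ} (hn : n ≠ 0) {u : ℤ}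
    (h : (l * n ^ 2 : ℤ) ∣ u - 1) : ∃ t : ℤ_[l], t ^ n = u := by
  obtain ⟨k, hk⟩ := h
  obtain ⟨t, ht, -⟩ := hensels_lemma (p := l) (R := ℤ)
    (F := (Polynomial.X ^ n - Polynomial.C u)) (a := (1 : ℤ_[l])) (by
      have e1 : Polynomial.aeval (1 : ℤ_[l]) (Polynomial.X ^ n - Polynomial.C u) =
          -((l : ℤ_[l]) * n ^ 2 * k) := by
        have : ((u - 1 : ℤ) : ℤ_[l]) = l * n ^ 2 * k := by rw [hk]; push_cast; ring
        rw [← this]; simp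
      have e2 : Polynomial.aeval (1 : ℤ_[l])
          (Polynomial.derivative (Polynomial.X ^ n - Polynomial.C u)) = n := by
        rw [Polynomial.derivative_sub, Polynomial.derivative_X_pow, Polynomial.derivative_C]
        simp
      rw [e1, e2, norm_neg, norm_mul, norm_mul, norm_pow]
      have hn0 : 0 < ‖(n : ℤ_[l])‖ ^ 2 := by
        have : (n : ℤ_[l]) ≠ 0 := by exact_mod_cast hn
        positivity
      have hl1 : ‖(l : ℤ_[l])‖ < 1 := by
        have := (PadicInt.norm_int_lt_one_iff_dvd (p := l) (l : ℤ)).2 dvd_rfl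
        exact_mod_cast this
      calc _ ≤ ‖(l : ℤ_[l])‖ * ‖(n : ℤ_[l])‖ ^ 2 * 1 := by
            gcongr; exact PadicInt.norm_le_one _
        _ < _ := by nlinarith)
  exact ⟨t, by simpa [sub_eq_zero] using ht⟩

theorem exists_padic_eqnHolds {a L : ℤ} {n : ℕ} (hn : Odd n) {cs : Fin m → ℤ} (j₀ : Fin m)
    (hL : (6 * a * n ^ 2 : ℤ) ∣ L - 1 ∨ (6 * a * n ^ 2 : ℤ) ∣ L + 1) (l : ℕ) [Fact l.Prime] :
    ∃ X Y Z : ℚ_[l], (X, Y, Z) ≠ (0, 0, 0) ∧ EqnHolds a L n (fun j ↦ ((1 : ℤ), cs j)) X Y Z := by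
  have hn0 : n ≠ 0 := by rintro rfl; simp at hn
  have hl : l.Prime := Fact.out
  have hroot (s : ℤ) (hs : s = 1 ∨ s = -1) (h6 : (l : ℤ) ∣ 6 * a)
      (h : (6 * a * n ^ 2 : ℤ) ∣ s * L - 1) :
      ∃ X Y Z : ℚ_[l], (X, Y, Z) ≠ (0, 0, 0) ∧
        EqnHolds a L n (fun j ↦ ((1 : ℤ), cs j)) X Y Z := by
    obtain ⟨t, ht⟩ := PadicInt.exists_pow_eq_of_dvd_sub_one (l := l) hn0 (u := s * L)
      ((mul_dvd_mul_right h6 _).trans h)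
    have ht' : ((t : ℚ_[l])) ^ n = s * L := by
      have := congrArg ((↑) : ℤ_[l] → ℚ_[l]) ht
      push_cast at this
      exact this
    have hL0 : ((s * L : ℤ) : ℚ_[l]) ≠ 0 := by
      intro h0
      have h0' : s * L = 0 := by exact_mod_cast h0
      rw [h0'] at h
      have h1 : (l : ℤ) ∣ 1 := by
        have := ((dvd_mul_right (6 * a) (n ^ 2 : ℤ)).trans h)
        simpa using h6.trans this
      exact hl.one_lt.ne' (by exact_mod_cast Int.eq_one_of_dvd_one (by positivity) h1)
    push_cast at hL0
    refine ⟨1, 0, s * (t : ℚ_[l])⁻¹, by simp, ?_⟩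
    have hsn : (s : ℚ_[l]) ^ n = s := by
      rcases hs with rfl | rfl
      · simp
      · push_cast; exact hn.neg_one_pow
    have : (L : ℚ_[l]) * (s * (t : ℚ_[l])⁻¹) ^ n = 1 := by
      rw [mul_pow, inv_pow, ht', hsn]
      rw [← mul_assoc, mul_comm (L : ℚ_[l])]
      exact mul_inv_cancel₀ hL0
    simp [EqnHolds, this]
  by_cases h6 : (l : ℤ) ∣ 6 * a
  · rcases hL with h | h
    · exact hroot 1 (Or.inl rfl) h6 (by simpa using h)
    · exact hroot (-1) (Or.inr rfl) h6 (by
        rw [show -1 * L - 1 = -(L + 1) by ring]; exact (dvd_neg).2 h)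
  have hl3 : l % 3 ≠ 0 := by
    intro h
    have : 3 ∣ l := Nat.dvd_of_mod_eq_zero h
    have := (Nat.prime_dvd_prime_iff_eq Nat.prime_three hl).1 this
    subst this
    exact h6 (Dvd.dvd.mul_right (by norm_num) _)
  have hla : ¬ (l : ℤ) ∣ -a := fun h ↦ h6 (((dvd_neg).1 h).mul_left 6)
  have h12 : l % 3 = 1 ∨ l % 3 = 2 := by omega
  rcases h12 with h3 | h3
  · obtain ⟨t, ht⟩ := PadicInt.exists_unity_root h3
    have ht' : (t : ℚ_[l]) ^ 2 + t + 1 = 0 := by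
      have := congrArg ((↑) : ℤ_[l] → ℚ_[l]) ht
      push_cast at this
      exact this
    refine ⟨t * cs j₀, 1, 0, by simp, ?_⟩
    rw [EqnHolds, Finset.prod_eq_zero (Finset.mem_univ j₀), zero_pow hn0]
    · simp
    · push_cast
      linear_combination (cs j₀ : ℚ_[l]) ^ 2 * ht'
  · obtain ⟨t, ht⟩ := PadicInt.exists_cube_root h3 hla
    have ht' : (t : ℚ_[l]) ^ 3 = -a := by
      have := congrArg ((↑) : ℤ_[l] → ℚ_[l]) ht
      push_cast at this
      exact this
    refine ⟨t, 1, 0, by simp, ?_⟩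
    rw [EqnHolds, ht', zero_pow hn0]
    simp

theorem exists_real_eqnHolds (a L : ℤ) {n : ℕ} (hn : n ≠ 0) (bc : Fin m → ℤ × ℤ) :
    ∃ X Y Z : ℝ, (X, Y, Z) ≠ (0, 0, 0) ∧ EqnHolds a L n bc X Y Z := by
  have hcube (y : ℝ) (hy : 0 ≤ y) : (y ^ ((3 : ℕ) : ℝ)⁻¹) ^ 3 = y :=
    Real.rpow_inv_natCast_pow hy three_ne_zero
  obtain ⟨x, hx'⟩ : ∃ x : ℝ, x ^ 3 = -a := by
    rcases le_total (a : ℝ) 0 with h | h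
    · exact ⟨_, hcube _ (neg_nonneg.2 h)⟩
    · exact ⟨-((a : ℝ) ^ ((3 : ℕ) : ℝ)⁻¹), by rw [Odd.neg_pow (by decide), hcube _ h]⟩
  refine ⟨x, 1, 0, by simp, ?_⟩
  rw [EqnHolds, hx', zero_pow hn]
  simp

end LocalSolvability

section Existence

variable {m : ℕ}

theorem exists_finset_inert_primes {a c : ℤ} (ha : ∀ x : ℤ, x ^ 3 ≠ a) {q₀ : ℕ} (hq : q₀.Prime)
    (hq3 : q₀ % 3 = 2) (hqa : ¬ (q₀ : ℤ) ∣ a) (h1 : (q₀ : ℤ) ∣ c ^ 3 + a)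
    (h2 : ¬ (q₀ : ℤ) ^ 2 ∣ c ^ 3 + a) {p : ℕ} (hp : p.Prime) (hp2 : Odd p) {B : Eis} (hB : B ≠ 0)
    (N : ℕ) : ∃ S : Finset ℕ, (∀ l ∈ S, l.Prime ∧ N < l ∧ l % 3 = 2) ∧
      ∀ d : Eis, d ∣ B → ∃ l ∈ S, ∀ (x y : ℤ) (w : Eis),
        (l : ℤ) ∣ x ^ 3 + a * y ^ 3 → ¬ (l : ℤ) ∣ y → (⟨x, -c * y⟩ : Eis) ≠ d * w ^ p := by
  classical
  have hex (d : Eis) : ∃ l : ℕ, d ≠ 0 → l.Prime ∧ N < l ∧ l % 3 = 2 ∧ ∀ (x y : ℤ) (w : Eis),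
        (l : ℤ) ∣ x ^ 3 + a * y ^ 3 → ¬ (l : ℤ) ∣ y → (⟨x, -c * y⟩ : Eis) ≠ d * w ^ p := by
    by_cases hd : d = 0
    · exact ⟨0, fun h ↦ absurd hd h⟩
    · obtain ⟨l, hl⟩ := exists_inert_prime ha hq hq3 hqa h1 h2 hp hp2 hd N
      exact ⟨l, fun _ ↦ hl⟩
  choose f hf using hex
  have hne {d : Eis} (hd : d ∣ B) : d ≠ 0 := fun h ↦ hB (zero_dvd_iff.1 (h ▸ hd))
  have hfin : {d : Eis | d ∣ B}.Finite := by
    refine (Eis.finite_nrm_le (Eis.nrm B)).subset ?_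
    rintro d ⟨e, rfl⟩
    have he : e ≠ 0 := right_ne_zero_of_mul hB
    change Eis.nrm d ≤ Eis.nrm (d * e)
    rw [Eis.nrm_mul]
    exact Nat.le_mul_of_pos_right _ (Nat.pos_of_ne_zero (by rwa [Ne, Eis.nrm_eq_zero]))
  refine ⟨hfin.toFinset.image f, fun l hl ↦ ?_, fun d hd ↦ ?_⟩
  · obtain ⟨d, hd, rfl⟩ := Finset.mem_image.1 hl
    have := hf d (hne (hfin.mem_toFinset.1 hd))
    exact ⟨this.1, this.2.1, this.2.2.1⟩
  · exact ⟨f d, Finset.mem_image_of_mem f (hfin.mem_toFinset.2 hd), (hf d (hne hd)).2.2.2⟩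

theorem infinite_setOf_prime_mul_modEq {M R : ℕ} (hM : M ≠ 0) (h3 : 3 ∣ M) (hR : R.Coprime M)
    (N : ℕ) :
    {l : ℕ | l.Prime ∧ N < l ∧ l % 3 = 2 ∧
      ((M : ℤ) ∣ (l * R : ℤ) - 1 ∨ (M : ℤ) ∣ (l * R : ℤ) + 1)}.Infinite := by
  have : NeZero M := ⟨hM⟩
  have hRu : IsUnit (R : ZMod M) := (ZMod.isUnit_iff_coprime R M).2 hR
  have hR3 : R % 3 = 1 ∨ R % 3 = 2 := by
    have : ¬ 3 ∣ R := fun h ↦ by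
      have := Nat.dvd_gcd h h3
      rw [hR] at this
      omega
    omega
  obtain ⟨u, hu⟩ := hRu
  obtain ⟨s, hs, hs3⟩ : ∃ s : ℤ, (s = 1 ∨ s = -1) ∧ (R : ℤ) % 3 = (-s) % 3 := by
    rcases hR3 with h | h
    · exact ⟨-1, Or.inr rfl, by omega⟩
    · exact ⟨1, Or.inl rfl, by omega⟩
  have hsu : IsUnit ((s : ZMod M)) := by
    rcases hs with rfl | rfl <;> simp
  refine Set.infinite_of_forall_exists_gt fun k ↦ ?_
  obtain ⟨l, hlk, hl, hlm⟩ := Nat.forall_exists_prime_gt_and_eq_mod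
    (hsu.mul (u⁻¹).isUnit) (max k N)
  have hd : (M : ℤ) ∣ (l * R : ℤ) - s := by
    rw [← ZMod.intCast_zmod_eq_zero_iff_dvd]
    push_cast
    rw [hlm, ← hu, mul_assoc, Units.inv_mul]
    simp
  refine ⟨l, ⟨hl, (le_max_right _ _).trans_lt hlk, ?_, ?_⟩, (le_max_left _ _).trans_lt hlk⟩
  · have h3d : (3 : ℤ) ∣ (l * R : ℤ) - s := (by exact_mod_cast h3 : (3 : ℤ) ∣ M).trans hd
    have h4 : ((l : ℤ) * R) % 3 = s % 3 := Int.emod_eq_emod_iff_emod_sub_eq_zero.2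
      (Int.emod_eq_zero_of_dvd h3d)
    rw [Int.mul_emod] at h4
    have h5 : (l : ℤ) % 3 = 0 ∨ (l : ℤ) % 3 = 1 ∨ (l : ℤ) % 3 = 2 := by omega
    rcases hs with rfl | rfl <;> rcases h5 with h5 | h5 | h5 <;> rw [hs3, h5] at h4 <;> omega
  · rcases hs with rfl | rfl
    · exact Or.inl hd
    · exact Or.inr (by simpa using hd)

theorem infinite_setOf_violatesLGP {a : ℤ} (ha : ∀ t : ℤ, t ^ 3 ≠ a) {q₀ : ℕ} (hq : q₀.Prime)
    (hq3 : q₀ % 3 = 2) (hqa : ¬ (q₀ : ℤ) ∣ a) {cs : Fin m → ℤ} {j₀ : Fin m}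
    (h1 : (q₀ : ℤ) ∣ cs j₀ ^ 3 + a) (h2 : ¬ (q₀ : ℤ) ^ 2 ∣ cs j₀ ^ 3 + a)
    (hcs0 : ∀ j, cs j ≠ 0) (hbad : badInt a cs j₀ ≠ 0)
    {p n : ℕ} (hp : p.Prime) (hp2 : Odd p) (hn : n = 3 + 2 * m) (hpn : p ∣ n) :
    {L : ℤ | L ≠ 0 ∧ ViolatesLGP a L n fun j ↦ ((1 : ℤ), cs j)}.Infinite := by
  have hn0 : n ≠ 0 := by omega
  have ha0 : a ≠ 0 := fun h ↦ ha 0 (by simp [h])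
  have hB : ((badInt a cs j₀ : ℤ) : Eis) ^ (p - 1) ≠ 0 := by
    refine pow_ne_zero _ fun h ↦ hbad ?_
    have := congrArg QuadraticAlgebra.re h
    simpa using this
  set M : ℕ := 6 * a.natAbs * n ^ 2 with hM
  have hMa : (M : ℤ) ∣ 6 * a * n ^ 2 ∧ (6 * a * n ^ 2) ∣ (M : ℤ) := by
    have : Associated (M : ℤ) (6 * a * n ^ 2) := by
      rw [hM]; push_cast
      refine Associated.mul_right (Associated.mul_left _ ?_) _
      exact Int.associated_iff.2 (abs_choice a)
    exact ⟨this.dvd, this.dvd'⟩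
  have hM0 : M ≠ 0 := by
    have : a.natAbs ≠ 0 := Int.natAbs_ne_zero.2 ha0
    positivity
  set N : ℕ := M + ∑ j, (cs j).natAbs with hN
  obtain ⟨S, hS, hSd⟩ := exists_finset_inert_primes ha hq hq3 hqa h1 h2 hp hp2 hB N
  set R : ℕ := ∏ l ∈ S, l with hR
  have hRpos : 0 < R := Finset.prod_pos fun l hl ↦ (hS l hl).1.pos
  have hcop : R.Coprime M := Nat.Coprime.prod_left fun l hl ↦
    ((hS l hl).1.coprime_iff_not_dvd).2 fun h ↦ by
      have := Nat.le_of_dvd (Nat.pos_of_ne_zero hM0) h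
      have := (hS l hl).2.1
      omega
  have hinf := infinite_setOf_prime_mul_modEq hM0
    (by rw [hM]; exact ((by norm_num : 3 ∣ 6).mul_right _).mul_right _) hcop (N + R)
  refine (hinf.image (f := fun l : ℕ ↦ ((l * R : ℕ) : ℤ)) ?_).mono ?_
  · intro x _ y _ hxy
    have : x * R = y * R := Int.ofNat_inj.1 hxy
    exact Nat.eq_of_mul_eq_mul_right hRpos this
  rintro _ ⟨l, ⟨hl, hlN, hl3, hlM⟩, rfl⟩
  beta_reduce
  have hdivR {q : ℕ} (hq : q.Prime) (h : q ∣ l * R) : q = l ∨ q ∈ S := by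
    rcases hq.dvd_mul.1 h with h | h
    · exact Or.inl ((Nat.prime_dvd_prime_iff_eq hq hl).1 h)
    · obtain ⟨i, hi, hqi⟩ := (hq.prime.dvd_finsetProd_iff _).1 h
      rw [(Nat.prime_dvd_prime_iff_eq hq (hS i hi).1).1 hqi]
      exact Or.inr hi
  have hlR : l.Coprime R := (hl.coprime_iff_not_dvd).2 fun h ↦ by
    have := Nat.le_of_dvd hRpos h
    omega
  refine ⟨by exact_mod_cast (Nat.mul_pos hl.pos hRpos).ne', ?_, ?_, ?_⟩
  · exact exists_real_eqnHolds _ _ hn0 _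
  · intro q _
    refine exists_padic_eqnHolds ⟨m + 1, by omega⟩ j₀ ?_ q
    push_cast
    exact hlM.imp hMa.2.trans hMa.2.trans
  · intro X Y Z h
    refine eq_zero_of_eqnHolds hp.pos hn hpn ha hcs0 j₀ ?_ ?_ ?_ h
    · intro q hq hqL
      have hqL' : q ∣ l * R := by exact_mod_cast hqL
      have hq' : q % 3 = 2 ∧ N < q := by
        rcases hdivR hq hqL' with rfl | h
        · exact ⟨hl3, by omega⟩
        · exact ⟨(hS q h).2.2, (hS q h).2.1⟩
      refine ⟨hq'.1, fun j hj ↦ ?_⟩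
      have h5 : q ∣ (cs j).natAbs := Int.natCast_dvd.1 hj
      have h6 := Nat.le_of_dvd (Int.natAbs_pos.2 (hcs0 j)) h5
      have h7 : (cs j).natAbs ≤ ∑ j, (cs j).natAbs :=
        Finset.single_le_sum (f := fun j ↦ (cs j).natAbs) (fun _ _ ↦ Nat.zero_le _)
          (Finset.mem_univ j)
      omega
    · rw [Int.squarefree_natCast, Nat.squarefree_mul hlR]
      refine ⟨hl.squarefree, ?_⟩
      refine Finset.squarefree_prod_of_pairwise_isCoprime ?_ ?_
      · intro x hx y hy hxy
        exact Nat.coprime_iff_isRelPrime.1 ((Nat.coprime_primes (hS x hx).1 (hS y hy).1).2 hxy)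
      · exact fun i hi ↦ (hS i hi).1.squarefree
    · intro d hd
      obtain ⟨q, hqS, hq⟩ := hSd d hd
      refine ⟨q, (hS q hqS).1, ?_, hq⟩
      exact Int.natCast_dvd_natCast.2 ((Finset.dvd_prod_of_mem (fun l ↦ l) hqS).mul_left l)

end Existence

section Nonsingular

variable {m : ℕ}

/-- The slopes `X / Y` at which `(X³ + θ³Y³) ∏ (X² + c_j XY + c_j² Y²)` vanishes, where `w` is a
primitive cube root of unity. -/
noncomputable def lineSlope (w : ℂ) (θ : ℝ) (cs : Fin m → ℤ) : Fin 3 ⊕ Fin m ⊕ Fin m → ℂ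
  | .inl i => -θ * w ^ (i : ℕ)
  | .inr (.inl j) => cs j * w
  | .inr (.inr j) => cs j * w ^ 2

theorem norm_lineSlope_inl {w : ℂ} (hw : ‖w‖ = 1) {θ : ℝ} (hθ : 0 < θ) (cs : Fin m → ℤ)
    (i : Fin 3) :
    ‖lineSlope w θ cs (.inl i)‖ = θ := by
  simp [lineSlope, hw, abs_of_pos hθ]

theorem norm_lineSlope_inr {w : ℂ} (hw : ‖w‖ = 1) (θ : ℝ) {cs : Fin m → ℤ} (hcs : ∀ j, 0 < cs j)
    (j : Fin m) : ‖lineSlope w θ cs (.inr (.inl j))‖ = cs j ∧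
      ‖lineSlope w θ cs (.inr (.inr j))‖ = cs j := by
  have : (0 : ℝ) < cs j := by exact_mod_cast hcs j
  simp [lineSlope, hw, abs_of_pos this]

theorem lineSlope_injective {w : ℂ} (hw : IsPrimitiveRoot w 3) {θ : ℝ} (hθ : 0 < θ) {cs : Fin m → ℤ}
    (hcs : ∀ j, 0 < cs j) (hinj : Function.Injective cs) (hθc : ∀ j, θ ≠ cs j) :
    Function.Injective (lineSlope w θ cs) := by
  have hw1 : ‖w‖ = 1 := hw.norm'_eq_one (by norm_num)
  have hw0 : w ≠ 0 := hw.ne_zero (by norm_num)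
  have hwne : w ≠ 1 := hw.ne_one (by norm_num)
  have key (j j' : Fin m) (h : (cs j : ℂ) * w = cs j' * w ^ 2) : False := by
    have h1 := congrArg norm h
    simp only [norm_mul, norm_pow, hw1, one_pow, mul_one, Complex.norm_intCast] at h1
    rw [abs_of_pos (by exact_mod_cast hcs j), abs_of_pos (by exact_mod_cast hcs j')] at h1
    have h2 : cs j = cs j' := by exact_mod_cast h1
    have h0 : (cs j' : ℂ) ≠ 0 := by exact_mod_cast (hcs j').ne'
    rw [h2] at h
    have := mul_left_cancel₀ h0 h
    rw [sq] at this
    exact hwne (mul_right_cancel₀ hw0 (by rw [one_mul]; exact this.symm))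
  rintro (i | j | j) (i' | j' | j') h
  · have hθ' : (-θ : ℂ) ≠ 0 := by simpa using hθ.ne'
    have := hw.pow_inj i.2 i'.2 (mul_left_cancel₀ hθ' h)
    rw [Fin.ext this]
  · exact absurd ((norm_lineSlope_inl hw1 hθ cs i).symm.trans
      ((congrArg norm h).trans (norm_lineSlope_inr hw1 θ hcs j').1)) (hθc j')
  · exact absurd ((norm_lineSlope_inl hw1 hθ cs i).symm.trans
      ((congrArg norm h).trans (norm_lineSlope_inr hw1 θ hcs j').2)) (hθc j')
  · exact absurd ((norm_lineSlope_inl hw1 hθ cs i').symm.trans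
      ((congrArg norm h.symm).trans (norm_lineSlope_inr hw1 θ hcs j).1)) (hθc j)
  · have := mul_right_cancel₀ hw0 h
    rw [hinj (Int.cast_injective (α := ℂ) this)]
  · exact (key _ _ h).elim
  · exact absurd ((norm_lineSlope_inl hw1 hθ cs i').symm.trans
      ((congrArg norm h.symm).trans (norm_lineSlope_inr hw1 θ hcs j).2)) (hθc j)
  · exact (key _ _ h.symm).elim
  · have := mul_right_cancel₀ (pow_ne_zero 2 hw0) h
    rw [hinj (Int.cast_injective (α := ℂ) this)]

theorem form_eq_prod_lineSlope {A : Type*} [CommRing A] [Algebra ℂ A] {w : ℂ}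
    (hw : IsPrimitiveRoot w 3)
    {θ : ℝ} {a : ℤ} (hθ : θ ^ 3 = a) (cs : Fin m → ℤ) (x y : A) :
    (x ^ 3 + algebraMap ℂ A a * y ^ 3) *
      ∏ j : Fin m, (x ^ 2 + algebraMap ℂ A (cs j) * x * y + algebraMap ℂ A (cs j) ^ 2 * y ^ 2) =
    ∏ i, (x - algebraMap ℂ A (lineSlope w θ cs i) * y) := by
  have hw2 : w ^ 2 + w + 1 = 0 := by
    have h := hw.geom_sum_eq_zero (by norm_num)
    simp only [Finset.sum_range_succ, Finset.sum_range_zero] at h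
    linear_combination h
  have hw3 : w ^ 3 = 1 := hw.pow_eq_one
  have h2 : algebraMap ℂ A w ^ 2 + algebraMap ℂ A w + 1 = 0 := by
    rw [← map_pow, ← map_add, ← map_one (algebraMap ℂ A), ← map_add, hw2, map_zero]
  have ha : algebraMap ℂ A a = algebraMap ℂ A (θ : ℂ) ^ 3 := by
    rw [← map_pow]; congr 1; exact_mod_cast hθ.symm
  rw [Fintype.prod_sum_type, Fintype.prod_sum_type, ← Finset.prod_mul_distrib, ha]
  congr 1
  · rw [Fin.prod_univ_three]
    simp only [lineSlope, map_mul, map_neg, map_pow]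
    set t := algebraMap ℂ A (θ : ℂ)
    set z := algebraMap ℂ A w
    change _ = (x - -t * z ^ 0 * y) * (x - -t * z ^ 1 * y) * (x - -t * z ^ 2 * y)
    linear_combination (-(x ^ 2 * t * y) - x * t ^ 2 * y ^ 2 * z - t ^ 3 * y ^ 3 * (z - 1)) * h2
  · refine Finset.prod_congr rfl fun j _ ↦ ?_
    simp only [lineSlope, map_mul, map_pow]
    set c := algebraMap ℂ A (cs j : ℂ)
    set z := algebraMap ℂ A w
    linear_combination (c * x * y - c ^ 2 * y ^ 2 * (z - 1)) * h2

theorem curvePoly_eq_prod_lineSlope {w : ℂ} (hw : IsPrimitiveRoot w 3)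
    {θ : ℝ} {a : ℤ} (hθ : θ ^ 3 = a) (cs : Fin m → ℤ) (L : ℤ) (n : ℕ) :
    curvePoly a L n (fun j ↦ ((1 : ℤ), cs j)) =
      ∏ i, (X 0 - C (lineSlope w θ cs i) * X 1) - C (L : ℂ) * X 2 ^ n := by
  rw [curvePoly]
  have := form_eq_prod_lineSlope (A := MvPolynomial (Fin 3) ℂ) hw hθ cs (X 0) (X 1)
  simp only [algebraMap_eq] at this
  rw [← this]
  simp

theorem affinePoly_eq_prod_lineSlope {w : ℂ} (hw : IsPrimitiveRoot w 3)
    {θ : ℝ} {a : ℤ} (hθ : θ ^ 3 = a) (cs : Fin m → ℤ) (L : ℤ) :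
    affinePoly a L (fun j ↦ ((1 : ℤ), cs j)) =
      ∏ i, (X 0 - C (lineSlope w θ cs i) * X 1) - C (L : ℂ) := by
  rw [affinePoly]
  have := form_eq_prod_lineSlope (A := MvPolynomial (Fin 2) ℂ) hw hθ cs (X 0) (X 1)
  simp only [algebraMap_eq] at this
  rw [← this]
  simp

theorem totalDegree_prod_sub_sub {ι : Type*} [Fintype ι] (α : ι → ℂ) (L : ℂ) {n : ℕ} (hn0 : n ≠ 0)
    (hn : Fintype.card ι = n) :
    (∏ i, (X 0 - C (α i) * X 1) - C L * X 2 ^ n : MvPolynomial (Fin 3) ℂ).totalDegree = n := by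
  refine IsHomogeneous.totalDegree (IsHomogeneous.sub ?_ ?_) ?_
  · have := IsHomogeneous.prod Finset.univ
      (fun i ↦ (X 0 - C (α i) * X 1 : MvPolynomial (Fin 3) ℂ)) (fun _ ↦ 1)
      (fun i _ ↦ (isHomogeneous_X _ _).sub (isHomogeneous_C_mul_X _ _))
    simpa [hn] using this
  · exact isHomogeneous_C_mul_X_pow _ _ _
  · intro h
    have := congrArg (eval ![(1 : ℂ), 0, 0]) h
    simp [hn0] at this

theorem isNonsingular_prod_sub_sub {ι : Type*} [Fintype ι] {α : ι → ℂ} (hα : Function.Injective α)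
    {L : ℂ} (hL : L ≠ 0) {n : ℕ} (hn : 2 ≤ n) :
    IsNonsingular (∏ i, (X 0 - C (α i) * X 1) - C L * X 2 ^ n) := by
  classical
  rintro v hv ⟨h0, hd⟩
  have hv2 : v 2 = 0 := by
    have h := hd 2
    have hprod : pderiv 2 (∏ i, (X 0 - C (α i) * X 1) : MvPolynomial (Fin 3) ℂ) = 0 := by
      refine Finset.prod_induction _ (fun q : MvPolynomial (Fin 3) ℂ ↦ pderiv 2 q = 0)
        (fun p q hp hq ↦ ?_) (by simp) (fun i _ ↦ ?_)
      · rw [pderiv_mul, hp, hq]; simp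
      · simp [pderiv_X]
    rw [map_sub, hprod] at h
    simp only [zero_sub, map_neg, neg_eq_zero, pderiv_mul, pderiv_C, pderiv_pow, pderiv_X_self] at h
    simp only [zero_mul, zero_add, mul_one, map_mul, eval_C, map_natCast, map_pow, eval_X,
      mul_eq_zero, hL, false_or, Nat.cast_eq_zero] at h
    rcases h with h | h
    · omega
    · exact pow_eq_zero_iff (by omega) |>.1 h
  have h1 : ∏ i, (v 0 - α i * v 1) = 0 := by
    simpa [hv2, eval_prod, show n ≠ 0 by omega] using h0
  obtain ⟨i, -, hi⟩ := Finset.prod_eq_zero_iff.1 h1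
  have hv1 : v 1 ≠ 0 := by
    intro h
    rw [h, mul_zero, sub_zero] at hi
    refine hv (funext fun j ↦ ?_)
    fin_cases j
    · exact hi
    · exact h
    · exact hv2
  have h := hd 0
  rw [map_sub, ← Finset.mul_prod_erase _ _ (Finset.mem_univ i), pderiv_mul, pderiv_mul,
    pderiv_pow, map_sub] at h
  simp only [pderiv_mul, pderiv_C, pderiv_X_self, pderiv_X_of_ne (show (1 : Fin 3) ≠ 0 by decide),
    pderiv_X_of_ne (show (2 : Fin 3) ≠ 0 by decide), mul_zero, zero_mul, add_zero, sub_zero,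
    one_mul, map_add, map_mul, map_sub, eval_X, eval_C, hi, eval_prod, map_zero, sub_zero] at h
  obtain ⟨j, hj, hji⟩ := Finset.prod_eq_zero_iff.1 h
  have hij : α j = α i := by
    refine mul_right_cancel₀ hv1 ?_
    linear_combination hi - hji
  exact (Finset.mem_erase.1 hj).1 (hα hij)

end Nonsingular

section Family

/-- The coefficients `c_j`: the first one is the free parameter, the others are fixed. -/
def paramFamily (m : ℕ) (c : ℤ) (j : Fin m) : ℤ := if (j : ℕ) = 0 then c else (j : ℕ)

theorem paramFamily_pos {m : ℕ} {c : ℤ} (hc : 0 < c) (j : Fin m) : 0 < paramFamily m c j := by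
  rw [paramFamily]
  split_ifs <;> omega

theorem paramFamily_injective {m : ℕ} {c : ℤ} (hc : m < c) :
    Function.Injective (paramFamily m c) := by
  intro i j h
  have := i.2
  have := j.2
  simp only [paramFamily] at h
  split_ifs at h <;> ext <;> omega

theorem pow_ne_cube {p P ι : ℕ} (hp : p.Prime) (hpodd : Odd p) (hP : P = 2 * p ∨ P = p)
    (hι : ι = 1 ∨ ι = 2) (t : ℤ) : t ^ 3 ≠ (P : ℤ) ^ ι := by
  intro h
  have hpr := Nat.prime_iff_prime_int.1 hp
  obtain ⟨s, hs, hPs⟩ : ∃ s : ℤ, (s = 1 ∨ s = 2) ∧ (P : ℤ) = s * p := by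
    rcases hP with rfl | rfl
    · exact ⟨2, Or.inr rfl, by push_cast; rfl⟩
    · exact ⟨1, Or.inl rfl, by simp⟩
  have hι0 : ι ≠ 0 := by omega
  have hpt : (p : ℤ) ∣ t := hpr.dvd_of_dvd_pow (n := 3) (by
    rw [h, hPs]; exact dvd_pow (dvd_mul_left _ _) hι0)
  have h3 : (p : ℤ) ^ 3 ∣ s ^ ι * p ^ ι := by
    rw [← mul_pow, ← hPs, ← h]; exact pow_dvd_pow_of_dvd hpt 3
  have h4 : (p : ℤ) ∣ s ^ ι := by
    have h5 : (p : ℤ) * p ^ ι ∣ s ^ ι * p ^ ι :=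
      dvd_trans (by rw [← pow_succ']; exact pow_dvd_pow _ (by omega)) h3
    exact (mul_dvd_mul_iff_right (pow_ne_zero _ hpr.ne_zero)).1 h5
  have h6 : (p : ℤ) ∣ 2 := by
    have := hpr.dvd_of_dvd_pow h4
    rcases hs with rfl | rfl
    · exact this.mul_right 2
    · exact this
  have h7 : p ∣ 2 := by exact_mod_cast h6
  have := (Nat.prime_dvd_prime_iff_eq hp Nat.prime_two).1 h7
  subst this
  exact absurd hpodd (by decide)

theorem exists_auxiliary_prime {p P ι : ℕ} (hp : p.Prime) (hpodd : Odd p)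
    (hP : P = 2 * p ∨ P = p) (hP9 : P % 9 ≠ 1) :
    ∃ (q : ℕ) (r : ℤ), q.Prime ∧ q % 3 = 2 ∧ ¬ (q : ℤ) ∣ (P : ℤ) ^ ι ∧
      ∀ c : ℤ, ((q ^ 2 : ℕ) : ℤ) ∣ c - r →
        (q : ℤ) ∣ c ^ 3 + (P : ℤ) ^ ι ∧ ¬ (q : ℤ) ^ 2 ∣ c ^ 3 + (P : ℤ) ^ ι := by
  suffices h : ∃ (q : ℕ) (r : ℤ), q.Prime ∧ q % 3 = 2 ∧ ¬ (q : ℤ) ∣ (P : ℤ) ^ ι ∧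
      ((r : ℤ) : ZMod (q ^ 2)) ^ 3 + ((P : ℤ) ^ ι : ℤ) = (q : ℕ) by
    obtain ⟨q, r, hq, hq3, hqP, hr⟩ := h
    refine ⟨q, r, hq, hq3, hqP, fun c hc ↦ ?_⟩
    have hcr : (c : ZMod (q ^ 2)) = r :=
      ((ZMod.intCast_eq_intCast_iff_dvd_sub _ _ _).2 hc).symm
    have hd : ((q ^ 2 : ℕ) : ℤ) ∣ c ^ 3 + (P : ℤ) ^ ι - q := by
      rw [← ZMod.intCast_zmod_eq_zero_iff_dvd]
      push_cast at hr ⊢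
      rw [hcr, hr, sub_self]
    push_cast at hd
    have hqd : (q : ℤ) ∣ c ^ 3 + (P : ℤ) ^ ι :=
      (dvd_sub_self_right).1 ((dvd_pow_self _ two_ne_zero).trans hd)
    refine ⟨hqd, fun h ↦ ?_⟩
    have h2 : (q : ℤ) ^ 2 ∣ q := by
      have := dvd_sub h hd
      rwa [sub_sub_cancel] at this
    have h3 : q ^ 2 ∣ q := by exact_mod_cast h2
    have := Nat.le_of_dvd hq.pos h3
    nlinarith [hq.one_lt]
  rcases hP with rfl | rfl
  · have h5 : ¬ 5 ∣ 2 * p := by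
      intro h
      have h6 : 5 ∣ p := (Nat.Coprime.dvd_mul_left (by norm_num)).1 h
      have := (Nat.prime_dvd_prime_iff_eq Nat.prime_five hp).1 h6
      subst this
      exact hP9 rfl
    have h5a : ¬ (5 : ℕ) ∣ (2 * p) ^ ι := fun h ↦ h5 (Nat.prime_five.dvd_of_dvd_pow h)
    have key : ∀ a : ZMod 25, 5 * a ≠ 0 → ∃ c : ZMod 25, c ^ 3 + a = 5 := by decide
    obtain ⟨c, hc⟩ := key (((2 * p) ^ ι : ℕ) : ZMod 25) (by
      intro h
      have h6 : ((5 * (2 * p) ^ ι : ℕ) : ZMod 25) = 0 := by push_cast at h ⊢; exact h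
      rw [ZMod.natCast_eq_zero_iff] at h6
      exact h5a ((Nat.mul_dvd_mul_iff_left (by norm_num : 0 < 5)).1 h6))
    obtain ⟨r, rfl⟩ := ZMod.intCast_surjective c
    refine ⟨5, r, Nat.prime_five, by norm_num, by exact_mod_cast h5a, ?_⟩
    push_cast at hc ⊢
    exact hc
  · have h2 : ¬ (2 : ℕ) ∣ P ^ ι := fun h ↦ by
      have := Nat.prime_two.dvd_of_dvd_pow h
      have := Nat.odd_iff.1 hpodd
      omega
    have key : ∀ a : ZMod 4, 2 * a ≠ 0 → ∃ c : ZMod 4, c ^ 3 + a = 2 := by decide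
    obtain ⟨c, hc⟩ := key ((P ^ ι : ℕ) : ZMod 4) (by
      intro h
      have h6 : ((2 * P ^ ι : ℕ) : ZMod 4) = 0 := by push_cast at h ⊢; exact h
      rw [ZMod.natCast_eq_zero_iff] at h6
      exact h2 ((Nat.mul_dvd_mul_iff_left (by norm_num : 0 < 2)).1 h6))
    obtain ⟨r, rfl⟩ := ZMod.intCast_surjective c
    refine ⟨2, r, Nat.prime_two, by norm_num, by exact_mod_cast h2, ?_⟩
    push_cast at hc ⊢
    exact hc

theorem exists_cube_root_pos {a : ℤ} (ha : 0 < a) : ∃ θ : ℝ, 0 < θ ∧ θ ^ 3 = a :=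
  have ha' : (0 : ℝ) < a := by exact_mod_cast ha
  ⟨(a : ℝ) ^ ((3 : ℕ) : ℝ)⁻¹, by positivity, Real.rpow_inv_natCast_pow ha'.le three_ne_zero⟩

theorem lineSlope_paramFamily_injective {w : ℂ} (hw : IsPrimitiveRoot w 3) {θ : ℝ} (hθ : 0 < θ)
    {a : ℤ} (hθa : θ ^ 3 = a) (ha : ∀ t : ℤ, t ^ 3 ≠ a) {m : ℕ} {c : ℤ} (hc : m < c) :
    Function.Injective (lineSlope w θ (paramFamily m c)) :=
  lineSlope_injective hw hθ (paramFamily_pos (by omega)) (paramFamily_injective hc)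
    fun j h ↦ ha (paramFamily m c j) (by rw [h] at hθa; exact_mod_cast hθa)

theorem infinite_setOf_goodCurve {a : ℤ} (ha0 : 0 < a) (ha : ∀ t : ℤ, t ^ 3 ≠ a) {q₀ : ℕ}
    (hq : q₀.Prime) (hq3 : q₀ % 3 = 2) (hqa : ¬ (q₀ : ℤ) ∣ a) {p n m : ℕ} (hp : p.Prime)
    (hp2 : Odd p) (hm : 0 < m) (hn : n = 3 + 2 * m) (hpn : p ∣ n) {c : ℤ} (hc : m < c)
    (h1 : (q₀ : ℤ) ∣ c ^ 3 + a) (h2 : ¬ (q₀ : ℤ) ^ 2 ∣ c ^ 3 + a) :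
    {L : ℤ | L ≠ 0 ∧ GoodCurve a n (fun j ↦ ((1 : ℤ), paramFamily m c j)) L}.Infinite := by
  have hc0 : 0 < c := by omega
  have hj0 : paramFamily m c ⟨0, hm⟩ = c := if_pos rfl
  have hbad : badInt a (paramFamily m c) ⟨0, hm⟩ ≠ 0 := by
    rw [badInt, hj0]
    refine mul_ne_zero (mul_ne_zero (mul_ne_zero three_ne_zero hc0.ne') (by positivity)) ?_
    refine Finset.prod_ne_zero_iff.2 fun j hj h ↦ (Finset.mem_erase.1 hj).1 ?_
    have h3 : c = paramFamily m c j :=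
      (Odd.strictMono_pow (R := ℤ) (n := 3) (by decide)).injective (sub_eq_zero.1 h)
    exact paramFamily_injective hc (h3.symm.trans hj0.symm)
  obtain ⟨θ, hθ, hθa⟩ := exists_cube_root_pos ha0
  obtain ⟨w, hw⟩ : ∃ w : ℂ, IsPrimitiveRoot w 3 :=
    ⟨_, Complex.isPrimitiveRoot_exp 3 three_ne_zero⟩
  have hcard : Fintype.card (Fin 3 ⊕ Fin m ⊕ Fin m) = n := by
    simp only [Fintype.card_sum, Fintype.card_fin]; omega
  refine (infinite_setOf_violatesLGP ha hq hq3 hqa (j₀ := ⟨0, hm⟩) (by rwa [hj0])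
    (by rwa [hj0]) (fun j ↦ (paramFamily_pos hc0 j).ne') hbad hp hp2 hn hpn).mono ?_
  rintro L ⟨hL0, hL⟩
  refine ⟨hL0, hL, ?_, ?_⟩
  · rw [curvePoly_eq_prod_lineSlope hw hθa]
    exact totalDegree_prod_sub_sub _ _ (by omega) hcard
  · rw [curvePoly_eq_prod_lineSlope hw hθa]
    exact isNonsingular_prod_sub_sub (lineSlope_paramFamily_injective hw hθ hθa ha hc)
      (by exact_mod_cast hL0) (by omega)

end Family

section LaurentOrder

open HahnSeries

/-- `x` has order at least `k`. -/
def OrdGE (k : ℤ) (x : LaurentSeries ℂ) : Prop :=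
  ∃ f : PowerSeries ℂ, x = single k 1 * ofPowerSeries ℤ ℂ f

/-- `x` has order exactly `k`. -/
def HasOrd (k : ℤ) (x : LaurentSeries ℂ) : Prop :=
  ∃ f : PowerSeries ℂ, PowerSeries.constantCoeff f ≠ 0 ∧ x = single k 1 * ofPowerSeries ℤ ℂ f

theorem single_mul_single_one (j k : ℤ) :
    (single j 1 * single k 1 : LaurentSeries ℂ) = single (j + k) 1 := by
  rw [single_mul_single, mul_one]

theorem ofPowerSeries_X_pow_eq (k : ℕ) :
    ofPowerSeries ℤ ℂ (PowerSeries.X ^ k) = single (k : ℤ) 1 := by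
  rw [ofPowerSeries_X_pow]

variable {j k : ℤ} {x y : LaurentSeries ℂ}

theorem OrdGE.mul (hx : OrdGE j x) (hy : OrdGE k y) : OrdGE (j + k) (x * y) := by
  obtain ⟨f, rfl⟩ := hx
  obtain ⟨g, rfl⟩ := hy
  exact ⟨f * g, by rw [map_mul, ← single_mul_single_one]; ring⟩

theorem OrdGE.add (hx : OrdGE k x) (hy : OrdGE k y) : OrdGE k (x + y) := by
  obtain ⟨f, rfl⟩ := hx
  obtain ⟨g, rfl⟩ := hy
  exact ⟨f + g, by rw [map_add, mul_add]⟩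

theorem OrdGE.neg (hx : OrdGE k x) : OrdGE k (-x) := by
  obtain ⟨f, rfl⟩ := hx
  exact ⟨-f, by rw [map_neg]; ring⟩

theorem OrdGE.sub (hx : OrdGE k x) (hy : OrdGE k y) : OrdGE k (x - y) :=
  sub_eq_add_neg x y ▸ hx.add hy.neg

theorem OrdGE.mono (hx : OrdGE k x) (h : j ≤ k) : OrdGE j x := by
  obtain ⟨f, rfl⟩ := hx
  obtain ⟨d, rfl⟩ := Int.le.dest h
  refine ⟨PowerSeries.X ^ d * f, ?_⟩
  rw [map_mul, ofPowerSeries_X_pow_eq, ← mul_assoc, single_mul_single_one]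

theorem ordGE_zero_iff : OrdGE 0 x ↔ ∃ f : PowerSeries ℂ, x = ofPowerSeries ℤ ℂ f := by
  simp [OrdGE]

theorem ordGE_of_zero (k : ℤ) : OrdGE k 0 := ⟨0, by simp⟩

theorem algebraMap_eq_ofPowerSeries (c : ℂ) :
    algebraMap ℂ (LaurentSeries ℂ) c = ofPowerSeries ℤ ℂ (PowerSeries.C c) := by
  simp [HahnSeries.algebraMap_apply']

theorem ordGE_algebraMap (c : ℂ) : OrdGE 0 (algebraMap ℂ (LaurentSeries ℂ) c) :=
  ordGE_zero_iff.2 ⟨_, algebraMap_eq_ofPowerSeries c⟩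

theorem OrdGE.const_mul (hx : OrdGE k x) (c : ℂ) :
    OrdGE k (algebraMap ℂ (LaurentSeries ℂ) c * x) := by
  simpa using (ordGE_algebraMap c).mul hx

theorem OrdGE.pow (hx : OrdGE k x) (d : ℕ) : OrdGE (d * k) (x ^ d) := by
  induction d with
  | zero => simpa using ordGE_algebraMap 1
  | succ d ih =>
    rw [pow_succ]
    exact (ih.mul hx).mono (by push_cast; linarith)

theorem OrdGE.sum {ι : Type*} {s : Finset ι} {F : ι → LaurentSeries ℂ}
    (h : ∀ i ∈ s, OrdGE k (F i)) : OrdGE k (∑ i ∈ s, F i) :=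
  Finset.sum_induction _ _ (fun _ _ ↦ OrdGE.add) (ordGE_of_zero k) h

theorem HasOrd.ordGE (hx : HasOrd k x) : OrdGE k x := by
  obtain ⟨f, -, hf⟩ := hx
  exact ⟨f, hf⟩

theorem HasOrd.mul (hx : HasOrd j x) (hy : HasOrd k y) : HasOrd (j + k) (x * y) := by
  obtain ⟨f, hf, rfl⟩ := hx
  obtain ⟨g, hg, rfl⟩ := hy
  exact ⟨f * g, by rw [map_mul]; exact mul_ne_zero hf hg,
    by rw [map_mul, ← single_mul_single_one]; ring⟩

theorem hasOrd_algebraMap {c : ℂ} (hc : c ≠ 0) : HasOrd 0 (algebraMap ℂ (LaurentSeries ℂ) c) :=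
  ⟨PowerSeries.C c, by simpa, by simp [algebraMap_eq_ofPowerSeries]⟩

theorem hasOrd_one : HasOrd 0 (1 : LaurentSeries ℂ) := by
  simpa using hasOrd_algebraMap one_ne_zero

theorem HasOrd.const_mul (hx : HasOrd k x) {c : ℂ} (hc : c ≠ 0) :
    HasOrd k (algebraMap ℂ (LaurentSeries ℂ) c * x) := by
  simpa using (hasOrd_algebraMap hc).mul hx

theorem HasOrd.pow (hx : HasOrd k x) (d : ℕ) : HasOrd (d * k) (x ^ d) := by
  induction d with
  | zero => simpa using hasOrd_one
  | succ d ih =>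
    rw [pow_succ, show ((d + 1 : ℕ) : ℤ) * k = d * k + k by push_cast; ring]
    exact ih.mul hx

theorem HasOrd.prod {ι : Type*} {s : Finset ι} {F : ι → LaurentSeries ℂ} {o : ι → ℤ}
    (h : ∀ i ∈ s, HasOrd (o i) (F i)) : HasOrd (∑ i ∈ s, o i) (∏ i ∈ s, F i) := by
  classical
  induction s using Finset.induction_on with
  | empty => simpa using hasOrd_one
  | insert i s hi ih =>
    rw [Finset.sum_insert hi, Finset.prod_insert hi]
    exact (h i (Finset.mem_insert_self _ _)).mul
      (ih fun l hl ↦ h l (Finset.mem_insert_of_mem hl))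

theorem hasOrd_single (k : ℤ) : HasOrd k (single k (1 : ℂ)) := ⟨1, by simp, by simp⟩

theorem HasOrd.le (hx : HasOrd k x) (hj : OrdGE j x) : j ≤ k := by
  obtain ⟨f, hf, rfl⟩ := hx
  obtain ⟨g, hg⟩ := hj
  by_contra! h
  obtain ⟨d, rfl⟩ := Int.le.dest h
  apply hf
  have h1 : ofPowerSeries ℤ ℂ f = ofPowerSeries ℤ ℂ (PowerSeries.X ^ (d + 1) * g) := by
    rw [map_mul, ofPowerSeries_X_pow_eq]
    have h2 := congrArg (single (-k) (1 : ℂ) * ·) hg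
    simp only [← mul_assoc, single_mul_single_one] at h2
    rw [neg_add_cancel, show -k + (k + 1 + d) = ((d + 1 : ℕ) : ℤ) by push_cast; ring] at h2
    simpa using h2
  rw [ofPowerSeries_injective h1]
  simp

theorem HasOrd.unique (hx : HasOrd k x) (hj : HasOrd j x) : j = k :=
  le_antisymm (hx.le hj.ordGE) (hj.le hx.ordGE)

theorem HasOrd.ne_zero (hx : HasOrd k x) : x ≠ 0 := by
  rintro rfl
  have := hx.le (ordGE_of_zero (k + 1))
  omega

theorem exists_hasOrd (hx : x ≠ 0) : ∃ k, HasOrd k x :=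
  ⟨x.order, x.powerSeriesPart, by
    rw [← PowerSeries.coeff_zero_eq_constantCoeff_apply, LaurentSeries.powerSeriesPart_coeff]
    simpa using coeff_order_eq_zero.not.2 hx, (LaurentSeries.single_order_mul_powerSeriesPart x).symm⟩

theorem HasOrd.add_ordGE (hx : HasOrd k x) (hy : OrdGE (k + 1) y) : HasOrd k (x + y) := by
  obtain ⟨f, hf, rfl⟩ := hx
  obtain ⟨g, rfl⟩ := hy
  refine ⟨f + PowerSeries.X * g, by simpa, ?_⟩
  rw [map_add, map_mul, ofPowerSeries_X, mul_add, ← mul_assoc, single_mul_single_one]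

theorem HasOrd.inv (hx : HasOrd k x) : HasOrd (-k) x⁻¹ := by
  obtain ⟨l, hl⟩ := exists_hasOrd (inv_ne_zero hx.ne_zero)
  have := hx.mul hl
  rw [mul_inv_cancel₀ hx.ne_zero] at this
  have := hasOrd_one.unique this
  rwa [show -k = l by omega]

theorem OrdGE.exists_leading (hx : OrdGE k x) :
    ∃ c : ℂ, OrdGE (k + 1) (x - algebraMap ℂ (LaurentSeries ℂ) c * single k 1) := by
  obtain ⟨f, rfl⟩ := hx
  refine ⟨PowerSeries.constantCoeff f, (PowerSeries.mk fun n ↦ PowerSeries.coeff (n + 1) f), ?_⟩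
  have h := congrArg (ofPowerSeries ℤ ℂ) (PowerSeries.eq_X_mul_shift_add_const f)
  rw [map_add, map_mul, ofPowerSeries_X] at h
  rw [← single_mul_single_one, algebraMap_eq_ofPowerSeries]
  linear_combination single k 1 * h

theorem OrdGE.exists_const (hx : OrdGE 0 x) :
    ∃ c : ℂ, OrdGE 1 (x - algebraMap ℂ (LaurentSeries ℂ) c) := by
  simpa using hx.exists_leading

theorem OrdGE.succ_or_hasOrd (hx : OrdGE k x) : OrdGE (k + 1) x ∨ HasOrd k x := by
  obtain ⟨c, hc⟩ := hx.exists_leading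
  by_cases h : c = 0
  · left; simpa [h] using hc
  · right
    have := ((hasOrd_single k).const_mul h).add_ordGE hc
    simpa using this

theorem eq_zero_of_ordGE_algebraMap {c : ℂ} (h : OrdGE 1 (algebraMap ℂ (LaurentSeries ℂ) c)) :
    c = 0 := by
  by_contra hc
  have := (hasOrd_algebraMap hc).le h
  omega

theorem PowerSeries.exists_pow_eq {f : PowerSeries ℂ} (hf : PowerSeries.constantCoeff f ≠ 0)
    {n : ℕ} (hn : n ≠ 0) : ∃ g : PowerSeries ℂ, g ^ n = f := by
  obtain ⟨c, hc⟩ := IsAlgClosed.exists_pow_nat_eq (PowerSeries.constantCoeff f)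
    (Nat.pos_of_ne_zero hn)
  have hc0 : c ≠ 0 := by
    rintro rfl
    exact hf (by rw [← hc, zero_pow hn])
  obtain ⟨g, hg, -⟩ := HenselianRing.is_henselian (R := PowerSeries ℂ)
    (I := Ideal.span {PowerSeries.X}) (Polynomial.X ^ n - Polynomial.C f)
    (Polynomial.monic_X_pow_sub_C f hn) (PowerSeries.C c) (by
      rw [Ideal.mem_span_singleton, PowerSeries.X_dvd_iff]
      simp [hc]) (by
      refine IsUnit.map _ ?_
      rw [PowerSeries.isUnit_iff_constantCoeff, isUnit_iff_ne_zero]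
      rw [Polynomial.derivative_sub, Polynomial.derivative_X_pow, Polynomial.derivative_C]
      simp [hc0, hn])
  refine ⟨g, ?_⟩
  simpa [sub_eq_zero] using hg

end LaurentOrder

section LaurentDerivative

open HahnSeries

/-- The derivative of a Laurent series. -/
noncomputable abbrev laurentDeriv : LaurentSeries ℂ →ₗ[ℂ] LaurentSeries ℂ :=
  LaurentSeries.derivative ℂ

theorem laurentDeriv_coeff (x : LaurentSeries ℂ) (i : ℤ) :
    (laurentDeriv x).coeff i = (i + 1) * x.coeff (i + 1) := by
  change (LaurentSeries.hasseDeriv ℂ 1 x).coeff i = _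
  rw [LaurentSeries.hasseDeriv_coeff]
  simp

theorem coeff_algebraMap_mul (c : ℂ) (x : LaurentSeries ℂ) (i : ℤ) :
    (algebraMap ℂ (LaurentSeries ℂ) c * x).coeff i = c * x.coeff i := by
  rw [algebraMap_eq_ofPowerSeries, ofPowerSeries_C, C_mul_eq_smul, HahnSeries.coeff_smul,
    smul_eq_mul]

theorem laurentDeriv_single_mul (k : ℤ) (x : LaurentSeries ℂ) :
    laurentDeriv (single k 1 * x) = algebraMap ℂ (LaurentSeries ℂ) k * (single (k - 1) 1 * x) +
      single k 1 * laurentDeriv x := by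
  ext i
  rw [laurentDeriv_coeff, HahnSeries.coeff_add, coeff_algebraMap_mul]
  obtain ⟨l, rfl⟩ : ∃ l, i = k + l := ⟨i - k, by ring⟩
  have e1 : (single k 1 * x).coeff (k + l + 1) = x.coeff (l + 1) := by
    rw [show k + l + 1 = (l + 1) + k by ring, coeff_single_mul_add, one_mul]
  have e2 : (single (k - 1) 1 * x).coeff (k + l) = x.coeff (l + 1) := by
    rw [show k + l = (l + 1) + (k - 1) by ring, coeff_single_mul_add, one_mul]
  have e3 : (single k 1 * laurentDeriv x).coeff (k + l) = (l + 1) * x.coeff (l + 1) := by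
    rw [add_comm k l, coeff_single_mul_add, one_mul, laurentDeriv_coeff]
  rw [e1, e2, e3]
  push_cast
  ring

theorem laurentDeriv_ofPowerSeries (f : PowerSeries ℂ) :
    laurentDeriv (ofPowerSeries ℤ ℂ f) = ofPowerSeries ℤ ℂ (PowerSeries.derivative ℂ f) := by
  ext i
  rw [laurentDeriv_coeff, PowerSeries.coeff_coe, PowerSeries.coeff_coe]
  rcases lt_trichotomy i (-1) with h | h | h
  · rw [if_pos (by omega), if_pos (by omega), mul_zero]
  · subst h
    simp
  · obtain ⟨d, rfl⟩ : ∃ d : ℕ, i = d := ⟨i.toNat, by omega⟩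
    rw [if_neg (by omega), if_neg (by omega), show ((d : ℤ) + 1).natAbs = d + 1 by omega,
      Int.natAbs_natCast, PowerSeries.coeff_derivative]
    push_cast
    ring

theorem laurentDeriv_mul (x y : LaurentSeries ℂ) :
    laurentDeriv (x * y) = x * laurentDeriv y + y * laurentDeriv x := by
  have key : ∀ x : LaurentSeries ℂ, ∃ k, OrdGE k x := fun x ↦ by
    rcases eq_or_ne x 0 with rfl | h
    · exact ⟨0, ordGE_of_zero 0⟩
    · obtain ⟨k, hk⟩ := exists_hasOrd h
      exact ⟨k, hk.ordGE⟩
  obtain ⟨j, f, rfl⟩ := key x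
  obtain ⟨k, g, rfl⟩ := key y
  have h : (single j 1 * ofPowerSeries ℤ ℂ f) * (single k 1 * ofPowerSeries ℤ ℂ g) =
      single (j + k) 1 * ofPowerSeries ℤ ℂ (f * g) := by
    rw [map_mul, ← single_mul_single_one]; ring
  rw [h, laurentDeriv_single_mul, laurentDeriv_single_mul, laurentDeriv_single_mul,
    laurentDeriv_ofPowerSeries, laurentDeriv_ofPowerSeries, laurentDeriv_ofPowerSeries,
    Derivation.leibniz, map_add, smul_eq_mul, smul_eq_mul, map_mul, map_mul, map_mul]
  have e1 : (single (j + k - 1) 1 : LaurentSeries ℂ) = single j 1 * single (k - 1) 1 := by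
    rw [single_mul_single_one, add_sub_assoc]
  have e2 : (single j 1 * single (k - 1) 1 : LaurentSeries ℂ) = single (j - 1) 1 * single k 1 := by
    rw [single_mul_single_one, single_mul_single_one, sub_add_eq_add_sub, add_sub_assoc]
  rw [e1, ← single_mul_single_one, Int.cast_add, map_add]
  linear_combination (algebraMap ℂ (LaurentSeries ℂ) j) * ofPowerSeries ℤ ℂ f *
    ofPowerSeries ℤ ℂ g * e2

theorem laurentDeriv_algebraMap (c : ℂ) : laurentDeriv (algebraMap ℂ (LaurentSeries ℂ) c) = 0 := by
  rw [algebraMap_eq_ofPowerSeries, laurentDeriv_ofPowerSeries]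
  simp

variable {k : ℤ} {x : LaurentSeries ℂ}

theorem OrdGE.deriv (hx : OrdGE k x) : OrdGE (k - 1) (laurentDeriv x) := by
  obtain ⟨f, rfl⟩ := hx
  rw [laurentDeriv_single_mul, laurentDeriv_ofPowerSeries]
  exact (OrdGE.const_mul ⟨f, rfl⟩ _).add (OrdGE.mono (k := k) ⟨_, rfl⟩ (by omega))

theorem OrdGE.deriv_zero (hx : OrdGE 0 x) : OrdGE 0 (laurentDeriv x) := by
  obtain ⟨f, rfl⟩ := ordGE_zero_iff.1 hx
  rw [laurentDeriv_ofPowerSeries]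
  exact ordGE_zero_iff.2 ⟨_, rfl⟩

theorem HasOrd.deriv (hx : HasOrd k x) (hk : k ≠ 0) : HasOrd (k - 1) (laurentDeriv x) := by
  obtain ⟨f, hf, rfl⟩ := hx
  rw [laurentDeriv_single_mul, laurentDeriv_ofPowerSeries]
  refine (HasOrd.const_mul ⟨f, hf, rfl⟩ (by exact_mod_cast hk)).add_ordGE ?_
  rw [sub_add_cancel]
  exact ⟨_, rfl⟩

theorem laurentDeriv_pow (x : LaurentSeries ℂ) (n : ℕ) :
    laurentDeriv (x ^ (n + 1)) = (n + 1) * x ^ n * laurentDeriv x := by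
  induction n with
  | zero => simp
  | succ n ih =>
    rw [pow_succ, laurentDeriv_mul, ih]
    push_cast
    ring

end LaurentDerivative

section CyclicModel

open HahnSeries

/-- `t` and `y` are generators of the field `E`, the function field over `ℂ` of the curve
`y ^ n * ∏ i, (t - α i) = 1`, where `n` is the number of indices. -/
structure IsModel {ι : Type*} [Fintype ι] (α : ι → ℂ) {E : Type*} [Field E] [Algebra ℂ E]
    (t y : E) : Prop where
  eqn : y ^ Fintype.card ι * ∏ i, (t - algebraMap ℂ E (α i)) = 1
  adjoin : IntermediateField.adjoin ℂ {t, y} = ⊤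
  lift : ∀ τ υ : LaurentSeries ℂ, (∀ c, τ ≠ algebraMap ℂ _ c) →
    υ ^ Fintype.card ι * ∏ i, (τ - algebraMap ℂ _ (α i)) = 1 →
    ∃ ψ : E →ₐ[ℂ] LaurentSeries ℂ, ψ t = τ ∧ ψ y = υ

theorem IsModel.map {ι : Type*} [Fintype ι] {α : ι → ℂ} {E F : Type*} [Field E] [Algebra ℂ E]
    [Field F] [Algebra ℂ F] {t y : E} (h : IsModel α t y) (φ : E ≃ₐ[ℂ] F) :
    IsModel α (φ t) (φ y) where
  eqn := by
    have := congrArg φ h.eqn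
    simpa [map_prod] using this
  adjoin := by
    have := congrArg (IntermediateField.map (φ : E →ₐ[ℂ] F)) h.adjoin
    rw [IntermediateField.adjoin_map] at this
    rw [← Set.image_pair]
    refine this.trans ?_
    rw [← AlgHom.fieldRange_eq_map]
    exact AlgHom.fieldRange_eq_top.2 φ.surjective
  lift τ υ hτ hυ := by
    obtain ⟨ψ, h1, h2⟩ := h.lift τ υ hτ hυ
    exact ⟨ψ.comp φ.symm, by simpa using h1, by simpa using h2⟩

theorem hasOrd_sub_const {k : ℤ} {x : LaurentSeries ℂ} (hx : HasOrd k x) (hk : k < 0) (c : ℂ) :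
    HasOrd k (x - algebraMap ℂ _ c) := by
  rw [sub_eq_add_neg]
  exact hx.add_ordGE ((ordGE_algebraMap c).neg.mono (by omega))

theorem hasOrd_sub_const_of_ne {b c : ℂ} (hbc : b ≠ c) {x : LaurentSeries ℂ}
    (hx : OrdGE 1 (x - algebraMap ℂ _ b)) : HasOrd 0 (x - algebraMap ℂ _ c) := by
  have := (hasOrd_algebraMap (sub_ne_zero.2 hbc)).add_ordGE hx
  rw [map_sub] at this
  convert this using 1
  ring

theorem exists_hasOrd_root {n : ℕ} (hn : n ≠ 0) {e : ℤ} {z : LaurentSeries ℂ}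
    (hz : HasOrd (n * e) z) : ∃ υ, HasOrd (-e) υ ∧ υ ^ n * z = 1 := by
  obtain ⟨f, hf, hz'⟩ := hz.inv
  obtain ⟨g, hg⟩ := PowerSeries.exists_pow_eq hf hn
  have h : (single (-e) 1 * ofPowerSeries ℤ ℂ g) ^ n = z⁻¹ := by
    rw [hz', mul_pow, ← map_pow (ofPowerSeries ℤ ℂ), hg, single_pow, one_pow]
    congr 3
    simp
  refine ⟨_, ⟨g, ?_, rfl⟩, ?_⟩
  · intro h0
    rw [← hg, map_pow, h0, zero_pow hn] at hf
    exact hf rfl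
  · rw [h, inv_mul_cancel₀ hz.ne_zero]

variable {ι : Type*} [Fintype ι] {α : ι → ℂ}

theorem hasOrd_prod_sub_of_ne {b : ℂ} (hb : ∀ i, b ≠ α i) {τ : LaurentSeries ℂ}
    (hτ : OrdGE 1 (τ - algebraMap ℂ _ b)) :
    HasOrd 0 (∏ i, (τ - algebraMap ℂ _ (α i))) := by
  have := HasOrd.prod (s := Finset.univ) (o := fun _ : ι ↦ (0 : ℤ))
    fun i _ ↦ hasOrd_sub_const_of_ne (hb i) hτ
  simpa using this

theorem hasOrd_prod_sub_root (hα : Function.Injective α) (i : ι) {k : ℤ} (hk : 0 < k)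
    {τ : LaurentSeries ℂ} (hτ : HasOrd k (τ - algebraMap ℂ _ (α i))) :
    HasOrd k (∏ i, (τ - algebraMap ℂ _ (α i))) := by
  classical
  have := HasOrd.prod (s := Finset.univ) (o := fun j : ι ↦ if j = i then k else 0)
    (F := fun j ↦ τ - algebraMap ℂ _ (α j)) fun j _ ↦ by
      split_ifs with h
      · exact h ▸ hτ
      · exact hasOrd_sub_const_of_ne (fun h' ↦ h (hα h').symm) (hτ.ordGE.mono (by omega))
  simpa using this

theorem hasOrd_prod_sub_pole {k : ℤ} (hk : k < 0) {τ : LaurentSeries ℂ} (hτ : HasOrd k τ) :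
    HasOrd (Fintype.card ι * k) (∏ i, (τ - algebraMap ℂ _ (α i))) := by
  have := HasOrd.prod (s := Finset.univ) (o := fun _ : ι ↦ k)
    (F := fun j ↦ τ - algebraMap ℂ _ (α j)) fun j _ ↦ hasOrd_sub_const hτ hk _
  simpa using this

/-- The local behaviour of the curve: a parametrised branch is either affine, or lies over one of
the points at infinity. -/
theorem branch_cases (hα : Function.Injective α) [Nonempty ι] {τ υ : LaurentSeries ℂ}
    (hτ : ∀ c, τ ≠ algebraMap ℂ _ c)
    (h : υ ^ Fintype.card ι * ∏ i, (τ - algebraMap ℂ _ (α i)) = 1) :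
    (OrdGE 0 (τ * υ) ∧ OrdGE 0 υ) ∨ ∃ (i : ι) (e : ℤ), 0 < e ∧ HasOrd (-e) υ ∧
      HasOrd (Fintype.card ι * e) (τ - algebraMap ℂ _ (α i)) := by
  have hn : Fintype.card ι ≠ 0 := Fintype.card_ne_zero
  have hυ0 : υ ≠ 0 := by
    rintro rfl
    rw [zero_pow hn, zero_mul] at h
    exact zero_ne_one h
  obtain ⟨o, ho⟩ := exists_hasOrd hυ0
  have key : ∀ k, HasOrd k (∏ i, (τ - algebraMap ℂ _ (α i))) → Fintype.card ι * o + k = 0 := by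
    intro k hk
    have := (ho.pow (Fintype.card ι)).mul hk
    rw [h] at this
    exact this.unique hasOrd_one |>.symm
  have hn' : (0 : ℤ) < Fintype.card ι := by exact_mod_cast Nat.pos_of_ne_zero hn
  obtain ⟨k, hk⟩ := exists_hasOrd (x := τ) (by simpa using hτ 0)
  rcases lt_or_ge k 0 with hk0 | hk0
  · left
    have h1 := key _ (hasOrd_prod_sub_pole hk0 hk)
    have h2 : o = -k := by
      have : (Fintype.card ι : ℤ) * (o + k) = 0 := by linarith
      rcases mul_eq_zero.1 this with h | h <;> omega
    subst h2
    exact ⟨(hk.mul ho).ordGE.mono (by omega), ho.ordGE.mono (by omega)⟩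
  · have h0 := hk.ordGE.mono hk0
    obtain ⟨c, hc⟩ := h0.exists_const
    by_cases hi : ∃ i, c = α i
    · right
      obtain ⟨i, rfl⟩ := hi
      obtain ⟨l, hl⟩ := exists_hasOrd (sub_ne_zero.2 (hτ (α i)))
      have hl1 := hl.le hc
      have h1 := key _ (hasOrd_prod_sub_root hα i (by omega) hl)
      refine ⟨i, -o, ?_, by rwa [neg_neg], ?_⟩
      · nlinarith
      · convert hl using 1
        linarith
    · left
      push Not at hi
      have h1 := key _ (hasOrd_prod_sub_of_ne hi hc)
      have : o = 0 := by
        rcases mul_eq_zero.1 ((add_zero _).symm.trans h1) with h | h <;> omega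
      subst this
      exact ⟨by simpa using h0.mul ho.ordGE, ho.ordGE⟩

namespace IsModel

variable {E : Type*} [Field E] [Algebra ℂ E] {t y : E}

theorem exists_place_regular (h : IsModel α t y) [Nonempty ι] {b : ℂ} (hb : ∀ i, b ≠ α i) :
    ∃ ψ : E →ₐ[ℂ] LaurentSeries ℂ, ψ t - algebraMap ℂ _ b = single 1 1 ∧ HasOrd 0 (ψ y) := by
  have h1 : (algebraMap ℂ (LaurentSeries ℂ) b + single 1 1) - algebraMap ℂ _ b = single 1 1 := by
    ring
  obtain ⟨υ, hυ, hυ'⟩ := exists_hasOrd_root (e := 0) (Fintype.card_ne_zero (α := ι))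
    (z := ∏ i, ((algebraMap ℂ (LaurentSeries ℂ) b + single 1 1) - algebraMap ℂ _ (α i)))
    (by rw [mul_zero]; exact hasOrd_prod_sub_of_ne hb (by rw [h1]; exact (hasOrd_single 1).ordGE))
  refine Exists.imp (fun ψ h23 ↦ ?_) (h.lift _ _ (fun c hc ↦ ?_) hυ')
  · obtain ⟨h2, h3⟩ := h23
    exact ⟨by rw [h2, h1], h3 ▸ hυ⟩
  · have h4 : (single 1 1 : LaurentSeries ℂ) = algebraMap ℂ _ (c - b) := by
      rw [map_sub, ← hc]; ring
    have h5 := hasOrd_single 1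
    have h6 : c - b = 0 := eq_zero_of_ordGE_algebraMap (h4 ▸ h5.ordGE)
    rw [h6, map_zero] at h4
    exact h5.ne_zero h4

theorem exists_place_root (h : IsModel α t y) (hα : Function.Injective α) (i : ι) :
    ∃ ψ : E →ₐ[ℂ] LaurentSeries ℂ,
      ψ t - algebraMap ℂ _ (α i) = single (Fintype.card ι : ℤ) 1 ∧ HasOrd (-1) (ψ y) := by
  have : Nonempty ι := ⟨i⟩
  have hn : 0 < Fintype.card ι := Fintype.card_pos
  have h1 : (algebraMap ℂ (LaurentSeries ℂ) (α i) + single (Fintype.card ι : ℤ) 1) -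
      algebraMap ℂ _ (α i) = single (Fintype.card ι : ℤ) 1 := by
    ring
  obtain ⟨υ, hυ, hυ'⟩ := exists_hasOrd_root (e := 1) (Fintype.card_ne_zero (α := ι))
    (z := ∏ j, ((algebraMap ℂ (LaurentSeries ℂ) (α i) + single (Fintype.card ι : ℤ) 1) -
      algebraMap ℂ _ (α j)))
    (by
      rw [mul_one]
      exact hasOrd_prod_sub_root hα i (by exact_mod_cast hn)
        (by rw [h1]; exact hasOrd_single _))
  refine Exists.imp (fun ψ h23 ↦ ?_) (h.lift _ _ (fun c hc ↦ ?_) hυ')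
  · obtain ⟨h2, h3⟩ := h23
    exact ⟨by rw [h2, h1], h3 ▸ hυ⟩
  · have h4 : (single (Fintype.card ι : ℤ) 1 : LaurentSeries ℂ) = algebraMap ℂ _ (c - α i) := by
      rw [map_sub, ← hc]; ring
    have h5 := hasOrd_single (Fintype.card ι : ℤ)
    have h6 : c - α i = 0 :=
      eq_zero_of_ordGE_algebraMap (h4 ▸ h5.ordGE.mono (by exact_mod_cast hn))
    rw [h6, map_zero] at h4
    exact h5.ne_zero h4

theorem exists_place_pole (h : IsModel α t y) [Nonempty ι] :
    ∃ ψ : E →ₐ[ℂ] LaurentSeries ℂ, ψ t = single (-1) 1 ∧ HasOrd 1 (ψ y) := by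
  obtain ⟨υ, hυ, hυ'⟩ := exists_hasOrd_root (e := -1) (Fintype.card_ne_zero (α := ι))
    (z := ∏ i, ((single (-1) 1 : LaurentSeries ℂ) - algebraMap ℂ _ (α i)))
    (hasOrd_prod_sub_pole (by norm_num) (hasOrd_single (-1)))
  refine Exists.imp (fun ψ h23 ↦ ?_) (h.lift _ _ (fun c hc ↦ ?_) hυ')
  · obtain ⟨h2, h3⟩ := h23
    exact ⟨h2, h3 ▸ by simpa using hυ⟩
  · have := (hasOrd_single (-1)).le (hc ▸ ordGE_algebraMap c)
    omega

theorem ne_algebraMap (h : IsModel α t y) [Nonempty ι] (c : ℂ) : t ≠ algebraMap ℂ E c := by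
  rintro rfl
  obtain ⟨ψ, h1, -⟩ := h.exists_place_pole
  rw [AlgHom.commutes] at h1
  have := (hasOrd_single (-1)).le (h1 ▸ ordGE_algebraMap c)
  omega

theorem map_ne_algebraMap (h : IsModel α t y) [Nonempty ι] (ψ : E →ₐ[ℂ] LaurentSeries ℂ) (c : ℂ) :
    ψ t ≠ algebraMap ℂ _ c := by
  rw [← ψ.commutes]
  exact fun h' ↦ h.ne_algebraMap c (ψ.injective h')

theorem map_eqn (h : IsModel α t y) (ψ : E →ₐ[ℂ] LaurentSeries ℂ) :
    ψ y ^ Fintype.card ι * ∏ i, (ψ t - algebraMap ℂ _ (α i)) = 1 := by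
  have := congrArg ψ h.eqn
  simpa [map_prod] using this

theorem y_ne_zero (h : IsModel α t y) [Nonempty ι] : y ≠ 0 := by
  rintro rfl
  have := h.eqn
  rw [zero_pow Fintype.card_ne_zero, zero_mul] at this
  exact zero_ne_one this

theorem map_cases (h : IsModel α t y) (hα : Function.Injective α) [Nonempty ι]
    (ψ : E →ₐ[ℂ] LaurentSeries ℂ) :
    (OrdGE 0 (ψ t * ψ y) ∧ OrdGE 0 (ψ y)) ∨ ∃ (i : ι) (e : ℤ), 0 < e ∧ HasOrd (-e) (ψ y) ∧
      HasOrd (Fintype.card ι * e) (ψ t - algebraMap ℂ _ (α i)) :=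
  branch_cases hα (h.map_ne_algebraMap ψ) (h.map_eqn ψ)

end IsModel

end CyclicModel

section HolomorphicDifferentials

open HahnSeries (single)

theorem exists_hasOrd_sum {κ : Type*} {s : Finset κ} (hs : s.Nonempty) {o : κ → ℤ}
    (ho : Set.InjOn o s) {F : κ → LaurentSeries ℂ} (h : ∀ i ∈ s, HasOrd (o i) (F i)) :
    ∃ i ∈ s, HasOrd (o i) (∑ i ∈ s, F i) := by
  classical
  induction hs using Finset.Nonempty.cons_induction with
  | singleton a => exact ⟨a, by simp, by simpa using h a⟩
  | cons a s ha hs ih =>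
    obtain ⟨i, hi, hi'⟩ := ih (ho.mono (by simp)) fun i hi ↦ h i (by simp [hi])
    have hne : o i ≠ o a := fun h' ↦ by
      have := ho (by simp [hi]) (by simp) h'
      exact ha (this ▸ hi)
    rw [Finset.sum_cons]
    rcases lt_or_gt_of_ne hne with h' | h'
    · refine ⟨i, by simp [hi], ?_⟩
      rw [add_comm]
      exact hi'.add_ordGE ((h a (by simp)).ordGE.mono (by omega))
    · exact ⟨a, by simp, (h a (by simp)).add_ordGE (hi'.ordGE.mono (by omega))⟩

section PolynomialValues

open Polynomial

theorem ordGE_aeval {τ : LaurentSeries ℂ} (hτ : OrdGE 0 τ) (p : ℂ[X]) : OrdGE 0 (aeval τ p) := by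
  rw [aeval_eq_sum_range]
  refine OrdGE.sum fun i _ ↦ ?_
  rw [Algebra.smul_def]
  simpa using (hτ.pow i).const_mul (p.coeff i)

theorem ordGE_of_sub_const {k : ℤ} (hk : 0 ≤ k) {b : ℂ} {τ : LaurentSeries ℂ}
    (hτ : OrdGE k (τ - algebraMap ℂ _ b)) : OrdGE 0 τ := by
  have := (hτ.mono hk).add (ordGE_algebraMap b)
  rwa [sub_add_cancel] at this

theorem hasOrd_aeval_of_eval_ne {k : ℕ} (hk : 0 < k) {b : ℂ} {τ : LaurentSeries ℂ}
    (hτ : HasOrd k (τ - algebraMap ℂ _ b)) {p : ℂ[X]} (hp : p.eval b ≠ 0) :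
    HasOrd 0 (aeval τ p) := by
  have h1 : p = Polynomial.C (p.eval b) +
      (Polynomial.X - Polynomial.C b) * (p /ₘ (Polynomial.X - Polynomial.C b)) := by
    have := modByMonic_add_div p (Polynomial.X - Polynomial.C b)
    rwa [modByMonic_X_sub_C_eq_C_eval, eq_comm] at this
  rw [h1, map_add, map_mul, Polynomial.aeval_C, map_sub, Polynomial.aeval_X, Polynomial.aeval_C]
  refine (hasOrd_algebraMap hp).add_ordGE ?_
  have h0 := ordGE_of_sub_const (by omega) hτ.ordGE
  simpa using (hτ.ordGE.mono (j := 1) (by omega)).mul (ordGE_aeval h0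
    (p /ₘ (Polynomial.X - Polynomial.C b)))

theorem hasOrd_aeval_rootMultiplicity {k : ℕ} (hk : 0 < k) {b : ℂ} {τ : LaurentSeries ℂ}
    (hτ : HasOrd k (τ - algebraMap ℂ _ b)) {p : ℂ[X]} (hp : p ≠ 0) :
    HasOrd (p.rootMultiplicity b * k) (aeval τ p) := by
  have h1 := hτ.pow (p.rootMultiplicity b)
  have h2 := hasOrd_aeval_of_eval_ne hk hτ (eval_divByMonic_pow_rootMultiplicity_ne_zero b hp)
  have h3 := h1.mul h2
  rw [add_zero] at h3
  convert h3 using 1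
  conv_lhs => rw [← pow_mul_divByMonic_rootMultiplicity_eq p b]
  simp

theorem hasOrd_aeval_pole {τ : LaurentSeries ℂ} (hτ : HasOrd (-1) τ) {p : ℂ[X]} (hp : p ≠ 0) :
    HasOrd (-p.natDegree) (aeval τ p) := by
  rw [aeval_eq_sum_range, Finset.sum_range_succ, add_comm]
  refine HasOrd.add_ordGE ?_ (OrdGE.sum fun i hi ↦ ?_)
  · rw [Algebra.smul_def]
    simpa using (hτ.pow p.natDegree).const_mul (leadingCoeff_ne_zero.2 hp)
  · rw [Algebra.smul_def]
    rw [Finset.mem_range] at hi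
    exact ((hτ.ordGE.pow i).const_mul _).mono (by omega)

end PolynomialValues

variable {ι : Type*} [Fintype ι] {α : ι → ℂ} {E : Type*} [Field E] [Algebra ℂ E]

/-- The pull-back of the differential `y ^ 2 dt` along a branch `ψ`. -/
noncomputable def differential (t y : E) (ψ : E →ₐ[ℂ] LaurentSeries ℂ) : LaurentSeries ℂ :=
  ψ y ^ 2 * laurentDeriv (ψ t)

/-- The differential `h * y ^ 2 dt` is holomorphic on every branch. -/
def IsHol (t y h : E) : Prop :=
  ∀ ψ : E →ₐ[ℂ] LaurentSeries ℂ, OrdGE 0 (ψ h * differential t y ψ)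

theorem differential_eq (t y : E) (ψ : E →ₐ[ℂ] LaurentSeries ℂ) :
    differential t y ψ = ψ y * laurentDeriv (ψ t * ψ y) - (ψ t * ψ y) * laurentDeriv (ψ y) := by
  rw [differential, laurentDeriv_mul]
  ring

theorem laurentDeriv_sub_const (x : LaurentSeries ℂ) (c : ℂ) :
    laurentDeriv (x - algebraMap ℂ _ c) = laurentDeriv x := by
  rw [map_sub, laurentDeriv_algebraMap, sub_zero]

namespace IsModel

variable {t y : E}

theorem ordGE_differential {ψ : E →ₐ[ℂ] LaurentSeries ℂ} (h1 : OrdGE 0 (ψ t * ψ y))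
    (h2 : OrdGE 0 (ψ y)) : OrdGE 0 (differential t y ψ) := by
  rw [differential_eq]
  exact ((h2.mul h1.deriv_zero).sub (h1.mul h2.deriv_zero)).mono (by norm_num)

theorem hasOrd_differential [Nonempty ι] {ψ : E →ₐ[ℂ] LaurentSeries ℂ} {i : ι} {e : ℤ}
    (he : 0 < e)
    (h1 : HasOrd (-e) (ψ y)) (h2 : HasOrd (Fintype.card ι * e) (ψ t - algebraMap ℂ _ (α i))) :
    HasOrd ((Fintype.card ι - 2) * e - 1) (differential t y ψ) := by
  have hn : 0 < Fintype.card ι := Fintype.card_pos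
  have h3 := (h1.pow 2).mul (h2.deriv (by positivity))
  rw [laurentDeriv_sub_const] at h3
  rw [differential]
  convert h3 using 1
  push_cast
  ring

theorem ordGE_x {ψ : E →ₐ[ℂ] LaurentSeries ℂ} [Nonempty ι] {i : ι} {e : ℤ} (he : 0 < e)
    (h1 : HasOrd (-e) (ψ y)) (h2 : HasOrd (Fintype.card ι * e) (ψ t - algebraMap ℂ _ (α i))) :
    OrdGE (-e) (ψ (t * y)) := by
  have hn : 0 < Fintype.card ι := Fintype.card_pos
  rw [map_mul]
  simpa using (ordGE_of_sub_const (by positivity) h2.ordGE).mul h1.ordGE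

theorem isHol_of_growth (h : IsModel α t y) (hα : Function.Injective α) [Nonempty ι] {z : E}
    (H : ∀ ψ : E →ₐ[ℂ] LaurentSeries ℂ, ∀ e : ℤ, 0 ≤ e → OrdGE (-e) (ψ (t * y)) →
      OrdGE (-e) (ψ y) → OrdGE (-((Fintype.card ι - 3) * e)) (ψ z)) : IsHol t y z := by
  intro ψ
  rcases h.map_cases hα ψ with ⟨h1, h2⟩ | ⟨i, e, he, h1, h2⟩
  · have := H ψ 0 le_rfl (by rw [map_mul]; simpa using h1) (by simpa using h2)
    simpa using this.mul (ordGE_differential h1 h2)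
  · have h3 := H ψ e he.le (ordGE_x he h1 h2) h1.ordGE
    refine (h3.mul (hasOrd_differential he h1 h2).ordGE).mono ?_
    ring_nf
    omega

theorem exists_repr (h : IsModel α t y) [Nonempty ι] (z : E) :
    ∃ p q : ℕ → Polynomial ℂ, (∀ j, IsCoprime (p j) (q j)) ∧ (∀ j, q j ≠ 0) ∧
      z = ∑ j ∈ Finset.range (Fintype.card ι),
        Polynomial.aeval t (p j) / Polynomial.aeval t (q j) * y ^ j := by
  classical
  have hn : Fintype.card ι ≠ 0 := Fintype.card_ne_zero
  let F := IntermediateField.adjoin ℂ {t}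
  have htF : t ∈ F := IntermediateField.mem_adjoin_simple_self ℂ t
  have hy0 := h.y_ne_zero
  have hynF : y ^ Fintype.card ι ∈ F := by
    rw [eq_inv_of_mul_eq_one_left h.eqn]
    exact inv_mem (prod_mem fun i _ ↦ sub_mem htF (algebraMap_mem F _))
  have htop : IntermediateField.adjoin F {y} = ⊤ := by
    have h1 := IntermediateField.adjoin_adjoin_left ℂ {t} {y}
    rw [Set.singleton_union, h.adjoin] at h1
    exact IntermediateField.restrictScalars_eq_top_iff.1 h1
  have hint : IsIntegral F y := by
    refine IsIntegral.of_pow (Nat.pos_of_ne_zero hn) ?_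
    exact isIntegral_algebraMap (R := F) (x := ⟨_, hynF⟩)
  have hz : z ∈ (IntermediateField.adjoin F {y}).toSubalgebra := by
    rw [htop]; trivial
  rw [IntermediateField.adjoin_simple_toSubalgebra_of_isAlgebraic hint.isAlgebraic,
    Algebra.adjoin_singleton_eq_range_aeval] at hz
  obtain ⟨r, hr⟩ := hz
  set Q : Polynomial F := Polynomial.X ^ Fintype.card ι - Polynomial.C ⟨_, hynF⟩
  have hQ : Q.Monic := Polynomial.monic_X_pow_sub_C _ hn
  have hQd : Q.natDegree = Fintype.card ι := Polynomial.natDegree_X_pow_sub_C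
  have hQ0 : Polynomial.aeval y Q = 0 := by
    simp only [Q, map_sub, map_pow, Polynomial.aeval_X, Polynomial.aeval_C]
    exact sub_self _
  have hr' : Polynomial.aeval y (r %ₘ Q) = z := by
    rw [← hr]
    conv_rhs => rw [← Polynomial.modByMonic_add_div r Q]
    rw [AlgHom.toRingHom_eq_coe, RingHom.coe_coe, map_add, map_mul, hQ0, zero_mul, add_zero]
  have hdeg : (r %ₘ Q).natDegree < Fintype.card ι := by
    rw [← hQd]
    refine Polynomial.natDegree_modByMonic_lt _ hQ fun h1 ↦ ?_
    rw [h1, Polynomial.natDegree_one] at hQd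
    exact hn hQd.symm
  have key : ∀ u : F, ∃ p q : Polynomial ℂ, IsCoprime p q ∧ q ≠ 0 ∧
      (u : E) = Polynomial.aeval t p / Polynomial.aeval t q := by
    rintro ⟨u, hu⟩
    obtain ⟨p, q, hpq⟩ := IntermediateField.mem_adjoin_simple_iff ℂ _ |>.1 hu
    by_cases hq : Polynomial.aeval t q = 0
    · exact ⟨0, 1, isCoprime_zero_left.2 isUnit_one, one_ne_zero, by simp [hpq, hq]⟩
    have hq0 : q ≠ 0 := fun h0 ↦ hq (by simp [h0])
    let _ := EuclideanDomain.gcdMonoid (Polynomial ℂ)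
    obtain ⟨p', q', hp', hq', hu'⟩ := extract_gcd p q
    refine ⟨p', q', (gcd_isUnit_iff _ _).1 hu', fun h0 ↦ hq0 (by rw [hq', h0, mul_zero]), ?_⟩
    have e1 := congrArg (Polynomial.aeval t) hp'
    have e2 := congrArg (Polynomial.aeval t) hq'
    rw [map_mul] at e1 e2
    rw [e2] at hq
    refine hpq.trans ?_
    rw [e1, e2, mul_div_mul_left _ _ (left_ne_zero_of_mul hq)]
  choose P Q' hcop hq hPQ using key
  refine ⟨fun j ↦ P ((r %ₘ Q).coeff j), fun j ↦ Q' ((r %ₘ Q).coeff j), fun j ↦ hcop _,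
    fun j ↦ hq _, ?_⟩
  rw [← hr', Polynomial.aeval_eq_sum_range' hdeg]
  refine Finset.sum_congr rfl fun j _ ↦ ?_
  rw [← hPQ, Algebra.smul_def]
  rfl

end IsModel

end HolomorphicDifferentials

section HolomorphicPolynomials

open HahnSeries (single)

open Polynomial in
theorem ordGE_components {n : ℕ} {ζ : ℂ} (hζ : IsPrimitiveRoot ζ n) {a : ℕ → LaurentSeries ℂ}
    {o : ℤ} (h : ∀ k : ℕ, OrdGE o (∑ j ∈ Finset.range n, algebraMap ℂ _ (ζ ^ (k * j)) * a j))
    {l : ℕ} (hl : l < n) : OrdGE o (a l) := by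
  have hn : (n : ℂ) ≠ 0 := by exact_mod_cast (by omega : n ≠ 0)
  have hsum : ∀ j < n, ∑ k ∈ Finset.range n, ζ ^ (k * (n - l)) * ζ ^ (k * j) =
      if j = l then (n : ℂ) else 0 := by
    intro j hj
    have h1 : ∀ k, ζ ^ (k * (n - l)) * ζ ^ (k * j) = (ζ ^ (n - l + j)) ^ k := fun k ↦ by
      rw [← pow_add, ← pow_mul]; ring
    simp only [h1]
    split_ifs with hjl
    · rw [hjl, Nat.sub_add_cancel hl.le, hζ.pow_eq_one]
      simp
    · have hne : ζ ^ (n - l + j) ≠ 1 := fun h1 ↦ by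
        obtain ⟨c, hc⟩ := (hζ.pow_eq_one_iff_dvd _).1 h1
        have hc2 : c < 2 := by
          by_contra! h2
          have := Nat.mul_le_mul_left n h2
          omega
        interval_cases c <;> omega
      have := mul_geom_sum (ζ ^ (n - l + j)) n
      rw [← pow_mul, mul_comm _ n, pow_mul, hζ.pow_eq_one, one_pow, sub_self] at this
      exact (mul_eq_zero.1 this).resolve_left (sub_ne_zero.2 hne)
  have h2 : algebraMap ℂ (LaurentSeries ℂ) n * a l = ∑ k ∈ Finset.range n,
      algebraMap ℂ _ (ζ ^ (k * (n - l))) *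
        ∑ j ∈ Finset.range n, algebraMap ℂ _ (ζ ^ (k * j)) * a j := by
    simp only [Finset.mul_sum]
    rw [Finset.sum_comm]
    have h3 : ∀ j ∈ Finset.range n, (∑ k ∈ Finset.range n,
        algebraMap ℂ (LaurentSeries ℂ) (ζ ^ (k * (n - l))) *
          (algebraMap ℂ _ (ζ ^ (k * j)) * a j)) =
        if j = l then algebraMap ℂ (LaurentSeries ℂ) n * a l else 0 := by
      intro j hj
      simp only [← mul_assoc, ← map_mul]
      rw [← Finset.sum_mul, ← map_sum, hsum j (Finset.mem_range.1 hj)]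
      split_ifs with h
      · rw [h]
      · rw [map_zero, zero_mul]
    rw [Finset.sum_congr rfl h3, Finset.sum_ite_eq' (Finset.range n) l,
      if_pos (Finset.mem_range.2 hl)]
  have h3 : OrdGE o (algebraMap ℂ (LaurentSeries ℂ) n * a l) := by
    rw [h2]
    exact OrdGE.sum fun k _ ↦ (h k).const_mul _
  have h4 := h3.const_mul ((n : ℂ)⁻¹)
  rwa [← mul_assoc, ← map_mul, inv_mul_cancel₀ hn, map_one, one_mul] at h4

variable {ι : Type*} [Fintype ι] {α : ι → ℂ} {E : Type*} [Field E] [Algebra ℂ E]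

theorem rootMultiplicity_le_natDegree {p : Polynomial ℂ} (hp : p ≠ 0) (b : ℂ) :
    p.rootMultiplicity b ≤ p.natDegree := by
  have := Polynomial.natDegree_le_of_dvd (p.pow_rootMultiplicity_dvd b) hp
  simpa using this

namespace IsModel

variable {t y : E}

theorem exists_twist (h : IsModel α t y) [Nonempty ι] (ψ : E →ₐ[ℂ] LaurentSeries ℂ) {ζ : ℂ}
    (hζ : ζ ^ Fintype.card ι = 1) :
    ∃ ψ' : E →ₐ[ℂ] LaurentSeries ℂ, ψ' t = ψ t ∧ ψ' y = algebraMap ℂ _ ζ * ψ y :=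
  h.lift _ _ (h.map_ne_algebraMap ψ) (by
    rw [mul_pow, ← map_pow, hζ, map_one, one_mul, h.map_eqn ψ])

/-- A quotient of coprime polynomials in `t`, times `y ^ j dt`, that is holomorphic has a constant
denominator, and the numerator has degree at most `j - 2`. -/
theorem natDegree_of_component (h : IsModel α t y) (hα : Function.Injective α) [Nonempty ι]
    {p q : Polynomial ℂ} (hpq : IsCoprime p q) (hq : q ≠ 0) {j : ℕ}
    (H : ∀ ψ : E →ₐ[ℂ] LaurentSeries ℂ, OrdGE 0 (ψ (Polynomial.aeval t p / Polynomial.aeval t q) *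
      ψ y ^ j * laurentDeriv (ψ t))) :
    ∃ p' : Polynomial ℂ, (p' ≠ 0 → p'.natDegree + 2 ≤ j) ∧
      Polynomial.aeval t p / Polynomial.aeval t q = Polynomial.aeval t p' := by
  have hcard : 0 < Fintype.card ι := Fintype.card_pos
  have inj : ∀ r : Polynomial ℂ, r ≠ 0 → Polynomial.aeval t r ≠ 0 := by
    intro r hr h0
    obtain ⟨ψ, h1, -⟩ := h.exists_place_pole
    have h2 := congrArg ψ h0
    rw [map_zero, ← Polynomial.aeval_algHom_apply, h1] at h2
    exact (hasOrd_aeval_pole (hasOrd_single _) hr).ne_zero h2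
  have noroot : ∀ (ψ : E →ₐ[ℂ] LaurentSeries ℂ) (b : ℂ) (k : ℕ) (o : ℤ), 0 < k → o ≤ 0 →
      HasOrd k (ψ t - algebraMap ℂ _ b) → HasOrd o (ψ y) → q.eval b ≠ 0 := by
    intro ψ b k o hk ho h1 h2 h0
    have hp : p.eval b ≠ 0 := by
      intro h3
      obtain ⟨u, v, huv⟩ := hpq
      have := congrArg (Polynomial.eval b) huv
      simp [h0, h3] at this
    have h3 := hasOrd_aeval_of_eval_ne hk h1 hp
    have h4 := hasOrd_aeval_rootMultiplicity hk h1 hq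
    have h5 := h1.deriv (by omega)
    rw [laurentDeriv_sub_const] at h5
    have h6 := ((h3.mul h4.inv).mul (h2.pow j)).mul h5
    have h7 := H ψ
    rw [map_div₀, ← Polynomial.aeval_algHom_apply, ← Polynomial.aeval_algHom_apply,
      div_eq_mul_inv] at h7
    have h8 := h6.le h7
    have hm : 1 ≤ q.rootMultiplicity b := (Polynomial.rootMultiplicity_pos hq).2 h0
    have h9 : (j : ℤ) * o ≤ 0 := mul_nonpos_of_nonneg_of_nonpos (by positivity) ho
    have h10 : (k : ℤ) ≤ (q.rootMultiplicity b : ℤ) * k :=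
      le_mul_of_one_le_left (by positivity) (by exact_mod_cast hm)
    linarith
  have hdeg : q.degree = 0 := by
    by_contra hd
    obtain ⟨b, hb⟩ := IsAlgClosed.exists_root q hd
    by_cases hi : ∃ i, b = α i
    · obtain ⟨i, rfl⟩ := hi
      obtain ⟨ψ, h1, h2⟩ := h.exists_place_root hα i
      exact noroot ψ _ (Fintype.card ι) _ hcard (by norm_num) (h1 ▸ hasOrd_single _) h2 hb
    · push Not at hi
      obtain ⟨ψ, h1, h2⟩ := h.exists_place_regular hi
      exact noroot ψ _ 1 _ one_pos le_rfl (h1 ▸ hasOrd_single _) h2 hb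
  rw [Polynomial.eq_C_of_degree_eq_zero hdeg] at hq ⊢
  rw [Polynomial.eq_C_of_degree_eq_zero hdeg] at H
  set c := q.coeff 0
  have hc : c ≠ 0 := by simpa using hq
  have hrw : Polynomial.aeval t p / Polynomial.aeval t (Polynomial.C c) =
      Polynomial.aeval t (Polynomial.C c⁻¹ * p) := by
    rw [map_mul, Polynomial.aeval_C, Polynomial.aeval_C, map_inv₀, div_eq_inv_mul]
  refine ⟨Polynomial.C c⁻¹ * p, fun h0 ↦ ?_, hrw⟩
  obtain ⟨ψ, h1, h2⟩ := h.exists_place_pole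
  have h3 : HasOrd (-1) (ψ t) := h1 ▸ hasOrd_single _
  have h4 := H ψ
  rw [hrw, ← Polynomial.aeval_algHom_apply] at h4
  have h5 := (((hasOrd_aeval_pole h3 h0).mul (h2.pow j)).mul (h3.deriv (by norm_num))).le h4
  omega

theorem exists_polynomial_repr (h : IsModel α t y) (hα : Function.Injective α) [Nonempty ι]
    {z : E} (hz : IsHol t y z) :
    ∃ p : ℕ → Polynomial ℂ, (∀ j < Fintype.card ι, p j ≠ 0 → (p j).natDegree + 2 ≤ j) ∧
      z * y ^ 2 = ∑ j ∈ Finset.range (Fintype.card ι), Polynomial.aeval t (p j) * y ^ j := by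
  have hcard : Fintype.card ι ≠ 0 := Fintype.card_ne_zero
  obtain ⟨p, q, hpq, hq, hsum⟩ := h.exists_repr (z * y ^ 2)
  set r : ℕ → E := fun j ↦ Polynomial.aeval t (p j) / Polynomial.aeval t (q j) with hr
  have key : ∀ j < Fintype.card ι, ∀ ψ : E →ₐ[ℂ] LaurentSeries ℂ,
      OrdGE 0 (ψ (r j) * ψ y ^ j * laurentDeriv (ψ t)) := by
    intro j hj ψ
    obtain ⟨ζ, hζ⟩ : ∃ ζ : ℂ, IsPrimitiveRoot ζ (Fintype.card ι) :=
      ⟨_, Complex.isPrimitiveRoot_exp _ hcard⟩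
    refine ordGE_components (n := Fintype.card ι) hζ
      (a := fun j ↦ ψ (r j) * ψ y ^ j * laurentDeriv (ψ t)) (fun k ↦ ?_) hj
    obtain ⟨ψ', h1, h2⟩ := h.exists_twist ψ (ζ := ζ ^ k) (by
      rw [← pow_mul, mul_comm, pow_mul, hζ.pow_eq_one, one_pow])
    have h3 : ∀ j, ψ' (r j) = ψ (r j) := fun j ↦ by
      simp only [hr, map_div₀, ← Polynomial.aeval_algHom_apply, h1]
    have h4 := hz ψ'
    rw [differential, ← mul_assoc, ← map_pow, ← map_mul, hsum, map_sum, h1, Finset.sum_mul] at h4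
    convert h4 using 1
    refine Finset.sum_congr rfl fun j _ ↦ ?_
    rw [map_mul ψ', map_pow ψ', h2, mul_pow, ← map_pow (algebraMap ℂ (LaurentSeries ℂ)), ← pow_mul]
    change _ = ψ' (r j) * _ * _
    rw [h3]
    ring
  have key2 : ∀ j, ∃ p' : Polynomial ℂ, j < Fintype.card ι →
      (p' ≠ 0 → p'.natDegree + 2 ≤ j) ∧ r j = Polynomial.aeval t p' := by
    intro j
    by_cases hj : j < Fintype.card ι
    · obtain ⟨p', hp'⟩ := h.natDegree_of_component hα (hpq j) (hq j) (key j hj)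
      exact ⟨p', fun _ ↦ hp'⟩
    · exact ⟨0, fun h' ↦ absurd h' hj⟩
  choose p' hp' using key2
  refine ⟨p', fun j hj ↦ (hp' j hj).1, ?_⟩
  rw [hsum]
  refine Finset.sum_congr rfl fun j hj ↦ ?_
  rw [← (hp' j (Finset.mem_range.1 hj)).2]

theorem growth_of_isHol (h : IsModel α t y) (hα : Function.Injective α) [Nonempty ι]
    {z : E} (hz : IsHol t y z) {ψ : E →ₐ[ℂ] LaurentSeries ℂ} {e : ℤ} (he : 0 ≤ e)
    (hx : OrdGE (-e) (ψ (t * y))) (hy : OrdGE (-e) (ψ y)) :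
    OrdGE (-((Fintype.card ι - 3) * e)) (ψ z) := by
  obtain ⟨p, hp, hsum⟩ := h.exists_polynomial_repr hα hz
  have hy0 := h.y_ne_zero
  have h1 : z = ∑ j ∈ Finset.range (Fintype.card ι), ∑ b ∈ Finset.range (j - 1),
      algebraMap ℂ E ((p j).coeff b) * ((t * y) ^ b * y ^ (j - 2 - b)) := by
    refine mul_right_cancel₀ (pow_ne_zero 2 hy0) ?_
    rw [hsum, Finset.sum_mul]
    refine Finset.sum_congr rfl fun j hj ↦ ?_
    by_cases h0 : p j = 0
    · simp [h0]
    have h2 := hp j (Finset.mem_range.1 hj) h0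
    rw [Polynomial.aeval_eq_sum_range' (n := j - 1) (by omega), Finset.sum_mul, Finset.sum_mul]
    refine Finset.sum_congr rfl fun b hb ↦ ?_
    rw [Finset.mem_range] at hb
    obtain ⟨r, rfl⟩ : ∃ r, j = 2 + b + r := ⟨j - 2 - b, by omega⟩
    rw [Algebra.smul_def, show 2 + b + r - 2 - b = r by omega]
    ring
  rw [h1, map_sum]
  refine OrdGE.sum fun j hj ↦ ?_
  rw [map_sum]
  refine OrdGE.sum fun b hb ↦ ?_
  rw [map_mul, AlgHom.commutes, map_mul, map_pow, map_pow]
  rw [Finset.mem_range] at hj hb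
  refine (((hx.pow b).mul (hy.pow (j - 2 - b))).const_mul _).mono ?_
  have h3 : (b : ℤ) + ((j - 2 - b : ℕ) : ℤ) ≤ Fintype.card ι - 3 := by omega
  nlinarith

theorem exists_hasOrd_at_root (h : IsModel α t y) (hα : Function.Injective α) {z : E}
    (hz : IsHol t y z) (hz0 : z ≠ 0) {i : ι} {ψ : E →ₐ[ℂ] LaurentSeries ℂ}
    (h1 : HasOrd (Fintype.card ι) (ψ t - algebraMap ℂ _ (α i))) (h2 : HasOrd (-1) (ψ y)) :
    ∃ b c : ℕ, b + c + 3 ≤ Fintype.card ι ∧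
      HasOrd (Fintype.card ι * b + c) (ψ z * differential t y ψ) := by
  have : Nonempty ι := ⟨i⟩
  have hcard : 0 < Fintype.card ι := Fintype.card_pos
  obtain ⟨p, hp, hsum⟩ := h.exists_polynomial_repr hα hz
  have hderiv := h1.deriv (by omega)
  rw [laurentDeriv_sub_const] at hderiv
  set s := (Finset.range (Fintype.card ι)).filter fun j ↦ p j ≠ 0
  have h3 : ψ z * differential t y ψ =
      ∑ j ∈ s, Polynomial.aeval (ψ t) (p j) * ψ y ^ j * laurentDeriv (ψ t) := by
    rw [differential, ← mul_assoc, ← map_pow, ← map_mul, hsum, map_sum, Finset.sum_mul,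
      Finset.sum_filter]
    refine Finset.sum_congr rfl fun j _ ↦ ?_
    split_ifs with hj
    · rw [map_mul, map_pow, Polynomial.aeval_algHom_apply]
    · rw [not_not.1 hj, map_zero, zero_mul, map_zero, zero_mul]
  have hs : s.Nonempty := by
    rw [Finset.nonempty_iff_ne_empty]
    intro h0
    rw [h0, Finset.sum_empty] at h3
    have h4 : ψ z ≠ 0 := (map_ne_zero ψ).2 hz0
    have h5 : differential t y ψ ≠ 0 := ((h2.pow 2).mul hderiv).ne_zero
    exact mul_ne_zero h4 h5 h3
  have hmem : ∀ j ∈ s, j < Fintype.card ι ∧ p j ≠ 0 := fun j hj ↦ by simpa [s] using hj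
  have hb : ∀ j ∈ s, (p j).rootMultiplicity (α i) + 2 ≤ j := fun j hj ↦
    (Nat.add_le_add_right (rootMultiplicity_le_natDegree (hmem j hj).2 _) 2).trans
      (hp j (hmem j hj).1 (hmem j hj).2)
  obtain ⟨j, hj, hj'⟩ := exists_hasOrd_sum hs
    (o := fun j ↦ (Fintype.card ι : ℤ) * (p j).rootMultiplicity (α i) +
      ((Fintype.card ι - 1 - j : ℕ) : ℤ))
    (F := fun j ↦ Polynomial.aeval (ψ t) (p j) * ψ y ^ j * laurentDeriv (ψ t)) (by
      intro j hj l hl hjl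
      have hj1 := (hmem j hj).1
      have hl1 := (hmem l hl).1
      have h5 := congrArg (· % (Fintype.card ι : ℤ)) hjl
      simp only [Int.mul_add_emod_self_left] at h5
      rw [Int.emod_eq_of_lt (by positivity) (by omega),
        Int.emod_eq_of_lt (by positivity) (by omega)] at h5
      omega)
    (fun j hj ↦ by
      have hj1 := (hmem j hj).1
      convert ((hasOrd_aeval_rootMultiplicity hcard h1 (hmem j hj).2).mul (h2.pow j)).mul hderiv
        using 1
      rw [mul_comm]
      omega)
  refine ⟨_, Fintype.card ι - 1 - j, ?_, h3 ▸ hj'⟩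
  have := hb j hj
  have := (hmem j hj).1
  omega

end IsModel

end HolomorphicPolynomials

section RegularBranches

open HahnSeries (single)

theorem laurentDeriv_single_one : laurentDeriv (single 1 1) = (1 : LaurentSeries ℂ) := by
  have h := laurentDeriv_single_mul 1 1
  have h1 : laurentDeriv (1 : LaurentSeries ℂ) = 0 := by
    simpa using laurentDeriv_algebraMap 1
  rw [mul_one, mul_one, h1, mul_zero, add_zero] at h
  simpa using h

/-- The expansion of a power series to first order. -/
theorem OrdGE.exists_expansion {x : LaurentSeries ℂ} (hx : OrdGE 0 x) :
    ∃ x₀ x₁ : ℂ, OrdGE 2 (x - algebraMap ℂ _ x₀ - algebraMap ℂ _ x₁ * single 1 1) := by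
  obtain ⟨x₀, h0⟩ := hx.exists_const
  obtain ⟨x₁, h1⟩ := h0.exists_leading
  exact ⟨x₀, x₁, h1⟩

theorem ordGE_one_of_expansion {x : LaurentSeries ℂ} {x₀ x₁ : ℂ}
    (h : OrdGE 2 (x - algebraMap ℂ _ x₀ - algebraMap ℂ _ x₁ * single 1 1)) :
    OrdGE 1 (x - algebraMap ℂ _ x₀) := by
  have := (h.mono (j := 1) (by norm_num)).add ((hasOrd_single 1).ordGE.const_mul x₁)
  rwa [sub_add_cancel] at this

theorem hasOrd_one_of_expansion {x : LaurentSeries ℂ} {x₀ x₁ : ℂ} (hx₁ : x₁ ≠ 0)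
    (h : OrdGE 2 (x - algebraMap ℂ _ x₀ - algebraMap ℂ _ x₁ * single 1 1)) :
    HasOrd 1 (x - algebraMap ℂ _ x₀) := by
  have := ((hasOrd_single 1).const_mul hx₁).add_ordGE h
  rwa [add_sub_cancel] at this

theorem deriv_of_expansion {x : LaurentSeries ℂ} {x₀ x₁ : ℂ}
    (h : OrdGE 2 (x - algebraMap ℂ _ x₀ - algebraMap ℂ _ x₁ * single 1 1)) :
    OrdGE 1 (laurentDeriv x - algebraMap ℂ _ x₁) := by
  have := h.deriv
  rw [map_sub, map_sub, laurentDeriv_mul, laurentDeriv_algebraMap, laurentDeriv_algebraMap,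
    laurentDeriv_single_one] at this
  simpa using this

variable {ι : Type*} [Fintype ι] {α : ι → ℂ} {E : Type*} [Field E] [Algebra ℂ E]

namespace IsModel

variable {t y : E}

open Polynomial in
theorem exists_form_of_flex (h : IsModel α t y) [Nonempty ι] {ψ : E →ₐ[ℂ] LaurentSeries ℂ}
    (hx : OrdGE 0 (ψ t * ψ y)) (hy : OrdGE 0 (ψ y)) (hD : HasOrd 0 (differential t y ψ))
    {l m : ℂ} (hu : OrdGE (Fintype.card ι)
      (1 - (algebraMap ℂ _ l * (ψ t * ψ y) + algebraMap ℂ _ m * ψ y))) :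
    ∃ r s : ℂ, ∀ w : ℂ, ∏ i, (w - α i) =
      (l * w + m) ^ Fintype.card ι - (r * w + s) ^ Fintype.card ι := by
  have hn : Fintype.card ι ≠ 0 := Fintype.card_ne_zero
  set n := Fintype.card ι with hndef
  set u := algebraMap ℂ _ l * (ψ t * ψ y) + algebraMap ℂ _ m * ψ y with hudef
  have hu0 : OrdGE 0 u := (hx.const_mul l).add (hy.const_mul m)
  have hun : OrdGE n (1 - u ^ n) := by
    have h1 := mul_neg_geom_sum u n
    rw [← h1]
    have := hu.mul (OrdGE.sum (s := Finset.range n) fun i _ ↦ by simpa using hu0.pow i)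
    simpa using this
  set H : ℂ[X] := ∏ i, (Polynomial.X - Polynomial.C (α i)) -
    (Polynomial.C l * Polynomial.X + Polynomial.C m) ^ n with hH
  have hHd : H.natDegree ≤ n := by
    refine (natDegree_sub_le _ _).trans (max_le ?_ ?_)
    · rw [natDegree_prod_of_monic _ _ fun i _ ↦ monic_X_sub_C _]
      simp [hndef]
    · refine natDegree_pow_le.trans ?_
      have : (Polynomial.C l * Polynomial.X + Polynomial.C m).natDegree ≤ 1 := natDegree_linear_le
      nlinarith
  have heval : ∀ w, ∏ i, (w - α i) = (l * w + m) ^ n + H.eval w := fun w ↦ by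
    simp [hH, Polynomial.eval_prod]
  have haeval : aeval (ψ t) H * ψ y ^ n = 1 - u ^ n := by
    have h1 := h.map_eqn ψ
    have h2 : aeval (ψ t) H = ∏ i, (ψ t - algebraMap ℂ _ (α i)) -
        (algebraMap ℂ _ l * ψ t + algebraMap ℂ _ m) ^ n := by
      simp [hH, map_prod, Polynomial.aeval_C]
    rw [h2, hudef, ← h1]
    have : algebraMap ℂ (LaurentSeries ℂ) l * (ψ t * ψ y) + algebraMap ℂ _ m * ψ y =
      (algebraMap ℂ _ l * ψ t + algebraMap ℂ _ m) * ψ y := by ring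
    rw [this, mul_pow]
    ring
  rw [← haeval] at hun
  -- it suffices to see that `H` is a constant times an `n`-th power
  suffices hs : ∃ κ r s : ℂ, ∀ w, H.eval w = κ * (r * w + s) ^ n by
    obtain ⟨κ, r, s, hs⟩ := hs
    obtain ⟨ν, hν⟩ := IsAlgClosed.exists_pow_nat_eq (-κ) (Nat.pos_of_ne_zero hn)
    refine ⟨ν * r, ν * s, fun w ↦ ?_⟩
    rw [heval, hs, show ν * r * w + ν * s = ν * (r * w + s) by ring, mul_pow, hν]
    ring
  by_cases hH0 : H = 0
  · exact ⟨0, 0, 0, fun w ↦ by simp [hH0]⟩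
  obtain ⟨k, hk⟩ := exists_hasOrd (x := ψ y) (fun h0 ↦ h.y_ne_zero
    (ψ.injective (by simpa using h0)))
  have hk0 := hk.le hy
  have hderiv : HasOrd (-(2 * k)) (laurentDeriv (ψ t)) := by
    have h1 := hD.mul (hk.pow 2).inv
    rw [differential, mul_comm (ψ y ^ 2), mul_assoc, mul_inv_cancel₀ (hk.pow 2).ne_zero,
      mul_one] at h1
    simpa using h1
  obtain ⟨o, ho⟩ := exists_hasOrd (x := ψ t) (by simpa using h.map_ne_algebraMap ψ 0)
  rcases lt_or_ge o 0 with ho0 | ho0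
  · have h1 := (ho.deriv ho0.ne).unique hderiv
    have h2 := (ho.mul hk).le hx
    have ho1 : o = -1 := by omega
    subst ho1
    have hk1 : k = 1 := by omega
    subst hk1
    have h3 := ((hasOrd_aeval_pole ho hH0).mul (hk.pow n)).le hun
    have h4 : H.natDegree = 0 := by omega
    refine ⟨H.coeff 0, 0, 1, fun w ↦ ?_⟩
    rw [eq_C_of_natDegree_eq_zero h4]
    simp
  · obtain ⟨t₀, ht₀⟩ := (ho.ordGE.mono ho0).exists_const
    obtain ⟨p, hp⟩ := exists_hasOrd (sub_ne_zero.2 (h.map_ne_algebraMap ψ t₀))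
    have hp1 := hp.le ht₀
    have h1 := hp.deriv (by omega)
    rw [laurentDeriv_sub_const] at h1
    have h2 := h1.unique hderiv
    have hk' : k = 0 := by omega
    subst hk'
    have hp' : p = ((1 : ℕ) : ℤ) := by push_cast; omega
    rw [hp'] at hp
    have h3 := ((hasOrd_aeval_rootMultiplicity one_pos hp hH0).mul (hk.pow n)).le hun
    have h4 : n ≤ H.rootMultiplicity t₀ := by
      push_cast at h3
      omega
    obtain ⟨Q, hQ⟩ := (pow_dvd_pow (Polynomial.X - Polynomial.C t₀) h4).trans
      (H.pow_rootMultiplicity_dvd t₀)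
    have hQ0 : Q.natDegree = 0 := by
      have h5 := congrArg natDegree hQ
      have hQne : Q ≠ 0 := by
        rintro rfl
        exact hH0 (by rw [hQ, mul_zero])
      rw [natDegree_mul (pow_ne_zero _ (X_sub_C_ne_zero _)) hQne, natDegree_pow,
        natDegree_X_sub_C] at h5
      omega
    refine ⟨Q.coeff 0, 1, -t₀, fun w ↦ ?_⟩
    rw [hQ, eq_C_of_natDegree_eq_zero hQ0]
    simp
    ring

theorem exists_form_of_regular (h : IsModel α t y) (hα : Function.Injective α)
    (hn : 5 ≤ Fintype.card ι) {ψ : E →ₐ[ℂ] LaurentSeries ℂ}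
    (hx : OrdGE 0 (ψ t * ψ y)) (hy : OrdGE 0 (ψ y))
    (H0 : ∃ z, IsHol t y z ∧ HasOrd 0 (ψ z * differential t y ψ))
    (H : ∀ z, IsHol t y z → z ≠ 0 → ∃ b c : ℕ, b + c + 3 ≤ Fintype.card ι ∧
      HasOrd (Fintype.card ι * b + c) (ψ z * differential t y ψ)) :
    ∃ l m r s : ℂ, ∀ w : ℂ, ∏ i, (w - α i) =
      (l * w + m) ^ Fintype.card ι - (r * w + s) ^ Fintype.card ι := by
  have : Nonempty ι := Fintype.card_pos_iff.1 (by omega)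
  have hD : HasOrd 0 (differential t y ψ) := by
    obtain ⟨z, hz, hz0⟩ := H0
    have h1 := h.growth_of_isHol hα hz (ψ := ψ) le_rfl (by rw [map_mul]; simpa using hx)
      (by simpa using hy)
    have h2 := ordGE_differential hx hy
    rcases h2.succ_or_hasOrd with h3 | h3
    · have := hz0.le (h1.mul h3)
      simp at this
    · exact h3
  obtain ⟨x₀, x₁, hx2⟩ := hx.exists_expansion
  obtain ⟨y₀, y₁, hy2⟩ := hy.exists_expansion
  set s : LaurentSeries ℂ := single 1 1 with hs
  set d := y₀ * x₁ - x₀ * y₁ with hd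
  have hd0 : d ≠ 0 := by
    intro h0
    have h1 := (hy.mul (deriv_of_expansion hx2)).sub (hx.mul (deriv_of_expansion hy2))
    have h2 := ((ordGE_one_of_expansion hy2).const_mul x₁).sub
      ((ordGE_one_of_expansion hx2).const_mul y₁)
    have h3 := (h1.mono (j := 1) (by norm_num)).add h2
    have h4 : differential t y ψ = ψ y * (laurentDeriv (ψ t * ψ y) - algebraMap ℂ _ x₁) -
        (ψ t * ψ y) * (laurentDeriv (ψ y) - algebraMap ℂ _ y₁) +
        (algebraMap ℂ _ x₁ * (ψ y - algebraMap ℂ _ y₀) -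
          algebraMap ℂ _ y₁ * (ψ t * ψ y - algebraMap ℂ _ x₀)) + algebraMap ℂ _ d := by
      rw [differential_eq, hd]
      simp only [map_sub, map_mul]
      ring
    rw [h0, map_zero, add_zero] at h4
    have := hD.le (h4 ▸ h3)
    omega
  obtain ⟨w, k₀, hw, hwk⟩ : ∃ (w : E) (k₀ : ℂ), (w = t * y ∨ w = y) ∧
      HasOrd 1 (ψ w - algebraMap ℂ _ k₀) := by
    by_cases hx1 : x₁ = 0
    · have hy1 : y₁ ≠ 0 := by
        rintro rfl
        simp [hd, hx1] at hd0
      exact ⟨y, y₀, Or.inr rfl, hasOrd_one_of_expansion hy1 hy2⟩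
    · refine ⟨t * y, x₀, Or.inl rfl, ?_⟩
      rw [map_mul]
      exact hasOrd_one_of_expansion hx1 hx2
  set l := -y₁ / d
  set m := x₁ / d
  have hu2 : OrdGE 2 (1 - (algebraMap ℂ _ l * (ψ t * ψ y) + algebraMap ℂ _ m * ψ y)) := by
    have h1 := ((hx2.const_mul l).add (hy2.const_mul m)).neg
    have e1 : l * x₀ + m * y₀ = 1 := by
      simp only [l, m]; field_simp; rw [hd]; ring
    have e2 : l * x₁ + m * y₁ = 0 := by
      simp only [l, m]; field_simp; ring
    have e1' := congrArg (algebraMap ℂ (LaurentSeries ℂ)) e1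
    have e2' := congrArg (algebraMap ℂ (LaurentSeries ℂ)) e2
    simp only [map_add, map_mul, map_one, map_zero] at e1' e2'
    convert h1 using 1
    linear_combination -e1' - s * e2'
  suffices hun : OrdGE (Fintype.card ι)
      (1 - (algebraMap ℂ _ l * (ψ t * ψ y) + algebraMap ℂ _ m * ψ y)) by
    obtain ⟨r, s, hrs⟩ := h.exists_form_of_flex hx hy hD hun
    exact ⟨l, m, r, s, hrs⟩
  by_contra hun
  have hne : (1 - (algebraMap ℂ _ l * (ψ t * ψ y) + algebraMap ℂ _ m * ψ y)) ≠ 0 := fun h0 ↦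
    hun (h0 ▸ ordGE_of_zero _)
  obtain ⟨k, hk⟩ := exists_hasOrd hne
  have hk2 := hk.le hu2
  have hkn : k < Fintype.card ι := by
    by_contra! h'
    exact hun (hk.ordGE.mono h')
  obtain ⟨k, rfl⟩ := Int.eq_ofNat_of_zero_le (by omega : 0 ≤ k)
  set r := Fintype.card ι - 2 - k
  set z : E := (1 - (algebraMap ℂ _ l * (t * y) + algebraMap ℂ _ m * y)) *
    (w - algebraMap ℂ _ k₀) ^ r with hz
  have hmapz : ∀ ψ : E →ₐ[ℂ] LaurentSeries ℂ, ψ z =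
      (1 - (algebraMap ℂ _ l * (ψ (t * y)) + algebraMap ℂ _ m * ψ y)) *
        (ψ w - algebraMap ℂ _ k₀) ^ r := fun ψ ↦ by
    simp only [hz, map_mul, map_sub, map_add, map_pow, map_one, AlgHom.commutes]
  have hzH : IsHol t y z := by
    refine h.isHol_of_growth hα fun φ e he h1 h2 ↦ ?_
    rw [hmapz]
    have h3 : OrdGE (-e) (φ w) := by rcases hw with rfl | rfl <;> assumption
    have hc : ∀ c : ℂ, OrdGE (-e) (algebraMap ℂ (LaurentSeries ℂ) c) := fun c ↦
      (ordGE_algebraMap c).mono (by omega)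
    have h4 := (((map_one (algebraMap ℂ (LaurentSeries ℂ))) ▸ hc 1).sub
      ((h1.const_mul l).add (h2.const_mul m))).mul ((h3.sub (hc k₀)).pow r)
    refine h4.mono ?_
    have : (r : ℤ) + 1 ≤ Fintype.card ι - 3 := by omega
    nlinarith
  have hzord : HasOrd (k + r) (ψ z * differential t y ψ) := by
    rw [hmapz, map_mul]
    have := (hk.mul (hwk.pow r)).mul hD
    simpa using this
  have hz0 : z ≠ 0 := by
    rintro h0
    rw [h0, map_zero, zero_mul] at hzord
    exact hzord.ne_zero rfl
  obtain ⟨b, c, hbc, hord⟩ := H z hzH hz0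
  have heq := hord.unique hzord
  rcases Nat.eq_zero_or_pos b with rfl | hb
  · push_cast at heq
    omega
  · have : (Fintype.card ι : ℤ) * 1 ≤ Fintype.card ι * b :=
      mul_le_mul_of_nonneg_left (by exact_mod_cast hb) (by positivity)
    omega

end IsModel

end RegularBranches

section ChangeOfModel

variable {ι : Type*} [Fintype ι] {α β : ι → ℂ} {E : Type*} [Field E] [Algebra ℂ E]

theorem exists_algebraMap_of_pow_eq {d : ℕ} (hd : d ≠ 0) {u : E} {c : ℂ}
    (h : u ^ d = algebraMap ℂ E c) : ∃ ρ : ℂ, u = algebraMap ℂ E ρ := by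
  have hint : IsIntegral ℂ u := by
    refine IsIntegral.of_pow (Nat.pos_of_ne_zero hd) ?_
    rw [h]
    exact isIntegral_algebraMap
  have h1 := IsAlgClosed.degree_eq_one_of_irreducible ℂ (minpoly.irreducible hint)
  obtain ⟨ρ, hρ⟩ := minpoly.mem_range_of_degree_eq_one ℂ u h1
  exact ⟨ρ, hρ.symm⟩

theorem HasOrd.exists_sub_const_mul {k : ℤ} {x y : LaurentSeries ℂ} (hx : OrdGE k x)
    (hy : HasOrd k y) : ∃ c : ℂ, OrdGE (k + 1) (x - algebraMap ℂ _ c * y) := by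
  have h1 : OrdGE 0 (y⁻¹ * x) := by
    have := hy.inv.ordGE.mul hx
    rwa [neg_add_cancel] at this
  obtain ⟨c, hc⟩ := h1.exists_const
  refine ⟨c, ?_⟩
  have h2 := hy.ordGE.mul hc
  convert h2 using 1
  rw [mul_sub, ← mul_assoc, mul_inv_cancel₀ hy.ne_zero, one_mul, mul_comm y]

namespace IsModel

variable {t y T Y : E}

theorem exists_laurentDeriv (h : IsModel α t y) [Nonempty ι] (z : E) :
    ∃ g : E, ∀ ψ : E →ₐ[ℂ] LaurentSeries ℂ,
      laurentDeriv (ψ z) = ψ g * differential t y ψ := by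
  have hy0 := h.y_ne_zero
  let Q : E → Prop := fun z ↦ ∃ g : E, ∀ ψ : E →ₐ[ℂ] LaurentSeries ℂ,
    laurentDeriv (ψ z) = ψ g * differential t y ψ
  have hconst : ∀ c : ℂ, Q (algebraMap ℂ E c) := fun c ↦ ⟨0, fun ψ ↦ by
    rw [AlgHom.commutes, laurentDeriv_algebraMap, map_zero, zero_mul]⟩
  have hadd : ∀ u v, Q u → Q v → Q (u + v) := fun u v ⟨f, hf⟩ ⟨g, hg⟩ ↦ ⟨f + g, fun ψ ↦ by
    rw [map_add, map_add, hf, hg, map_add]; ring⟩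
  have hmul : ∀ u v, Q u → Q v → Q (u * v) := fun u v ⟨f, hf⟩ ⟨g, hg⟩ ↦ ⟨u * g + v * f, fun ψ ↦ by
    rw [map_mul, laurentDeriv_mul, hf, hg, map_add, map_mul, map_mul]; ring⟩
  have hinv : ∀ u, Q u → Q u⁻¹ := by
    rintro u ⟨f, hf⟩
    rcases eq_or_ne u 0 with rfl | hu
    · rw [inv_zero]
      exact ⟨f, hf⟩
    refine ⟨-(u⁻¹ ^ 2 * f), fun ψ ↦ ?_⟩
    have hψ : ψ u ≠ 0 := (map_ne_zero ψ).2 hu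
    have h1 : laurentDeriv (ψ u * ψ u⁻¹) = 0 := by
      rw [← map_mul, mul_inv_cancel₀ hu, map_one]
      simpa using laurentDeriv_algebraMap 1
    rw [laurentDeriv_mul, hf] at h1
    refine mul_left_cancel₀ hψ ?_
    rw [map_neg, map_mul, map_pow]
    have h2 : ψ u * ψ u⁻¹ = 1 := by rw [← map_mul, mul_inv_cancel₀ hu, map_one]
    linear_combination h1 + ψ u⁻¹ * ψ f * differential t y ψ * h2
  have ht : Q t := ⟨(y ^ 2)⁻¹, fun ψ ↦ by
    have hψ : ψ y ≠ 0 := (map_ne_zero ψ).2 hy0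
    rw [differential, map_inv₀, map_pow, ← mul_assoc, inv_mul_cancel₀ (pow_ne_zero 2 hψ), one_mul]⟩
  have hprod : Q (∏ i, (t - algebraMap ℂ E (α i))) := by
    refine Finset.prod_induction _ Q hmul (by simpa using hconst 1) fun i _ ↦ ?_
    rw [sub_eq_add_neg, ← map_neg]
    exact hadd _ _ ht (hconst _)
  have hy : Q y := by
    obtain ⟨f, hf⟩ := hprod
    obtain ⟨n, hn⟩ : ∃ n, Fintype.card ι = n + 1 :=
      Nat.exists_eq_succ_of_ne_zero Fintype.card_ne_zero
    have he := h.eqn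
    rw [hn] at he
    set W := ∏ i, (t - algebraMap ℂ E (α i))
    have hn0 : ((n : LaurentSeries ℂ) + 1) ≠ 0 := by
      have hc : ((n : ℂ) + 1) ≠ 0 := by exact_mod_cast Nat.succ_ne_zero n
      simpa using (hasOrd_algebraMap hc).ne_zero
    have hn0' : ((n : E) + 1) ≠ 0 := by
      intro h0
      obtain ⟨ψ, -, -⟩ := h.exists_place_pole
      have := congrArg ψ h0
      exact hn0 (by simpa using this)
    refine ⟨-(y ^ (n + 2) * f) / (n + 1), fun ψ ↦ ?_⟩
    have hψ : ψ y ≠ 0 := (map_ne_zero ψ).2 hy0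
    have h1 : ψ y ^ (n + 1) * ψ W = 1 := by
      rw [← map_pow, ← map_mul, he, map_one]
    have h2 := congrArg laurentDeriv h1
    have h3 : laurentDeriv (1 : LaurentSeries ℂ) = 0 := by simpa using laurentDeriv_algebraMap 1
    rw [laurentDeriv_mul, laurentDeriv_pow, hf, h3] at h2
    rw [map_div₀, map_neg, map_mul, map_pow, map_add, map_natCast, map_one, div_mul_eq_mul_div,
      eq_div_iff hn0]
    linear_combination ψ y * h2 - (n + 1) * laurentDeriv (ψ y) * h1
  have hz : z ∈ IntermediateField.adjoin ℂ {t, y} := h.adjoin ▸ IntermediateField.mem_top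
  refine IntermediateField.adjoin_induction ℂ (p := fun z _ ↦ Q z) ?_ hconst
    (fun _ _ _ _ ↦ hadd _ _) (fun _ _ ↦ hinv _) (fun _ _ _ _ ↦ hmul _ _) hz
  rintro x (rfl | rfl)
  exacts [ht, hy]

theorem differential_ne_zero (h : IsModel α t y) (hα : Function.Injective α) (i : ι) :
    ∃ ψ : E →ₐ[ℂ] LaurentSeries ℂ, differential t y ψ ≠ 0 := by
  have : Nonempty ι := ⟨i⟩
  obtain ⟨ψ, h1, h2⟩ := h.exists_place_root hα i
  refine ⟨ψ, (hasOrd_differential one_pos h2 (α := α) (i := i) ?_).ne_zero⟩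
  rw [h1, mul_one]
  exact hasOrd_single _

theorem exists_change (h : IsModel α t y) (h' : IsModel β T Y) (hβ : Function.Injective β)
    (hn : 3 ≤ Fintype.card ι) : ∃ G : E, G ≠ 0 ∧ ∀ ψ : E →ₐ[ℂ] LaurentSeries ℂ,
      differential T Y ψ = ψ G * differential t y ψ := by
  obtain ⟨i⟩ : Nonempty ι := Fintype.card_pos_iff.1 (by omega)
  have : Nonempty ι := ⟨i⟩
  obtain ⟨g, hg⟩ := h.exists_laurentDeriv T
  have key : ∀ ψ : E →ₐ[ℂ] LaurentSeries ℂ,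
      differential T Y ψ = ψ (Y ^ 2 * g) * differential t y ψ := fun ψ ↦ by
    rw [differential, hg, map_mul, map_pow, mul_assoc]
  refine ⟨_, ?_, key⟩
  intro h0
  obtain ⟨ψ, hψ⟩ := h'.differential_ne_zero hβ i
  rw [key, h0, map_zero, zero_mul] at hψ
  exact hψ rfl

theorem isHol_pow (h : IsModel α t y) (hα : Function.Injective α) (hn : 3 ≤ Fintype.card ι)
    (b c : ℂ) : IsHol t y
      ((algebraMap ℂ E b * (t * y) + algebraMap ℂ E c * y) ^ (Fintype.card ι - 3)) := by
  have : Nonempty ι := Fintype.card_pos_iff.1 (by omega)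
  refine h.isHol_of_growth hα fun ψ e _ h1 h2 ↦ ?_
  rw [map_pow, map_add, map_mul ψ (algebraMap ℂ E b), map_mul ψ (algebraMap ℂ E c),
    AlgHom.commutes, AlgHom.commutes]
  refine (((h1.const_mul b).add (h2.const_mul c)).pow _).mono ?_
  rw [Nat.cast_sub hn]
  push_cast
  linarith

theorem hasOrd_pow_at_root {ψ : E →ₐ[ℂ] LaurentSeries ℂ} {a : ℂ} (hn : 3 ≤ Fintype.card ι)
    (h1 : HasOrd (Fintype.card ι) (ψ t - algebraMap ℂ _ a)) (h2 : HasOrd (-1) (ψ y)) :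
    HasOrd (Fintype.card ι * (Fintype.card ι - 3 : ℕ))
      (ψ ((t * y - algebraMap ℂ E a * y) ^ (Fintype.card ι - 3)) * differential t y ψ) := by
  have hd := (h2.pow 2).mul (h1.deriv (by omega))
  rw [laurentDeriv_sub_const] at hd
  have h3 := ((h1.mul h2).pow (Fintype.card ι - 3)).mul hd
  rw [map_pow, map_sub, map_mul, map_mul, AlgHom.commutes, ← sub_mul, differential]
  convert h3 using 1
  rw [Nat.cast_sub hn]
  push_cast
  ring

theorem isHol_change {G : E}
    (hD : ∀ ψ : E →ₐ[ℂ] LaurentSeries ℂ, differential T Y ψ = ψ G * differential t y ψ) {z : E} :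
    IsHol T Y z ↔ IsHol t y (G * z) := by
  refine forall_congr' fun ψ ↦ ?_
  rw [hD, map_mul, ← mul_assoc, mul_comm (ψ z)]

/-- If the form `∏ i, (w - α i)` is not a difference of two `n`-th powers, the branches over the
roots are intrinsic. -/
theorem root_of_root (h : IsModel α t y) (hα : Function.Injective α) (h' : IsModel β T Y)
    (hβ : Function.Injective β) (hn : 5 ≤ Fintype.card ι)
    (hform : ¬ ∃ l m r s : ℂ, ∀ w, ∏ i, (w - α i) =
      (l * w + m) ^ Fintype.card ι - (r * w + s) ^ Fintype.card ι)
    {G : E} (hG : G ≠ 0)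
    (hD : ∀ ψ : E →ₐ[ℂ] LaurentSeries ℂ, differential T Y ψ = ψ G * differential t y ψ)
    {i : ι} {ψ : E →ₐ[ℂ] LaurentSeries ℂ} (h1 : HasOrd (Fintype.card ι)
      (ψ T - algebraMap ℂ _ (β i)))
    (h2 : HasOrd (-1) (ψ Y)) :
    ∃ (j : ι) (c : ℂ), c ≠ 0 ∧ HasOrd (Fintype.card ι) (ψ t - algebraMap ℂ _ (α j)) ∧
      G * (T * Y - algebraMap ℂ E (β i) * Y) ^ (Fintype.card ι - 3) =
        algebraMap ℂ E c * (t * y - algebraMap ℂ E (α j) * y) ^ (Fintype.card ι - 3) := by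
  have : Nonempty ι := ⟨i⟩
  have horders : ∀ z, IsHol t y z → z ≠ 0 → ∃ b c : ℕ, b + c + 3 ≤ Fintype.card ι ∧
      HasOrd (Fintype.card ι * b + c) (ψ z * differential t y ψ) := by
    intro z hz hz0
    have hz' : G * (G⁻¹ * z) = z := by rw [← mul_assoc, mul_inv_cancel₀ hG, one_mul]
    obtain ⟨b, c, hbc, hord⟩ := h'.exists_hasOrd_at_root hβ
      ((isHol_change hD).2 (hz'.symm ▸ hz)) (mul_ne_zero (inv_ne_zero hG) hz0) h1 h2
    refine ⟨b, c, hbc, ?_⟩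
    rwa [hD, ← mul_assoc, ← map_mul, mul_comm _ G, hz'] at hord
  have hzero : ∃ z, IsHol t y z ∧ HasOrd 0 (ψ z * differential t y ψ) := by
    refine ⟨G * Y ^ (Fintype.card ι - 3), ?_, ?_⟩
    · rw [← isHol_change hD]
      simpa using h'.isHol_pow hβ (by omega) 0 1
    · have h3 := (h2.pow (Fintype.card ι - 3)).mul
        (hasOrd_differential one_pos h2 (α := β) (i := i) (by simpa using h1))
      rw [map_mul, mul_comm (ψ G), mul_assoc, ← hD, map_pow]
      convert h3 using 1
      rw [Nat.cast_sub (by omega)]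
      push_cast
      ring
  rcases h.map_cases hα ψ with ⟨h3, h4⟩ | ⟨j, e, he, h3, h4⟩
  · exact absurd (h.exists_form_of_regular hα hn h3 h4 hzero horders) hform
  have he1 : e = 1 := by
    obtain ⟨z, hz, hz0⟩ := hzero
    have h5 := h.growth_of_isHol hα hz he.le (ordGE_x he h3 h4) h3.ordGE
    have h6 := hz0.le (h5.mul (hasOrd_differential he h3 h4).ordGE)
    ring_nf at h6
    omega
  subst he1
  rw [mul_one] at h4
  have hz1 : IsHol t y (G * (T * Y - algebraMap ℂ E (β i) * Y) ^ (Fintype.card ι - 3)) := by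
    rw [← isHol_change hD]
    simpa [sub_eq_add_neg] using h'.isHol_pow hβ (by omega) 1 (-β i)
  have hz2 : ∀ c : ℂ, IsHol t y
      (algebraMap ℂ E c * (t * y - algebraMap ℂ E (α j) * y) ^ (Fintype.card ι - 3)) := by
    intro c ψ
    have := h.isHol_pow hα (by omega) 1 (-α j)
    rw [map_mul, AlgHom.commutes, mul_assoc]
    refine OrdGE.const_mul ?_ c
    simpa [sub_eq_add_neg] using this ψ
  have ho1 := hasOrd_pow_at_root (by omega) h1 h2
  rw [hD, ← mul_assoc, ← map_mul, mul_comm _ G] at ho1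
  have ho2 := hasOrd_pow_at_root (by omega) h4 h3
  obtain ⟨c, hc⟩ := HasOrd.exists_sub_const_mul ho1.ordGE ho2
  have heq : G * (T * Y - algebraMap ℂ E (β i) * Y) ^ (Fintype.card ι - 3) =
      algebraMap ℂ E c * (t * y - algebraMap ℂ E (α j) * y) ^ (Fintype.card ι - 3) := by
    by_contra hne
    have hsub : IsHol t y (G * (T * Y - algebraMap ℂ E (β i) * Y) ^ (Fintype.card ι - 3) -
        algebraMap ℂ E c * (t * y - algebraMap ℂ E (α j) * y) ^ (Fintype.card ι - 3)) := by
      intro φ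
      rw [map_sub, sub_mul]
      exact (hz1 φ).sub (hz2 c φ)
    obtain ⟨b, k, hbk, hord⟩ := horders _ hsub (sub_ne_zero.2 hne)
    rw [map_sub, sub_mul, map_mul ψ (algebraMap ℂ E c), AlgHom.commutes, mul_assoc] at hord
    have h7 := hord.le hc
    have h8 : ((Fintype.card ι - 3 : ℕ) : ℤ) = b + (Fintype.card ι - 3 - b : ℕ) := by omega
    rw [h8] at h7
    have h9 : (k : ℤ) ≤ Fintype.card ι * (Fintype.card ι - 3 - b : ℕ) := by
      have : k ≤ Fintype.card ι - 3 - b := by omega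
      have h10 : (k : ℤ) ≤ (Fintype.card ι - 3 - b : ℕ) := by exact_mod_cast this
      nlinarith
    linarith
  refine ⟨j, c, ?_, h4, heq⟩
  rintro rfl
  rw [map_zero, zero_mul] at heq
  rw [heq, map_zero, zero_mul] at ho1
  exact ho1.ne_zero rfl

theorem exists_crossRatio (h : IsModel α t y) (hα : Function.Injective α) (h' : IsModel β T Y)
    (hβ : Function.Injective β) (hn : 5 ≤ Fintype.card ι)
    (hform : ¬ ∃ l m r s : ℂ, ∀ w, ∏ i, (w - α i) =
      (l * w + m) ^ Fintype.card ι - (r * w + s) ^ Fintype.card ι) :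
    ∃ σ : ι → ι, Function.Injective σ ∧ ∀ i j, i ≠ j → ∃ ρ : ℂ, ∀ k,
      (β k - β i) * (α (σ k) - α (σ j)) = ρ * ((α (σ k) - α (σ i)) * (β k - β j)) := by
  have : Nonempty ι := Fintype.card_pos_iff.1 (by omega)
  obtain ⟨G, hG, hD⟩ := h.exists_change h' hβ (by omega)
  have hplace := h'.exists_place_root hβ
  choose Ψ hΨ1 hΨ2 using hplace
  have hΨ1' : ∀ i, HasOrd (Fintype.card ι) (Ψ i T - algebraMap ℂ _ (β i)) := fun i ↦
    hΨ1 i ▸ hasOrd_single _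
  choose σ c hc hσ heq using fun i ↦
    h.root_of_root hα h' hβ hn hform hG hD (hΨ1' i) (hΨ2 i)
  have hy0 := h.y_ne_zero
  have hY0 := h'.y_ne_zero
  have hcr : ∀ i j, i ≠ j → σ i ≠ σ j ∧ ∃ ρ : ℂ, ∀ k,
      (β k - β i) * (α (σ k) - α (σ j)) = ρ * ((α (σ k) - α (σ i)) * (β k - β j)) := by
    intro i j hij
    have hTj : T - algebraMap ℂ E (β j) ≠ 0 := sub_ne_zero.2 (h'.ne_algebraMap _)
    have hTi : T - algebraMap ℂ E (β i) ≠ 0 := sub_ne_zero.2 (h'.ne_algebraMap _)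
    have hti : t - algebraMap ℂ E (α (σ i)) ≠ 0 := sub_ne_zero.2 (h.ne_algebraMap _)
    have htj : t - algebraMap ℂ E (α (σ j)) ≠ 0 := sub_ne_zero.2 (h.ne_algebraMap _)
    have hpow : ((T - algebraMap ℂ E (β i)) * (t - algebraMap ℂ E (α (σ j))) /
        ((t - algebraMap ℂ E (α (σ i))) * (T - algebraMap ℂ E (β j)))) ^ (Fintype.card ι - 3) =
        algebraMap ℂ E (c i / c j) := by
      have e1 := heq i
      have e2 := heq j
      have hcj : algebraMap ℂ E (c j) ≠ 0 := (map_ne_zero _).2 (hc j)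
      rw [← sub_mul, ← sub_mul, mul_pow, mul_pow] at e1 e2
      rw [div_pow, map_div₀, div_eq_div_iff (pow_ne_zero _ (mul_ne_zero hti hTj)) hcj, mul_pow,
        mul_pow]
      refine mul_right_cancel₀ (mul_ne_zero hG (mul_ne_zero (pow_ne_zero (Fintype.card ι - 3) hY0)
        (pow_ne_zero (Fintype.card ι - 3) hy0))) ?_
      linear_combination (t - algebraMap ℂ E (α (σ j))) ^ (Fintype.card ι - 3) *
        algebraMap ℂ E (c j) * y ^ (Fintype.card ι - 3) * e1 -
        (t - algebraMap ℂ E (α (σ i))) ^ (Fintype.card ι - 3) *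
        algebraMap ℂ E (c i) * y ^ (Fintype.card ι - 3) * e2
    obtain ⟨ρ, hρ⟩ := exists_algebraMap_of_pow_eq (by omega) hpow
    rw [div_eq_iff (mul_ne_zero hti hTj)] at hρ
    refine ⟨fun hσij ↦ ?_, ρ, fun k ↦ ?_⟩
    · rw [← hσij, mul_comm, mul_left_comm] at hρ
      have h1 := congrArg (Ψ i) (mul_left_cancel₀ hti hρ)
      simp only [map_mul, map_sub, AlgHom.commutes] at h1
      have h2 : OrdGE 1 (Ψ i T - algebraMap ℂ _ (β i)) := (hΨ1' i).ordGE.mono (by omega)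
      have h3 : ρ * (β i - β j) = 0 := by
        refine eq_zero_of_ordGE_algebraMap ?_
        convert h2.sub (h2.const_mul ρ) using 1
        simp only [map_sub, map_mul]
        linear_combination -h1
      rcases mul_eq_zero.1 h3 with rfl | h3
      · rw [map_zero, zero_mul] at hρ
        exact mul_ne_zero hti hTi (by rw [hρ, mul_zero])
      · exact hij (hβ (sub_eq_zero.1 h3))
    · have h1 := congrArg (Ψ k) hρ
      simp only [map_mul, map_sub, AlgHom.commutes] at h1
      set u := Ψ k T - algebraMap ℂ _ (β k) with hu
      set v := Ψ k t - algebraMap ℂ _ (α (σ k)) with hv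
      have hTk : Ψ k T = u + algebraMap ℂ _ (β k) := by rw [hu]; ring
      have htk : Ψ k t = v + algebraMap ℂ _ (α (σ k)) := by rw [hv]; ring
      have hu1 : OrdGE 1 u := (hΨ1' k).ordGE.mono (by omega)
      have hv1 : OrdGE 1 v := (hσ k).ordGE.mono (by omega)
      rw [← sub_eq_zero]
      refine eq_zero_of_ordGE_algebraMap ?_
      have hu0 : OrdGE 0 u := hu1.mono (by norm_num)
      have key : algebraMap ℂ (LaurentSeries ℂ) ((β k - β i) * (α (σ k) - α (σ j)) -
          ρ * ((α (σ k) - α (σ i)) * (β k - β j))) =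
          algebraMap ℂ _ (ρ * (α (σ k) - α (σ i))) * u - algebraMap ℂ _ (α (σ k) - α (σ j)) * u +
          (algebraMap ℂ _ (ρ * (β k - β j)) * v - algebraMap ℂ _ (β k - β i) * v) +
          (algebraMap ℂ _ ρ * (u * v) - u * v) := by
        rw [hTk, htk] at h1
        simp only [map_sub, map_mul]
        linear_combination h1
      rw [key]
      have huv : OrdGE 1 (u * v) := by simpa using hu0.mul hv1
      exact (((hu1.const_mul _).sub (hu1.const_mul _)).add
        ((hv1.const_mul _).sub (hv1.const_mul _))).add ((huv.const_mul _).sub huv)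
  exact ⟨σ, fun i j hσij ↦ by_contra fun hij ↦ (hcr i j hij).1 hσij, fun i j hij ↦ (hcr i j hij).2⟩

end IsModel

end ChangeOfModel

section LineSlopes

theorem primitiveRoot_three {w : ℂ} (hw : IsPrimitiveRoot w 3) :
    ‖w‖ = 1 ∧ w.im ≠ 0 ∧ 1 + w + w ^ 2 = 0 := by
  have h0 : 1 + w + w ^ 2 = 0 := by
    have := hw.geom_sum_eq_zero (by norm_num)
    simpa [Finset.sum_range_succ] using this
  refine ⟨hw.norm'_eq_one (by norm_num), fun h ↦ ?_, h0⟩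
  have h1 := congrArg Complex.re h0
  simp [pow_two, h] at h1
  nlinarith [sq_nonneg (w.re + 1 / 2)]

theorem eq_zero_of_form_eq_zero {w : ℂ} (hw : IsPrimitiveRoot w 3) {θ c : ℝ} (hθ : 0 < θ)
    (hc : 0 < c) (hcθ : c ≠ θ) {A D : ℝ} {B : ℂ}
    (h0 : ∀ i : Fin 3, A * Complex.normSq (-θ * w ^ (i : ℕ)) + (B * (-θ * w ^ (i : ℕ))).re + D = 0)
    (h1 : A * Complex.normSq (c * w) + (B * (c * w)).re + D = 0) : A = 0 ∧ B = 0 ∧ D = 0 := by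
  obtain ⟨hw1, hw2, hw3⟩ := primitiveRoot_three hw
  have hn : Complex.normSq w = 1 := by rw [Complex.normSq_eq_norm_sq, hw1, one_pow]
  have e0 := h0 0
  have e1 := h0 1
  have e2 := h0 2
  have hw4 : w ^ 2 = -1 - w := by linear_combination hw3
  have hn2 : Complex.normSq (-1 - w) = 1 := by rw [← hw4, map_pow, hn, one_pow]
  simp [map_mul, Complex.normSq_ofReal, hw4, hn, hn2] at e0 e1 e2 h1
  have hAD : A * (θ * θ) + D = 0 := by linear_combination (e0 + e1 + e2) / 3
  have hre : B.re = 0 := by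
    have : θ * B.re = 0 := by linear_combination hAD - e0
    exact (mul_eq_zero.1 this).resolve_left hθ.ne'
  have him : B.im = 0 := by
    rw [hre] at e1
    have : θ * w.im * B.im = 0 := by linear_combination e1 - hAD
    exact (mul_eq_zero.1 this).resolve_left (mul_ne_zero hθ.ne' hw2)
  rw [hre, him] at h1
  have hA : A * ((c - θ) * (c + θ)) = 0 := by linear_combination h1 - hAD
  have hA0 : A = 0 := (mul_eq_zero.1 hA).resolve_right
    (mul_ne_zero (sub_ne_zero.2 hcθ) (by positivity))
  refine ⟨hA0, Complex.ext hre him, ?_⟩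
  rw [hA0] at hAD
  linarith

theorem normSq_mul_add (l m z : ℂ) : Complex.normSq (l * z + m) =
    Complex.normSq l * Complex.normSq z + 2 * (l * star m * z).re + Complex.normSq m := by
  simp [Complex.normSq_apply]
  ring

theorem not_exists_form {ι : Type*} [Fintype ι] {α : ι → ℂ} {w : ℂ}
    (hw : IsPrimitiveRoot w 3) {θ c : ℝ} (hθ : 0 < θ) (hc : 0 < c) (hcθ : c ≠ θ)
    (h0 : ∀ i : Fin 3, ∃ k, α k = -θ * w ^ (i : ℕ)) (h1 : ∃ k, α k = c * w) :
    ¬ ∃ l m r s : ℂ, ∀ z, ∏ i, (z - α i) =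
      (l * z + m) ^ Fintype.card ι - (r * z + s) ^ Fintype.card ι := by
  rintro ⟨l, m, r, s, H⟩
  obtain ⟨k₁, hk₁⟩ := h1
  obtain ⟨k₀, hk₀⟩ := h0 0
  have hcard : Fintype.card ι ≠ 0 := (Fintype.card_pos_iff.2 ⟨k₁⟩).ne'
  have hroot : ∀ k, (l * α k + m) ^ Fintype.card ι - (r * α k + s) ^ Fintype.card ι = 0 :=
    fun k ↦ by
    rw [← H, Finset.prod_eq_zero_iff]
    exact ⟨k, Finset.mem_univ k, sub_self _⟩
  have hnonzero : ¬ ∀ z, (l * z + m) ^ Fintype.card ι - (r * z + s) ^ Fintype.card ι = 0 := by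
    intro hall
    obtain ⟨z, hz⟩ := (Set.finite_range α).infinite_compl.nonempty
    have h2 := hall z
    rw [← H, Finset.prod_eq_zero_iff] at h2
    obtain ⟨i, -, hi⟩ := h2
    exact hz ⟨i, (sub_eq_zero.1 hi).symm⟩
  have hnorm : ∀ k, (Complex.normSq l - Complex.normSq r) * Complex.normSq (α k) +
      ((2 * (l * star m - r * star s)) * α k).re + (Complex.normSq m - Complex.normSq s) = 0 := by
    intro k
    have h2 := congrArg norm (sub_eq_zero.1 (hroot k))
    rw [norm_pow, norm_pow, pow_left_inj₀ (norm_nonneg _) (norm_nonneg _) hcard] at h2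
    have h3 : Complex.normSq (l * α k + m) = Complex.normSq (r * α k + s) := by
      rw [Complex.normSq_eq_norm_sq, Complex.normSq_eq_norm_sq, h2]
    rw [normSq_mul_add, normSq_mul_add] at h3
    have h4 : ((2 * (l * star m - r * star s)) * α k).re =
        2 * (l * star m * α k).re - 2 * (r * star s * α k).re := by
      simp only [Complex.mul_re, Complex.sub_re, Complex.sub_im, Complex.mul_im, Complex.re_ofNat,
        Complex.im_ofNat]
      ring
    rw [h4]
    linarith
  obtain ⟨hA, hB, hD⟩ := eq_zero_of_form_eq_zero hw hθ hc hcθ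
    (fun i ↦ by obtain ⟨k, hk⟩ := h0 i; rw [← hk]; exact hnorm k) (by rw [← hk₁]; exact hnorm k₁)
  by_cases hl : l = 0
  · have hr : r = 0 := by
      rw [hl, map_zero, zero_sub, neg_eq_zero] at hA
      exact Complex.normSq_eq_zero.1 hA
    refine hnonzero fun z ↦ ?_
    have h2 := hroot k₁
    rw [hl, hr] at h2 ⊢
    simpa using h2
  · have hz0 : l * (-m / l) + m = 0 := by field_simp; ring
    have hz1 : r * (-m / l) + s = 0 := by
      rw [← Complex.normSq_eq_zero]
      have h3 : Complex.normSq (r * (-m / l) + s) = Complex.normSq (l * (-m / l) + m) := by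
        rw [normSq_mul_add, normSq_mul_add, ← sub_eq_zero, ← sub_eq_zero.1 hA, ← sub_eq_zero.1 hD]
        have h4 := congrArg (fun b ↦ (b * (-m / l)).re) hB
        simp only [zero_mul, Complex.zero_re] at h4
        have h5 : ((2 * (l * star m - r * star s)) * (-m / l)).re =
            2 * (l * star m * (-m / l)).re - 2 * (r * star s * (-m / l)).re := by
          simp only [Complex.mul_re, Complex.sub_re, Complex.sub_im, Complex.mul_im,
            Complex.re_ofNat, Complex.im_ofNat]
          ring
        linarith
      rw [h3, hz0, map_zero]
    set z₀ := -m / l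
    have hl1 : ∀ z, l * z + m = l * (z - z₀) := fun z ↦ by linear_combination hz0
    have hr1 : ∀ z, r * z + s = r * (z - z₀) := fun z ↦ by linear_combination hz1
    obtain ⟨k, hk⟩ : ∃ k, α k ≠ z₀ := by
      by_contra! hall
      have h3 := (hall k₁).trans (hall k₀).symm
      rw [hk₁, hk₀] at h3
      have h4 := congrArg Complex.im h3
      obtain ⟨-, hw2, -⟩ := primitiveRoot_three hw
      simp [hc.ne', hw2] at h4
    refine hnonzero fun z ↦ ?_
    have h2 := hroot k
    simp only [hl1, hr1, mul_pow] at h2 ⊢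
    rw [← sub_mul] at h2 ⊢
    rw [(mul_eq_zero.1 h2).resolve_right (pow_ne_zero _ (sub_ne_zero.2 hk)), zero_mul]

/-- A point is determined by three others and their cross ratio. -/
theorem eq_of_crossRatio {ι : Type*} {α β γ : ι → ℂ} (hα : Function.Injective α)
    {σ : ι → ι} (hσ : Function.Injective σ) {i j k l : ι} (hki : k ≠ i)
    (hlj : l ≠ j)
    (hβi : β i = γ i) (hβj : β j = γ j) (hβk : β k = γ k) (hβij : β i ≠ β j) (hβkj : β k ≠ β j)
    (hβ : ∃ ρ : ℂ, ∀ k,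
      (β k - β i) * (α (σ k) - α (σ j)) = ρ * ((α (σ k) - α (σ i)) * (β k - β j)))
    (hγ : ∃ ρ : ℂ, ∀ k,
      (γ k - γ i) * (α (σ k) - α (σ j)) = ρ * ((α (σ k) - α (σ i)) * (γ k - γ j))) :
    β l = γ l := by
  obtain ⟨ρ, hρ⟩ := hβ
  obtain ⟨ρ', hρ'⟩ := hγ
  have hne : ∀ {a b}, a ≠ b → α (σ a) - α (σ b) ≠ 0 := fun h ↦
    sub_ne_zero.2 fun h' ↦ h (hσ (hα h'))
  have h1 : ρ = ρ' := by
    have e1 := hρ k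
    have e2 := hρ' k
    rw [← hβi, ← hβj, ← hβk, e1] at e2
    exact mul_right_cancel₀ (mul_ne_zero (hne hki) (sub_ne_zero.2 hβkj)) e2
  subst h1
  have e1 := hρ l
  have e2 := hρ' l
  rw [← hβi, ← hβj] at e2
  have e3 : (β l - γ l) * ((α (σ l) - α (σ j)) - ρ * (α (σ l) - α (σ i))) = 0 := by
    linear_combination e1 - e2
  refine sub_eq_zero.1 ((mul_eq_zero.1 e3).resolve_right fun h0 ↦ ?_)
  have e4 : (β j - β i) * (α (σ l) - α (σ j)) = 0 := by
    linear_combination e1 - (β l - β j) * h0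
  exact mul_ne_zero (sub_ne_zero.2 hβij.symm) (hne hlj) e4

end LineSlopes

section PlaneModel

namespace CyclicCurve

variable {ι : Type} [Fintype ι] {α : ι → ℂ}

/-- The polynomial `W ^ n - ∏ i, (T - α i)` over `ℂ[T]`, where `n` is the number of indices. -/
noncomputable def cyclicPoly (α : ι → ℂ) : Polynomial (Polynomial ℂ) :=
  Polynomial.X ^ Fintype.card ι - Polynomial.C (∏ i, (Polynomial.X - Polynomial.C (α i)))

theorem cyclicPoly_monic [Nonempty ι] (α : ι → ℂ) : (cyclicPoly α).Monic :=
  Polynomial.monic_X_pow_sub_C _ Fintype.card_ne_zero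

theorem irreducible_cyclicPoly [Nonempty ι] (hα : Function.Injective α) :
    Irreducible (cyclicPoly α) := by
  classical
  obtain ⟨i0⟩ := ‹Nonempty ι›
  have hn : Fintype.card ι ≠ 0 := Fintype.card_ne_zero
  have hnat : (cyclicPoly α).natDegree = Fintype.card ι := Polynomial.natDegree_X_pow_sub_C
  have hmonic := cyclicPoly_monic α
  have hprime : Prime (Polynomial.X - Polynomial.C (α i0)) := Polynomial.prime_X_sub_C _
  have hP := (Ideal.span_singleton_prime hprime.ne_zero).2 hprime
  have hF := Finset.mul_prod_erase Finset.univ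
    (fun i ↦ (Polynomial.X - Polynomial.C (α i) : Polynomial ℂ)) (Finset.mem_univ i0)
  have hcoeff0 : (cyclicPoly α).coeff 0 = -∏ i, (Polynomial.X - Polynomial.C (α i)) := by
    rw [cyclicPoly, Polynomial.coeff_sub, Polynomial.coeff_X_pow, if_neg hn.symm,
      Polynomial.coeff_C_zero, zero_sub]
  refine Polynomial.irreducible_of_eisenstein_criterion hP ?_ ?_ ?_ ?_ hmonic.isPrimitive
  · rw [hmonic.leadingCoeff]
    exact (Ideal.ne_top_iff_one _).1 hP.ne_top
  · intro k hk
    rw [Polynomial.degree_eq_natDegree hmonic.ne_zero, hnat, Nat.cast_lt] at hk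
    rw [Ideal.mem_span_singleton]
    rcases eq_or_ne k 0 with rfl | hk0
    · rw [hcoeff0, ← hF]
      exact (Dvd.intro _ rfl).neg_right
    · rw [cyclicPoly, Polynomial.coeff_sub, Polynomial.coeff_X_pow, if_neg hk.ne,
        Polynomial.coeff_C_of_ne_zero hk0, sub_zero]
      exact dvd_zero _
  · rw [Polynomial.degree_eq_natDegree hmonic.ne_zero, hnat]
    exact_mod_cast Nat.pos_of_ne_zero hn
  · rw [hcoeff0, ← hF, Ideal.span_singleton_pow, Ideal.mem_span_singleton, dvd_neg, sq]
    intro h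
    have h1 := (mul_dvd_mul_iff_left hprime.ne_zero).1 h
    rw [Polynomial.dvd_iff_isRoot, Polynomial.IsRoot, Polynomial.eval_prod,
      Finset.prod_eq_zero_iff] at h1
    obtain ⟨i, hi, h2⟩ := h1
    rw [Polynomial.eval_sub, Polynomial.eval_X, Polynomial.eval_C, sub_eq_zero] at h2
    exact (Finset.mem_erase.1 hi).1 (hα h2).symm

theorem aeval_injective_of_ne {K : Type*} [Field K] [Algebra ℂ K] {τ : K}
    (hτ : ∀ c, τ ≠ algebraMap ℂ K c) :
    Function.Injective (Polynomial.aeval τ : Polynomial ℂ →ₐ[ℂ] K) := by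
  refine transcendental_iff_injective.1 fun halg ↦ ?_
  have hint := halg.isIntegral
  have h1 := IsAlgClosed.degree_eq_one_of_irreducible ℂ (minpoly.irreducible hint)
  obtain ⟨ρ, hρ⟩ := minpoly.mem_range_of_degree_eq_one ℂ τ h1
  exact hτ ρ hρ.symm

theorem cyclicPoly_dvd [Nonempty ι] (hα : Function.Injective α) {K : Type*} [Field K] [Algebra ℂ K]
    {τ ω : K} (hτ : ∀ c, τ ≠ algebraMap ℂ K c)
    (hω : ω ^ Fintype.card ι = ∏ i, (τ - algebraMap ℂ K (α i)))
    {q : Polynomial (Polynomial ℂ)}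
    (hq : q.eval₂ ((Polynomial.aeval τ : Polynomial ℂ →ₐ[ℂ] K) : Polynomial ℂ →+* K) ω = 0) :
    cyclicPoly α ∣ q := by
  let _ : Algebra (Polynomial ℂ) K :=
    ((Polynomial.aeval τ : Polynomial ℂ →ₐ[ℂ] K) : Polynomial ℂ →+* K).toAlgebra
  have hinj : Function.Injective (algebraMap (Polynomial ℂ) K) := aeval_injective_of_ne hτ
  have : FaithfulSMul (Polynomial ℂ) K := (faithfulSMul_iff_algebraMap_injective _ _).2 hinj
  have hroot : Polynomial.aeval ω (cyclicPoly α) = 0 := by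
    rw [cyclicPoly, map_sub, map_pow, Polynomial.aeval_X, Polynomial.aeval_C, hω, sub_eq_zero]
    change _ = (Polynomial.aeval τ : Polynomial ℂ →ₐ[ℂ] K) _
    simp [map_prod]
  have hint : IsIntegral (Polynomial ℂ) ω := ⟨_, cyclicPoly_monic α, hroot⟩
  have h1 := minpoly.isIntegrallyClosed_dvd hint hroot
  have h2 : minpoly (Polynomial ℂ) ω ∣ q := minpoly.isIntegrallyClosed_dvd hint hq
  exact (((irreducible_cyclicPoly hα).dvd_iff.1 h1).resolve_left
    (minpoly.not_isUnit _ _)).dvd.trans h2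

end CyclicCurve

end PlaneModel

section PlaneModelDvd

namespace CyclicCurve

variable {ι : Type} [Fintype ι] {α : ι → ℂ}

/-- The polynomial `∏ i, (x - α i * y) - L`. -/
noncomputable def planePoly (α : ι → ℂ) (L : ℂ) : MvPolynomial (Fin 2) ℂ :=
  ∏ i, (MvPolynomial.X 0 - MvPolynomial.C (α i) * MvPolynomial.X 1) - MvPolynomial.C L

/-- Evaluation of a polynomial in `T` and `W` at a pair of elements of `K`. -/
noncomputable def bieval {K : Type} [Field K] [Algebra ℂ K] (τ ω : K) :
    Polynomial (Polynomial ℂ) →+* K :=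
  Polynomial.eval₂RingHom ((Polynomial.aeval τ : Polynomial ℂ →ₐ[ℂ] K) : Polynomial ℂ →+* K) ω

theorem bieval_C {K : Type} [Field K] [Algebra ℂ K] (τ ω : K) (p : Polynomial ℂ) :
    bieval τ ω (Polynomial.C p) = Polynomial.aeval τ p := by
  simp [bieval]

theorem bieval_X {K : Type} [Field K] [Algebra ℂ K] (τ ω : K) :
    bieval τ ω Polynomial.X = ω := by
  simp [bieval]

theorem exists_bieval_eq (L₀ : ℂ) (g : MvPolynomial (Fin 2) ℂ) :
    ∃ (N : ℕ) (q : Polynomial (Polynomial ℂ)), ∀ (K : Type) [Field K] [Algebra ℂ K] (τ ω : K),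
      ω ≠ 0 → bieval τ ω q = ω ^ N * MvPolynomial.aeval
        ![algebraMap ℂ K L₀ * τ / ω, algebraMap ℂ K L₀ / ω] g := by
  induction g using MvPolynomial.induction_on with
  | C a =>
    refine ⟨0, Polynomial.C (Polynomial.C a), fun K _ _ τ ω hω ↦ ?_⟩
    rw [bieval_C, Polynomial.aeval_C, pow_zero, one_mul, MvPolynomial.aeval_C]
  | add f g hf hg =>
    obtain ⟨N, q, hq⟩ := hf
    obtain ⟨M, r, hr⟩ := hg
    refine ⟨N + M, Polynomial.X ^ M * q + Polynomial.X ^ N * r, fun K _ _ τ ω hω ↦ ?_⟩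
    rw [map_add, map_mul, map_mul, map_pow, map_pow, bieval_X, hq K τ ω hω, hr K τ ω hω, map_add]
    ring
  | mul_X f i hf =>
    obtain ⟨N, q, hq⟩ := hf
    have hX : ∃ r : Polynomial (Polynomial ℂ), ∀ (K : Type) [Field K] [Algebra ℂ K] (τ ω : K),
        ω ≠ 0 → bieval τ ω r = ω * MvPolynomial.aeval
          ![algebraMap ℂ K L₀ * τ / ω, algebraMap ℂ K L₀ / ω]
            (MvPolynomial.X i : MvPolynomial (Fin 2) ℂ) := by
      fin_cases i
      · refine ⟨Polynomial.C (Polynomial.C L₀ * Polynomial.X), fun K _ _ τ ω hω ↦ ?_⟩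
        rw [bieval_C, map_mul, Polynomial.aeval_C, Polynomial.aeval_X, MvPolynomial.aeval_X]
        simp [mul_div_cancel₀ _ hω]
      · refine ⟨Polynomial.C (Polynomial.C L₀), fun K _ _ τ ω hω ↦ ?_⟩
        rw [bieval_C, Polynomial.aeval_C, MvPolynomial.aeval_X]
        simp [mul_div_cancel₀ _ hω]
    obtain ⟨r, hr⟩ := hX
    refine ⟨N + 1, q * r, fun K _ _ τ ω hω ↦ ?_⟩
    rw [map_mul, hq K τ ω hω, hr K τ ω hω, map_mul]
    ring

/-- The elements of `K` that become elements of the subalgebra `B` after multiplication by a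
power of `y`. -/
def powDenom {K : Type} [Field K] [Algebra ℂ K] (B : Subalgebra ℂ K) {y : K} (hy : y ∈ B) :
    Subalgebra ℂ K where
  carrier := {z | ∃ k : ℕ, z * y ^ k ∈ B}
  mul_mem' := by
    rintro u v ⟨k, hk⟩ ⟨l, hl⟩
    refine ⟨k + l, ?_⟩
    rw [pow_add, mul_mul_mul_comm]
    exact B.mul_mem hk hl
  add_mem' := by
    rintro u v ⟨k, hk⟩ ⟨l, hl⟩
    refine ⟨k + l, ?_⟩
    have : (u + v) * y ^ (k + l) = u * y ^ k * y ^ l + v * y ^ l * y ^ k := by ring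
    rw [this]
    exact B.add_mem (B.mul_mem hk (B.pow_mem hy l)) (B.mul_mem hl (B.pow_mem hy k))
  algebraMap_mem' c := ⟨0, by simp [B.algebraMap_mem c]⟩

theorem bieval_mem {K : Type} [Field K] [Algebra ℂ K] (B : Subalgebra ℂ K) {τ ω : K} (hτ : τ ∈ B)
    (hω : ω ∈ B) (q : Polynomial (Polynomial ℂ)) : bieval τ ω q ∈ B := by
  rw [bieval, Polynomial.coe_eval₂RingHom, Polynomial.eval₂_eq_sum_range]
  refine B.sum_mem fun k _ ↦ B.mul_mem ?_ (B.pow_mem hω k)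
  change Polynomial.aeval τ (q.coeff k) ∈ B
  rw [Polynomial.aeval_eq_sum_range]
  exact B.sum_mem fun k _ ↦ B.smul_mem (B.pow_mem hτ k) _

theorem not_X_dvd_planePoly [Nonempty ι] (α : ι → ℂ) {L : ℂ} (hL : L ≠ 0) :
    ¬ (MvPolynomial.X 1 : MvPolynomial (Fin 2) ℂ) ∣ planePoly α L := by
  rintro ⟨s, hs⟩
  have h := congrArg (MvPolynomial.eval (0 : Fin 2 → ℂ)) hs
  simp [planePoly, hL, map_prod] at h

theorem planePoly_dvd_of_X_pow_mul [Nonempty ι] (α : ι → ℂ) {L : ℂ} (hL : L ≠ 0) {M : ℕ}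
    {g : MvPolynomial (Fin 2) ℂ} (h : planePoly α L ∣ MvPolynomial.X 1 ^ M * g) :
    planePoly α L ∣ g := by
  have hX : Irreducible (MvPolynomial.X 1 : MvPolynomial (Fin 2) ℂ) :=
    (MvPolynomial.X_prime (R := ℂ) (i := (1 : Fin 2))).irreducible
  have h1 := (hX.isRelPrime_iff_not_dvd.2 (not_X_dvd_planePoly α hL)).symm
  exact (h1.pow_right (n := M)).dvd_of_dvd_mul_left h

theorem bieval_cyclicPoly {K : Type} [Field K] [Algebra ℂ K] (α : ι → ℂ) {x y : K} (hy : y ≠ 0)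
    (l : K) : bieval (x / y) (l / y) (cyclicPoly α) * y ^ Fintype.card ι =
      l ^ Fintype.card ι - ∏ i, (x - algebraMap ℂ K (α i) * y) := by
  have h1 : ∏ i, (x - algebraMap ℂ K (α i) * y) =
      (∏ i, (x / y - algebraMap ℂ K (α i))) * y ^ Fintype.card ι := by
    rw [Fintype.card, ← Finset.prod_const, ← Finset.prod_mul_distrib]
    refine Finset.prod_congr rfl fun i _ ↦ ?_
    rw [sub_mul, div_mul_cancel₀ _ hy]
  have h2 : Polynomial.aeval (x / y) (∏ i, (Polynomial.X - Polynomial.C (α i))) =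
      ∏ i, (x / y - algebraMap ℂ K (α i)) := by
    simp [map_prod]
  rw [cyclicPoly, map_sub, map_pow, bieval_X, bieval_C, h2, h1, sub_mul, ← mul_pow,
    div_mul_cancel₀ _ hy]

theorem aeval_planePoly {K : Type} [CommRing K] [Algebra ℂ K] (α : ι → ℂ) (L : ℂ) (x y : K) :
    MvPolynomial.aeval ![x, y] (planePoly α L) =
      ∏ i, (x - algebraMap ℂ K (α i) * y) - algebraMap ℂ K L := by
  simp [planePoly, map_prod]

theorem planePoly_dvd_of_bieval [Nonempty ι] {L L₀ : ℂ} (hL : L₀ ^ Fintype.card ι = L)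
    (hL0 : L ≠ 0) {g : MvPolynomial (Fin 2) ℂ} {Q : Type} [Field Q] [Algebra ℂ Q]
    {x y : Q} (hinj : Function.Injective (MvPolynomial.aeval ![x, y] : _ →ₐ[ℂ] Q)) (hy : y ≠ 0)
    {N : ℕ} {s : Polynomial (Polynomial ℂ)}
    (h : bieval (x / y) (algebraMap ℂ Q L₀ / y) (cyclicPoly α * s) =
      (algebraMap ℂ Q L₀ / y) ^ N * MvPolynomial.aeval
        ![algebraMap ℂ Q L₀ * (x / y) / (algebraMap ℂ Q L₀ / y),
          algebraMap ℂ Q L₀ / (algebraMap ℂ Q L₀ / y)] g) :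
    planePoly α L ∣ g := by
  have hn : Fintype.card ι ≠ 0 := Fintype.card_ne_zero
  have hL₀ : L₀ ≠ 0 := fun h ↦ hL0 (by rw [← hL, h, zero_pow hn])
  have hl : algebraMap ℂ Q L₀ ≠ 0 := (map_ne_zero _).2 hL₀
  rw [mul_div_assoc', div_div_div_cancel_right₀ hy, mul_div_cancel_left₀ _ hl,
    div_div_cancel₀ hl] at h
  let φ : MvPolynomial (Fin 2) ℂ →ₐ[ℂ] Q := MvPolynomial.aeval ![x, y]
  have hx1 : φ (MvPolynomial.X 0) = x := by simp [φ]
  have hy1 : φ (MvPolynomial.X 1) = y := by simp [φ]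
  obtain ⟨k, S, hS⟩ := bieval_mem (powDenom φ.range (y := y) ⟨_, hy1⟩)
    (τ := x / y) (ω := algebraMap ℂ Q L₀ / y)
    ⟨1, MvPolynomial.X 0, by rw [pow_one, div_mul_cancel₀ _ hy]; exact hx1⟩
    ⟨1, MvPolynomial.C L₀, by
      rw [pow_one, div_mul_cancel₀ _ hy]
      exact MvPolynomial.algHom_C φ L₀⟩ s
  have hS' : bieval (x / y) (algebraMap ℂ Q L₀ / y) s * y ^ k = φ S := hS.symm
  have hc := bieval_cyclicPoly α (x := x) hy (algebraMap ℂ Q L₀)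
  have hG := aeval_planePoly α L x y
  rw [← map_pow, hL] at hc
  rw [map_mul, div_pow] at h
  refine planePoly_dvd_of_X_pow_mul α hL0 (M := Fintype.card ι + k) ?_
  refine Dvd.intro (-S * MvPolynomial.X 1 ^ N * MvPolynomial.C (L₀ ^ N)⁻¹) (hinj ?_)
  change φ _ = φ _
  change φ (planePoly α L) = _ at hG
  change _ = _ * φ g at h
  have hC : φ (MvPolynomial.C (L₀ ^ N)⁻¹) * algebraMap ℂ Q L₀ ^ N = 1 := by
    rw [MvPolynomial.algHom_C, ← map_pow, ← map_mul, inv_mul_cancel₀ (pow_ne_zero _ hL₀), map_one]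
  have h' : bieval (x / y) (algebraMap ℂ Q L₀ / y) (cyclicPoly α) *
      bieval (x / y) (algebraMap ℂ Q L₀ / y) s * y ^ N = algebraMap ℂ Q L₀ ^ N * φ g := by
    rw [h]
    field_simp
  simp only [map_mul, map_neg, map_pow, hy1]
  rw [hG, pow_add]
  generalize bieval (x / y) (algebraMap ℂ Q L₀ / y) (cyclicPoly α) = u at *
  generalize bieval (x / y) (algebraMap ℂ Q L₀ / y) s = v at *
  rw [← hS', show ∏ i, (x - algebraMap ℂ Q (α i) * y) - algebraMap ℂ Q L =
    -(u * y ^ Fintype.card ι) by rw [hc]; ring]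
  linear_combination (y ^ Fintype.card ι * y ^ k * φ (MvPolynomial.C (L₀ ^ N)⁻¹)) * h' +
    y ^ Fintype.card ι * y ^ k * φ g * hC

theorem planePoly_dvd [Nonempty ι] (hα : Function.Injective α) {L L₀ : ℂ}
    (hL : L₀ ^ Fintype.card ι = L) (hL0 : L ≠ 0) {K : Type} [Field K] [Algebra ℂ K] {τ υ : K}
    (hτ : ∀ c, τ ≠ algebraMap ℂ K c)
    (hυ : υ ^ Fintype.card ι * ∏ i, (τ - algebraMap ℂ K (α i)) = 1)
    {g : MvPolynomial (Fin 2) ℂ}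
    (hg : MvPolynomial.aeval ![algebraMap ℂ K L₀ * τ * υ, algebraMap ℂ K L₀ * υ] g = 0) :
    planePoly α L ∣ g := by
  have hn : Fintype.card ι ≠ 0 := Fintype.card_ne_zero
  have hL₀ : L₀ ≠ 0 := fun h ↦ hL0 (by rw [← hL, h, zero_pow hn])
  have hυ0 : υ ≠ 0 := fun h ↦ by simp [h, hn] at hυ
  obtain ⟨N, q, hq⟩ := exists_bieval_eq L₀ g
  have h1 := hq K τ υ⁻¹ (inv_ne_zero hυ0)
  rw [div_inv_eq_mul, div_inv_eq_mul, hg, mul_zero] at h1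
  obtain ⟨s, rfl⟩ := cyclicPoly_dvd hα hτ (ω := υ⁻¹)
    (by rw [inv_pow]; exact (eq_inv_of_mul_eq_one_right hυ).symm) h1
  have hinj := IsFractionRing.injective (MvPolynomial (Fin 2) ℂ)
    (FractionRing (MvPolynomial (Fin 2) ℂ))
  have hal : MvPolynomial.aeval ![algebraMap (MvPolynomial (Fin 2) ℂ)
      (FractionRing (MvPolynomial (Fin 2) ℂ)) (MvPolynomial.X 0),
      algebraMap (MvPolynomial (Fin 2) ℂ) (FractionRing (MvPolynomial (Fin 2) ℂ))
        (MvPolynomial.X 1)] =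
      IsScalarTower.toAlgHom ℂ (MvPolynomial (Fin 2) ℂ)
        (FractionRing (MvPolynomial (Fin 2) ℂ)) := by
    ext i
    fin_cases i <;> simp
  have hy : algebraMap (MvPolynomial (Fin 2) ℂ) (FractionRing (MvPolynomial (Fin 2) ℂ))
      (MvPolynomial.X 1) ≠ 0 := (map_ne_zero_iff _ hinj).2 (MvPolynomial.X_ne_zero 1)
  have hl : algebraMap ℂ (FractionRing (MvPolynomial (Fin 2) ℂ)) L₀ ≠ 0 := (map_ne_zero _).2 hL₀
  exact planePoly_dvd_of_bieval (α := α) hL hL0 (N := N) (s := s) (by rw [hal]; exact hinj) hy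
    (hq _ _ _ (div_ne_zero hl hy))

end CyclicCurve

end PlaneModelDvd

section PlaneModelFunctionField

namespace CyclicCurve

variable {ι : Type} [Fintype ι] {α : ι → ℂ}

theorem prod_mul_sub {K : Type} [Field K] [Algebra ℂ K] (α : ι → ℂ) (L l τ υ : K)
    (hl : l ^ Fintype.card ι = L) :
    ∏ i, (l * τ * υ - algebraMap ℂ K (α i) * (l * υ)) =
      L * (υ ^ Fintype.card ι * ∏ i, (τ - algebraMap ℂ K (α i))) := by
  rw [← hl, ← mul_assoc, ← mul_pow, Fintype.card, ← Finset.prod_const, ← Finset.prod_mul_distrib]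
  exact Finset.prod_congr rfl fun i _ ↦ by ring

theorem aeval_planePoly_eq_zero {L L₀ : ℂ} (hL : L₀ ^ Fintype.card ι = L)
    {K : Type} [Field K] [Algebra ℂ K] {τ υ : K}
    (hυ : υ ^ Fintype.card ι * ∏ i, (τ - algebraMap ℂ K (α i)) = 1) :
    MvPolynomial.aeval ![algebraMap ℂ K L₀ * τ * υ, algebraMap ℂ K L₀ * υ]
      (planePoly α L) = 0 := by
  rw [aeval_planePoly, prod_mul_sub α (algebraMap ℂ K L) (algebraMap ℂ K L₀) τ υ
    (by rw [← map_pow, hL]), hυ, mul_one, sub_self]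

/-- The specialization of the coordinate ring of `planePoly α L` at a point. -/
noncomputable def specialize {L L₀ : ℂ} (hL : L₀ ^ Fintype.card ι = L)
    {K : Type} [Field K] [Algebra ℂ K] {τ υ : K}
    (hυ : υ ^ Fintype.card ι * ∏ i, (τ - algebraMap ℂ K (α i)) = 1) :
    (MvPolynomial (Fin 2) ℂ ⧸ Ideal.span {planePoly α L}) →ₐ[ℂ] K :=
  Ideal.Quotient.liftₐ _
    (MvPolynomial.aeval ![algebraMap ℂ K L₀ * τ * υ, algebraMap ℂ K L₀ * υ]) (by
      intro a ha
      obtain ⟨b, rfl⟩ := Ideal.mem_span_singleton.1 ha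
      rw [map_mul, aeval_planePoly_eq_zero hL hυ, zero_mul])

theorem specialize_mk {L L₀ : ℂ} (hL : L₀ ^ Fintype.card ι = L)
    {K : Type} [Field K] [Algebra ℂ K] {τ υ : K}
    (hυ : υ ^ Fintype.card ι * ∏ i, (τ - algebraMap ℂ K (α i)) = 1) (g : MvPolynomial (Fin 2) ℂ) :
    specialize hL hυ (Ideal.Quotient.mk _ g) =
      MvPolynomial.aeval ![algebraMap ℂ K L₀ * τ * υ, algebraMap ℂ K L₀ * υ] g :=
  rfl

theorem specialize_injective [Nonempty ι] (hα : Function.Injective α) {L L₀ : ℂ}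
    (hL : L₀ ^ Fintype.card ι = L) (hL0 : L ≠ 0)
    {K : Type} [Field K] [Algebra ℂ K] {τ υ : K} (hτ : ∀ c, τ ≠ algebraMap ℂ K c)
    (hυ : υ ^ Fintype.card ι * ∏ i, (τ - algebraMap ℂ K (α i)) = 1) :
    Function.Injective (specialize (L₀ := L₀) hL hυ) := by
  refine (injective_iff_map_eq_zero _).2 fun z hz ↦ ?_
  obtain ⟨g, rfl⟩ := Ideal.Quotient.mk_surjective z
  rw [specialize_mk] at hz
  rw [Ideal.Quotient.eq_zero_iff_mem, Ideal.mem_span_singleton]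
  exact planePoly_dvd hα hL hL0 hτ hυ hz

theorem isDomain_quotient_planePoly [Nonempty ι] (hα : Function.Injective α) {L : ℂ} (hL0 : L ≠ 0) :
    IsDomain (MvPolynomial (Fin 2) ℂ ⧸ Ideal.span {planePoly α L}) := by
  obtain ⟨L₀, hL⟩ := IsAlgClosed.exists_pow_nat_eq L (Fintype.card_pos (α := ι))
  have hτ := hasOrd_single (-1)
  obtain ⟨υ, -, hυ⟩ := exists_hasOrd_root Fintype.card_ne_zero
    (hasOrd_prod_sub_pole (α := α) (by norm_num) hτ)
  have hne : ∀ c, HahnSeries.single (-1 : ℤ) (1 : ℂ) ≠ algebraMap ℂ (LaurentSeries ℂ) c :=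
    fun c hc ↦ absurd (hτ.le (hc ▸ ordGE_algebraMap c)) (by norm_num)
  exact (specialize_injective hα hL hL0 hne hυ).isDomain
    ((specialize hL hυ : _ →ₐ[ℂ] LaurentSeries ℂ) : _ →+* LaurentSeries ℂ)

theorem exists_isModel [Nonempty ι] (hα : Function.Injective α) {L : ℂ} (hL0 : L ≠ 0)
    [IsDomain (MvPolynomial (Fin 2) ℂ ⧸ Ideal.span {planePoly α L})]
    {E : Type} [Field E] [Algebra (MvPolynomial (Fin 2) ℂ ⧸ Ideal.span {planePoly α L}) E]
    [IsFractionRing (MvPolynomial (Fin 2) ℂ ⧸ Ideal.span {planePoly α L}) E] [Algebra ℂ E]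
    [IsScalarTower ℂ (MvPolynomial (Fin 2) ℂ ⧸ Ideal.span {planePoly α L}) E] :
    ∃ t y : E, IsModel α t y := by
  obtain ⟨L₀, hL⟩ := IsAlgClosed.exists_pow_nat_eq L (Fintype.card_pos (α := ι))
  have hn : Fintype.card ι ≠ 0 := Fintype.card_ne_zero
  have hL₀ : L₀ ≠ 0 := fun h ↦ hL0 (by rw [← hL, h, zero_pow hn])
  let A := MvPolynomial (Fin 2) ℂ ⧸ Ideal.span {planePoly α L}
  have hinj := IsFractionRing.injective A E
  let φ : MvPolynomial (Fin 2) ℂ →ₐ[ℂ] E :=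
    (IsScalarTower.toAlgHom ℂ A E).comp (Ideal.Quotient.mkₐ ℂ _)
  have hφ : ∀ g, φ g = 0 ↔ planePoly α L ∣ g := fun g ↦ by
    change algebraMap A E (Ideal.Quotient.mk _ g) = 0 ↔ _
    rw [map_eq_zero_iff _ hinj, Ideal.Quotient.eq_zero_iff_mem, Ideal.mem_span_singleton]
  obtain ⟨x, hx⟩ : ∃ x, φ (MvPolynomial.X 0) = x := ⟨_, rfl⟩
  obtain ⟨y, hy⟩ : ∃ y, φ (MvPolynomial.X 1) = y := ⟨_, rfl⟩
  obtain ⟨l, hl⟩ : ∃ l, algebraMap ℂ E L₀ = l := ⟨_, rfl⟩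
  have hφa : φ = MvPolynomial.aeval ![x, y] := by
    ext i
    fin_cases i
    · simp [← hx]
    · simp [← hy]
  have hG : φ (planePoly α L) = 0 := (hφ _).2 dvd_rfl
  have hy0 : y ≠ 0 := by
    intro h
    obtain ⟨s, hs⟩ := (hφ _).1 (hy.trans h)
    obtain ⟨τ, hτ⟩ := (Set.finite_range α).exists_notMem
    have hne : ∏ i, (τ - algebraMap ℂ ℂ (α i)) ≠ 0 :=
      Finset.prod_ne_zero_iff.2 fun i _ h ↦ hτ ⟨i, (sub_eq_zero.1 h).symm⟩
    obtain ⟨υ, hυ⟩ := IsAlgClosed.exists_pow_nat_eq (∏ i, (τ - algebraMap ℂ ℂ (α i)))⁻¹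
      (Fintype.card_pos (α := ι))
    have hυ' : υ ^ Fintype.card ι * ∏ i, (τ - algebraMap ℂ ℂ (α i)) = 1 := by
      rw [hυ, inv_mul_cancel₀ hne]
    have hυ0 : υ ≠ 0 := fun h ↦ by simp [h, hn] at hυ'
    have h1 := congrArg (MvPolynomial.aeval ![algebraMap ℂ ℂ L₀ * τ * υ, algebraMap ℂ ℂ L₀ * υ]) hs
    rw [map_mul, aeval_planePoly_eq_zero hL hυ', zero_mul] at h1
    simp [hL₀, hυ0] at h1
  have hl0 : l ≠ 0 := hl ▸ (map_ne_zero _).2 hL₀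
  have hll : l ^ Fintype.card ι = algebraMap ℂ E L := by rw [← hl, ← map_pow, hL]
  have hxe : x = l * (x / y) * (y / l) := by field_simp
  have hye : y = l * (y / l) := by field_simp
  refine ⟨x / y, y / l, ?_, ?_, ?_⟩
  · rw [hφa, aeval_planePoly, sub_eq_zero] at hG
    rw [hxe] at hG
    conv_lhs at hG =>
      enter [2, i, 2, 2]
      rw [hye]
    rw [prod_mul_sub α _ l (x / y) (y / l) hll] at hG
    refine mul_left_cancel₀ ((map_ne_zero (algebraMap ℂ E)).2 hL0) (hG.trans (mul_one _).symm)
  · rw [eq_top_iff]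
    rintro z -
    have hlm : l ∈ IntermediateField.adjoin ℂ {x / y, y / l} := hl ▸ algebraMap_mem _ _
    have hym : y ∈ IntermediateField.adjoin ℂ {x / y, y / l} := by
      have := mul_mem hlm (IntermediateField.subset_adjoin ℂ {x / y, y / l}
        (by simp : y / l ∈ ({x / y, y / l} : Set E)))
      rwa [← hye] at this
    have hxm : x ∈ IntermediateField.adjoin ℂ {x / y, y / l} := by
      have := mul_mem (IntermediateField.subset_adjoin ℂ {x / y, y / l}
        (by simp : x / y ∈ ({x / y, y / l} : Set E))) hym
      rwa [div_mul_cancel₀ _ hy0] at this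
    have hm : ∀ g, φ g ∈ IntermediateField.adjoin ℂ {x / y, y / l} := fun g ↦ by
      induction g using MvPolynomial.induction_on with
      | C a =>
        rw [MvPolynomial.algHom_C]
        exact algebraMap_mem _ _
      | add f g hf hg => rw [map_add]; exact add_mem hf hg
      | mul_X f i hf =>
        rw [map_mul]
        refine mul_mem hf ?_
        fin_cases i
        · exact hx ▸ hxm
        · exact hy ▸ hym
    obtain ⟨a, b, -, rfl⟩ := IsFractionRing.div_surjective (A := A) z
    obtain ⟨f, rfl⟩ := Ideal.Quotient.mk_surjective a
    obtain ⟨g, rfl⟩ := Ideal.Quotient.mk_surjective b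
    exact div_mem (hm f) (hm g)
  · intro τ υ hτ hυ
    have hi := specialize_injective hα hL hL0 hτ hυ
    let ψ : E →ₐ[ℂ] LaurentSeries ℂ := IsFractionRing.liftAlgHom hi
    have hψ : ∀ g, ψ (φ g) =
        MvPolynomial.aeval ![algebraMap ℂ _ L₀ * τ * υ, algebraMap ℂ _ L₀ * υ] g := fun g ↦
      IsFractionRing.lift_algebraMap (K := E) hi (Ideal.Quotient.mk _ g)
    have hψx : ψ x = algebraMap ℂ _ L₀ * τ * υ := by rw [← hx, hψ]; simp
    have hψy : ψ y = algebraMap ℂ _ L₀ * υ := by rw [← hy, hψ]; simp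
    have hψl : ψ l = algebraMap ℂ _ L₀ := by rw [← hl, AlgHom.commutes]
    have hL1 : algebraMap ℂ (LaurentSeries ℂ) L₀ ≠ 0 := (map_ne_zero _).2 hL₀
    have hυ0 : υ ≠ 0 := fun h ↦ by simp [h, hn] at hυ
    refine ⟨ψ, ?_, ?_⟩
    · rw [map_div₀, hψx, hψy]
      field_simp
    · rw [map_div₀, hψl, hψy]
      field_simp

end CyclicCurve

end PlaneModelFunctionField

section IsomorphismClasses

namespace CyclicCurve

theorem exists_crossRatio {ι : Type} [Fintype ι] {α β : ι → ℂ} (hα : Function.Injective α)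
    (hβ : Function.Injective β) {L M : ℂ} (hL : L ≠ 0) (hM : M ≠ 0) (hn : 5 ≤ Fintype.card ι)
    (hform : ¬ ∃ l m r s : ℂ, ∀ w, ∏ i, (w - α i) =
      (l * w + m) ^ Fintype.card ι - (r * w + s) ^ Fintype.card ι)
    (h : CurvesIsomorphic (planePoly α L) (planePoly β M)) :
    ∃ σ : ι → ι, Function.Injective σ ∧ ∀ i j, i ≠ j → ∃ ρ : ℂ, ∀ k,
      (β k - β i) * (α (σ k) - α (σ j)) = ρ * ((α (σ k) - α (σ i)) * (β k - β j)) := by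
  have : Nonempty ι := Fintype.card_pos_iff.1 (by omega)
  have := isDomain_quotient_planePoly hα hL
  have := isDomain_quotient_planePoly hβ hM
  obtain ⟨e⟩ := h
  obtain ⟨t, y, hty⟩ := exists_isModel (E := FunctionFieldOf (planePoly α L)) hα hL
  obtain ⟨T, Y, hTY⟩ := exists_isModel (E := FunctionFieldOf (planePoly β M)) hβ hM
  exact (hty.map e).exists_crossRatio hα hTY hβ hn hform

theorem finite_setOf_curvesIsomorphic {a : ℤ} (ha0 : 0 < a) (ha : ∀ t : ℤ, t ^ 3 ≠ a) {m : ℕ}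
    (hm : 0 < m) {c : ℤ} (hc : m < c) {M : ℤ} (hM : M ≠ 0) (L : ℤ → ℤ) :
    {d : ℤ | m < d ∧ L d ≠ 0 ∧
      CurvesIsomorphic (affinePoly a M fun j ↦ ((1 : ℤ), paramFamily m c j))
        (affinePoly a (L d) fun j ↦ ((1 : ℤ), paramFamily m d j))}.Finite := by
  obtain ⟨θ, hθ, hθa⟩ := exists_cube_root_pos ha0
  obtain ⟨w, hw⟩ : ∃ w : ℂ, IsPrimitiveRoot w 3 :=
    ⟨_, Complex.isPrimitiveRoot_exp 3 three_ne_zero⟩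
  have hinj : ∀ {d : ℤ}, m < d → Function.Injective (lineSlope w θ (paramFamily m d)) := fun hd ↦
    lineSlope_paramFamily_injective hw hθ hθa ha hd
  have hpoly : ∀ d N, affinePoly a N (fun j ↦ ((1 : ℤ), paramFamily m d j)) =
      planePoly (lineSlope w θ (paramFamily m d)) N := fun d N ↦
    affinePoly_eq_prod_lineSlope hw hθa _ N
  have hparam : ∀ d, paramFamily m d ⟨0, hm⟩ = d := fun d ↦ if_pos rfl
  have hc0 : (0 : ℝ) < c := by exact_mod_cast (by omega : 0 < c)
  have hform := not_exists_form (α := lineSlope w θ (paramFamily m c)) hw hθ hc0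
    (fun h ↦ ha c (by rw [← h] at hθa; exact_mod_cast hθa)) (fun i ↦ ⟨.inl i, rfl⟩)
    ⟨.inr (.inl ⟨0, hm⟩), by simp [lineSlope, hparam]⟩
  have hcard : 5 ≤ Fintype.card (Fin 3 ⊕ Fin m ⊕ Fin m) := by
    simp only [Fintype.card_sum, Fintype.card_fin]
    omega
  have key : ∀ d : {d : ℤ | m < d ∧ L d ≠ 0 ∧
      CurvesIsomorphic (affinePoly a M fun j ↦ ((1 : ℤ), paramFamily m c j))
        (affinePoly a (L d) fun j ↦ ((1 : ℤ), paramFamily m d j))}, _ := fun d ↦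
    exists_crossRatio (hinj hc) (hinj d.2.1) (Int.cast_ne_zero.2 hM) (Int.cast_ne_zero.2 d.2.2.1)
      hcard hform (by rw [← hpoly, ← hpoly]; exact d.2.2.2)
  choose σ hσ hσ' using key
  refine Set.finite_coe_iff.1 <| Finite.of_injective σ fun d e hde ↦ ?_
  have h1 := eq_of_crossRatio (hinj hc) (hσ d) (i := .inl 0) (j := .inl 1) (k := .inl 2)
    (l := .inr (.inl ⟨0, hm⟩)) (by simp) (by simp) (β := lineSlope w θ (paramFamily m d))
    (γ := lineSlope w θ (paramFamily m e))
    rfl rfl rfl ((hinj d.2.1).ne (a₁ := .inl 0) (a₂ := .inl 1) (by simp))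
    ((hinj d.2.1).ne (a₁ := .inl 2) (a₂ := .inl 1) (by simp))
    (hσ' d (.inl 0) (.inl 1) (by simp))
    (by rw [hde]; exact hσ' e (.inl 0) (.inl 1) (by simp))
  simp only [lineSlope, hparam] at h1
  have h2 := mul_right_cancel₀ (hw.ne_zero three_ne_zero) h1
  exact Subtype.ext (by exact_mod_cast h2)

theorem exists_infinite_pairwise_not {X : Type*} [Infinite X] (r : Setoid X)
    (hr : ∀ x, {y | r x y}.Finite) :
    ∃ T : Set X, T.Infinite ∧ ∀ x ∈ T, ∀ y ∈ T, x ≠ y → ¬ r x y := by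
  have hinf : Infinite (Quotient r) := by
    by_contra hfin
    rw [not_infinite_iff_finite] at hfin
    have h1 := Set.finite_iUnion fun q : Quotient r ↦ hr q.out
    refine Set.infinite_univ (h1.subset fun x _ ↦ ?_)
    exact Set.mem_iUnion.2 ⟨⟦x⟧, Quotient.mk_out x⟩
  refine ⟨Set.range (Quotient.out (s := r)), Set.infinite_range_of_injective Quotient.out_injective, ?_⟩
  rintro _ ⟨a, rfl⟩ _ ⟨b, rfl⟩ hab h
  exact hab (congrArg _ (Quotient.out_equiv_out.1 h))

end CyclicCurve

end IsomorphismClasses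

/-- **Theorem 1.1** (main theorem). Let `p` be an odd prime, `P = 2p` or `p` with
`P ≢ ±1 (mod 9)`, `ε = α + β P^{1/3} + γ P^{2/3} > 1` the fundamental unit of
`ℚ(P^{1/3})`, `ι` defined from `β, γ mod p`, and `n ≥ 5` an odd integer divisible by
`p^ι`.  Then there are infinitely many `(n-3)/2`-tuples `(b_j, c_j)` for which there are
infinitely many `L ∈ ℤ` such that
`(X³ + P^ι Y³) ∏_j (b_j²X² + b_j c_j XY + c_j²Y²) = L Z^n`
defines a non-singular plane curve of degree `n` violating the local-global principle;
moreover there is a set of such tuples giving infinitely many such curves that are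
pairwise non-isomorphic over `ℂ`. -/
theorem main_odd
    (p : ℕ) (hp : p.Prime) (hpodd : Odd p)
    (P : ℕ) (hP : P = 2 * p ∨ P = p) (hP9 : P % 9 ≠ 1 ∧ P % 9 ≠ 8)
    (α β γ : ℤ) (ε : ℝ)
    (hε : ε = (α : ℝ) + (β : ℝ) * cbrt P + (γ : ℝ) * (cbrt P) ^ 2)
    (hfund : IsFundamentalUnit P ε)
    (ι : ℕ)
    (hι : (ι = 1 ∧ (¬ (p : ℤ) ∣ β ∨ ((p : ℤ) ∣ β ∧ (p : ℤ) ∣ γ))) ∨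
          (ι = 2 ∧ (p : ℤ) ∣ β ∧ ¬ (p : ℤ) ∣ γ))
    (n : ℕ) (hn5 : 5 ≤ n) (hnodd : Odd n) (hdvd : p ^ ι ∣ n) :
    {bc : Fin ((n - 3) / 2) → ℤ × ℤ |
        {L : ℤ | GoodCurve ((P : ℤ) ^ ι) n bc L}.Infinite}.Infinite ∧
    ∃ S : Set (Fin ((n - 3) / 2) → ℤ × ℤ),
      (∀ bc ∈ S, {L : ℤ | GoodCurve ((P : ℤ) ^ ι) n bc L}.Infinite) ∧
      ∃ T : Set ((Fin ((n - 3) / 2) → ℤ × ℤ) × ℤ),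
        T.Infinite ∧
        (∀ x ∈ T, x.1 ∈ S ∧ GoodCurve ((P : ℤ) ^ ι) n x.1 x.2) ∧
        (∀ x ∈ T, ∀ y ∈ T, x ≠ y →
          ¬ CurvesIsomorphic (affinePoly ((P : ℤ) ^ ι) x.2 x.1)
              (affinePoly ((P : ℤ) ^ ι) y.2 y.1)) := by
  have hι' : ι = 1 ∨ ι = 2 := by tauto
  have ha := pow_ne_cube hp hpodd hP hι'
  obtain ⟨q, r, hq, hq3, hqa, hqr⟩ := exists_auxiliary_prime (ι := ι) hp hpodd hP hP9.1
  have hP0 : 0 < P := by have := hp.pos; omega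
  have ha0 : 0 < (P : ℤ) ^ ι := by positivity
  obtain ⟨m, hm⟩ : ∃ m, (n - 3) / 2 = m := ⟨_, rfl⟩
  have hn : n = 3 + 2 * m := by
    obtain ⟨k, rfl⟩ := hnodd
    omega
  have hm0 : 0 < m := by omega
  have hpn : p ∣ n := (dvd_pow_self p (by omega)).trans hdvd
  rw [hm]
  let bc : ℤ → Fin m → ℤ × ℤ := fun c j ↦ (1, paramFamily m c j)
  have hbc : Function.Injective bc := fun c d h ↦ by
    have := congrArg Prod.snd (congrFun h ⟨0, hm0⟩)
    simpa [bc, paramFamily] using this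
  let I : Set ℤ := {c | (m : ℤ) < c ∧ ((q ^ 2 : ℕ) : ℤ) ∣ c - r}
  have hgood : ∀ c ∈ I, {L : ℤ | L ≠ 0 ∧ GoodCurve ((P : ℤ) ^ ι) n (bc c) L}.Infinite :=
    fun c hc ↦ infinite_setOf_goodCurve ha0 ha hq hq3 hqa hp hpodd hm0 hn hpn hc.1
      (hqr c hc.2).1 (hqr c hc.2).2
  have hgood' : ∀ c ∈ I, {L : ℤ | GoodCurve ((P : ℤ) ^ ι) n (bc c) L}.Infinite :=
    fun c hc ↦ (hgood c hc).mono fun L hL ↦ hL.2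
  have hI : I.Infinite := by
    refine Set.infinite_of_not_bddAbove ?_
    rintro ⟨B, hB⟩
    have hq0 : (1 : ℤ) ≤ ((q ^ 2 : ℕ) : ℤ) := by exact_mod_cast pow_pos hq.pos 2
    have hmem : r + ((q ^ 2 : ℕ) : ℤ) * (|r| + |B| + m + 1) ∈ I := by
      refine ⟨?_, by simp⟩
      nlinarith [neg_abs_le r, abs_nonneg r, abs_nonneg B]
    have := hB hmem
    nlinarith [neg_abs_le r, abs_nonneg r, abs_nonneg B, le_abs_self B]
  have hIinf := hI.to_subtype
  refine ⟨(hI.image hbc.injOn).mono ?_, bc '' I, ?_, ?_⟩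
  · rintro _ ⟨c, hc, rfl⟩
    exact hgood' c hc
  · rintro _ ⟨c, hc, rfl⟩
    exact hgood' c hc
  have hL : ∀ c : ℤ, ∃ L : ℤ, c ∈ I → L ≠ 0 ∧ GoodCurve ((P : ℤ) ^ ι) n (bc c) L := fun c ↦ by
    by_cases hc : c ∈ I
    · obtain ⟨L, hL⟩ := (hgood c hc).nonempty
      exact ⟨L, fun _ ↦ hL⟩
    · exact ⟨0, fun h ↦ absurd h hc⟩
  choose L hL using hL
  let iso : Setoid I :=
    { r := fun c d ↦ CurvesIsomorphic (affinePoly ((P : ℤ) ^ ι) (L c) (bc c))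
        (affinePoly ((P : ℤ) ^ ι) (L d) (bc d))
      iseqv := ⟨fun _ ↦ ⟨AlgEquiv.refl⟩, fun ⟨e⟩ ↦ ⟨e.symm⟩, fun ⟨e⟩ ⟨f⟩ ↦ ⟨e.trans f⟩⟩ }
  obtain ⟨T, hT, hT'⟩ := CyclicCurve.exists_infinite_pairwise_not iso fun c ↦ by
    have h := CyclicCurve.finite_setOf_curvesIsomorphic ha0 ha hm0 c.2.1 (hL c c.2).1 L
    exact (h.preimage Subtype.val_injective.injOn).subset fun d hd ↦
      ⟨d.2.1, (hL d d.2).1, hd⟩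
  refine ⟨(fun c : I ↦ (bc c, L c)) '' T, hT.image fun c _ d _ h ↦ ?_, ?_, ?_⟩
  · exact Subtype.ext (hbc (congrArg Prod.fst h))
  · rintro _ ⟨c, -, rfl⟩
    exact ⟨⟨c, c.2, rfl⟩, (hL c c.2).2⟩
  · rintro _ ⟨c, hc, rfl⟩ _ ⟨d, hd, rfl⟩ hcd
    exact hT' c hc d hd fun h ↦ hcd (by rw [h])
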